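/- arXiv:math/0112155 — 2 statements merged into one kernel-verified Lean document; each statement's English description precedes it below -/
import Mathlib

section
/- The pairing ⟨·,·⟩ : B ⊗ Ū → ℂ between the quantum Grassmannian B = O_q(Gr(r,N)) and Ū = U/K⁺U is nondegenerate. -/
noncomputable section

open scoped TensorProduct

/-- Cartan integers of `sl_N`. -/
def cartanSL (i j : ℕ) : ℤ :=
  if i = j then 2 else if ((i : ℤ) - j).natAbs = 1 then -1 else 0

/-- The defining relations of `U_q(sl_N)` for a candidate family of generators. -/
def UqslRels (q : ℝ) (N : ℕ) {V : Type} [Ring V] [Algebra ℂ V]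
    (e f kg ki : ℕ → V) : Prop :=
  (∀ i ∈ Finset.Icc 1 (N - 1), kg i * ki i = 1 ∧ ki i * kg i = 1) ∧
  (∀ i ∈ Finset.Icc 1 (N - 1), ∀ j ∈ Finset.Icc 1 (N - 1),
      kg i * kg j = kg j * kg i) ∧
  (∀ i ∈ Finset.Icc 1 (N - 1), ∀ j ∈ Finset.Icc 1 (N - 1),
      kg i * e j = ((q : ℂ) ^ (cartanSL i j)) • (e j * kg i)) ∧
  (∀ i ∈ Finset.Icc 1 (N - 1), ∀ j ∈ Finset.Icc 1 (N - 1),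
      kg i * f j = ((q : ℂ) ^ (-cartanSL i j)) • (f j * kg i)) ∧
  (∀ i ∈ Finset.Icc 1 (N - 1), ∀ j ∈ Finset.Icc 1 (N - 1),
      e i * f j - f j * e i =
        if i = j then (((q : ℂ) - (q : ℂ)⁻¹)⁻¹) • (kg i - ki i) else 0) ∧
  (∀ i ∈ Finset.Icc 1 (N - 1), ∀ j ∈ Finset.Icc 1 (N - 1), ((i : ℤ) - j).natAbs = 1 →
      e i * e i * e j - ((q : ℂ) + (q : ℂ)⁻¹) • (e i * e j * e i) + e j * e i * e i = 0) ∧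
  (∀ i ∈ Finset.Icc 1 (N - 1), ∀ j ∈ Finset.Icc 1 (N - 1), 2 ≤ ((i : ℤ) - j).natAbs →
      e i * e j = e j * e i) ∧
  (∀ i ∈ Finset.Icc 1 (N - 1), ∀ j ∈ Finset.Icc 1 (N - 1), ((i : ℤ) - j).natAbs = 1 →
      f i * f i * f j - ((q : ℂ) + (q : ℂ)⁻¹) • (f i * f j * f i) + f j * f i * f i = 0) ∧
  (∀ i ∈ Finset.Icc 1 (N - 1), ∀ j ∈ Finset.Icc 1 (N - 1), 2 ≤ ((i : ℤ) - j).natAbs →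
      f i * f j = f j * f i)

/-- The quantized enveloping algebra `U_q(sl_N)` together with its Hopf algebra
structure, generators, defining relations and universal property. -/
structure UqslData (q : ℝ) (N : ℕ) where
  U : Type
  [instRing : Ring U]
  [instHopf : HopfAlgebra ℂ U]
  E : ℕ → U
  F : ℕ → U
  Kg : ℕ → U
  Ki : ℕ → U
  rels : UqslRels q N E F Kg Ki
  comul_E : ∀ i ∈ Finset.Icc 1 (N - 1),
    Coalgebra.comul (R := ℂ) (E i) = E i ⊗ₜ[ℂ] 1 + Kg i ⊗ₜ[ℂ] E i
  comul_F : ∀ i ∈ Finset.Icc 1 (N - 1),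
    Coalgebra.comul (R := ℂ) (F i) = F i ⊗ₜ[ℂ] Ki i + 1 ⊗ₜ[ℂ] F i
  comul_Kg : ∀ i ∈ Finset.Icc 1 (N - 1),
    Coalgebra.comul (R := ℂ) (Kg i) = Kg i ⊗ₜ[ℂ] Kg i
  comul_Ki : ∀ i ∈ Finset.Icc 1 (N - 1),
    Coalgebra.comul (R := ℂ) (Ki i) = Ki i ⊗ₜ[ℂ] Ki i
  counit_E : ∀ i ∈ Finset.Icc 1 (N - 1), Coalgebra.counit (R := ℂ) (E i) = 0
  counit_F : ∀ i ∈ Finset.Icc 1 (N - 1), Coalgebra.counit (R := ℂ) (F i) = 0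
  counit_Kg : ∀ i ∈ Finset.Icc 1 (N - 1), Coalgebra.counit (R := ℂ) (Kg i) = 1
  counit_Ki : ∀ i ∈ Finset.Icc 1 (N - 1), Coalgebra.counit (R := ℂ) (Ki i) = 1
  gen : Algebra.adjoin ℂ
      {x : U | ∃ i ∈ Finset.Icc 1 (N - 1), x = E i ∨ x = F i ∨ x = Kg i ∨ x = Ki i} = ⊤
  univ : ∀ (V : Type) [Ring V] [Algebra ℂ V] (e f kg ki : ℕ → V),
      UqslRels q N e f kg ki → ∃ φ : U →ₐ[ℂ] V,
        ∀ i ∈ Finset.Icc 1 (N - 1),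
          φ (E i) = e i ∧ φ (F i) = f i ∧ φ (Kg i) = kg i ∧ φ (Ki i) = ki i

attribute [instance] UqslData.instRing UqslData.instHopf

namespace UqslData

variable {q : ℝ} {N : ℕ} (D : UqslData q N)

/-- Root vectors `E_{α_{i,i+d}}` (iterated `q`-commutators with respect to the
standard reduced decomposition of the longest Weyl group element). -/
def Ev : ℕ → ℕ → D.U
  | 0, i => D.E i
  | d + 1, i => D.E i * Ev d (i + 1) - (q : ℂ)⁻¹ • (Ev d (i + 1) * D.E i)

/-- Root vectors `F_{α_{i,i+d}}`. -/
def Fv : ℕ → ℕ → D.U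
  | 0, i => D.F i
  | d + 1, i => Fv d (i + 1) * D.F i - (q : ℂ)⁻¹ • (D.F i * Fv d (i + 1))

/-- The Hopf subalgebra `K` generated by `E_i, F_i (i ≠ r)` and all `K_j^{±1}`. -/
def Ksub (r : ℕ) : Subalgebra ℂ D.U :=
  Algebra.adjoin ℂ
    ({x : D.U | ∃ i ∈ Finset.Icc 1 (N - 1), i ≠ r ∧ (x = D.E i ∨ x = D.F i)} ∪
     {x : D.U | ∃ j ∈ Finset.Icc 1 (N - 1), x = D.Kg j ∨ x = D.Ki j})

/-- The subspace `K⁺U ⊆ U`. -/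
def Jsub (r : ℕ) : Submodule ℂ D.U :=
  Submodule.span ℂ
    {x : D.U | ∃ k ∈ D.Ksub r, Coalgebra.counit (R := ℂ) k = 0 ∧ ∃ u : D.U, x = k * u}

/-- The subspace `K⁺U ⊗ U + U ⊗ K⁺U` of `U ⊗ U`, i.e. the kernel of `π ⊗ π` where
`π : U → U/K⁺U` is the canonical projection. -/
def JUU (r : ℕ) : Submodule ℂ (D.U ⊗[ℂ] D.U) :=
  LinearMap.range (TensorProduct.map (D.Jsub r).subtype LinearMap.id) ⊔
  LinearMap.range (TensorProduct.map LinearMap.id (D.Jsub r).subtype)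

/-- `x ∈ U` represents a primitive element of the quotient coalgebra `Ū = U/K⁺U`. -/
def IsPrimitiveMod (r : ℕ) (x : D.U) : Prop :=
  Coalgebra.comul (R := ℂ) x - x ⊗ₜ[ℂ] 1 - 1 ⊗ₜ[ℂ] x ∈ D.JUU r

end UqslData

/-- Membership of the pair `(i,j)` in (the index set of) `Φ⁺_r`, the set of positive
roots `α_{ij} = α_i + ⋯ + α_j` of `sl_N` with `i ≤ r ≤ j`. -/
def inPhiR (N r : ℕ) (p : ℕ × ℕ) : Prop :=
  1 ≤ p.1 ∧ p.1 ≤ r ∧ r ≤ p.2 ∧ p.2 ≤ N - 1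



/-- The quantized function algebra `A = O_q(SL_N)` together with the nondegenerate Hopf
pairing with `U = U_q(sl_N)`:  `A` is a Hopf algebra generated by the matrix coefficients
`u^i_j` of the fundamental corepresentation, and the pairing is fixed by its values on
the generators (the fundamental representation of `U_q(sl_N)`). -/
structure QslnFun (q : ℝ) (N : ℕ) (D : UqslData q N) where
  A : Type
  [instRingA : Ring A]
  [instHopfA : HopfAlgebra ℂ A]
  u : ℕ → ℕ → A
  genA : Algebra.adjoin ℂ
      {x : A | ∃ i ∈ Finset.Icc 1 N, ∃ j ∈ Finset.Icc 1 N, x = u i j} = ⊤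
  comul_u : ∀ i ∈ Finset.Icc 1 N, ∀ j ∈ Finset.Icc 1 N,
    Coalgebra.comul (R := ℂ) (u i j) = ∑ k ∈ Finset.Icc 1 N, u i k ⊗ₜ[ℂ] u k j
  counit_u : ∀ i ∈ Finset.Icc 1 N, ∀ j ∈ Finset.Icc 1 N,
    Coalgebra.counit (R := ℂ) (u i j) = if i = j then 1 else 0
  pair : D.U →ₗ[ℂ] A →ₗ[ℂ] ℂ
  pair_mulU : ∀ (x y : D.U) (a : A), pair (x * y) a =
    LinearMap.mul' ℂ ℂ (TensorProduct.map (pair x) (pair y) (Coalgebra.comul (R := ℂ) a))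
  pair_mulA : ∀ (x : D.U) (a b : A), pair x (a * b) =
    LinearMap.mul' ℂ ℂ (TensorProduct.map (pair.flip a) (pair.flip b)
      (Coalgebra.comul (R := ℂ) x))
  pair_oneU : ∀ a : A, pair 1 a = Coalgebra.counit (R := ℂ) a
  pair_oneA : ∀ x : D.U, pair x 1 = Coalgebra.counit (R := ℂ) x
  pair_antipode : ∀ (x : D.U) (a : A),
    pair (HopfAlgebra.antipode (R := ℂ) x) a = pair x (HopfAlgebra.antipode (R := ℂ) a)
  pair_E : ∀ l ∈ Finset.Icc 1 (N - 1), ∀ i ∈ Finset.Icc 1 N, ∀ j ∈ Finset.Icc 1 N,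
    pair (D.E l) (u i j) = if i = l ∧ j = l + 1 then 1 else 0
  pair_F : ∀ l ∈ Finset.Icc 1 (N - 1), ∀ i ∈ Finset.Icc 1 N, ∀ j ∈ Finset.Icc 1 N,
    pair (D.F l) (u i j) = if i = l + 1 ∧ j = l then 1 else 0
  pair_Kg : ∀ l ∈ Finset.Icc 1 (N - 1), ∀ i ∈ Finset.Icc 1 N, ∀ j ∈ Finset.Icc 1 N,
    pair (D.Kg l) (u i j) =
      if i = j then (if i = l then (q : ℂ) else if i = l + 1 then (q : ℂ)⁻¹ else 1) else 0
  pair_Ki : ∀ l ∈ Finset.Icc 1 (N - 1), ∀ i ∈ Finset.Icc 1 N, ∀ j ∈ Finset.Icc 1 N,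
    pair (D.Ki l) (u i j) =
      if i = j then (if i = l then (q : ℂ)⁻¹ else if i = l + 1 then (q : ℂ) else 1) else 0
  nondegU : ∀ x : D.U, (∀ a : A, pair x a = 0) → x = 0
  nondegA : ∀ a : A, (∀ x : D.U, pair x a = 0) → a = 0

attribute [instance] QslnFun.instRingA QslnFun.instHopfA

namespace QslnFun

variable {q : ℝ} {N : ℕ} {D : UqslData q N} (P : QslnFun q N D)

/-- For `k : U`, the operator `a ↦ ⟨k, a₍₁₎⟩ a₍₂₎` on `A`. -/
def hitL (k : D.U) : P.A →ₗ[ℂ] P.A :=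
  TensorProduct.lift ((LinearMap.lsmul ℂ P.A).comp (P.pair k)) ∘ₗ
    Coalgebra.comul (R := ℂ)

/-- The quantum Grassmannian `B = O_q(Gr(r,N))` inside `A`, as the subspace
`{b ∈ A | ⟨k, b₍₁₎⟩ b₍₂₎ = 0 for all k ∈ K⁺}`. -/
def Bmod (r : ℕ) : Submodule ℂ P.A :=
  ⨅ k : ↥(D.Ksub r),
    LinearMap.ker (P.hitL ((k : D.U) - algebraMap ℂ D.U
      (Coalgebra.counit (R := ℂ) (k : D.U))))

end QslnFun

/-- The pairing of a weight `c = ∑ c_i α_i` with the simple coroot `α_j^∨`. -/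
def corootPair (c : ℕ → ℤ) (j : ℕ) : ℤ := 2 * c j - c (j - 1) - c (j + 1)

/-- The `j`-th coordinate of a weight `c = ∑ c_i α_i` in the standard basis. -/
def stdCoord (c : ℕ → ℤ) (j : ℕ) : ℤ := c j - c (j - 1)

/-- The simple root `α_i`. -/
abbrev simpleRoot (i : ℕ) : ℕ → ℤ := Pi.single i 1

lemma corootPair_add (c d : ℕ → ℤ) (j : ℕ) :
    corootPair (c + d) j = corootPair c j + corootPair d j := by
  simp only [corootPair, Pi.add_apply]; ring

lemma corootPair_sub (c d : ℕ → ℤ) (j : ℕ) :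
    corootPair (c - d) j = corootPair c j - corootPair d j := by
  simp only [corootPair, Pi.sub_apply]; ring

lemma corootPair_neg (c : ℕ → ℤ) (j : ℕ) : corootPair (-c) j = -corootPair c j := by
  simp only [corootPair, Pi.neg_apply]; ring

lemma stdCoord_add (c d : ℕ → ℤ) (j : ℕ) :
    stdCoord (c + d) j = stdCoord c j + stdCoord d j := by
  simp only [stdCoord, Pi.add_apply]; ring

@[simp] lemma corootPair_zero (j : ℕ) : corootPair 0 j = 0 := by simp [corootPair]

@[simp] lemma stdCoord_zero (j : ℕ) : stdCoord 0 j = 0 := by simp [stdCoord]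

lemma corootPair_eq_sub (c : ℕ → ℤ) (j : ℕ) :
    corootPair c j = stdCoord c j - stdCoord c (j + 1) := by
  simp only [corootPair, stdCoord, Nat.add_sub_cancel]; ring

lemma corootPair_simpleRoot {i j : ℕ} (hi : 1 ≤ i) (hj : 1 ≤ j) :
    corootPair (simpleRoot i) j = cartanSL j i := by
  simp only [corootPair, cartanSL, Pi.single_apply]
  split_ifs <;> omega

lemma cartanSL_comm (i j : ℕ) : cartanSL i j = cartanSL j i := by
  simp only [cartanSL]
  split_ifs <;> omega

lemma stdCoord_simpleRoot {i j : ℕ} (hj : 1 ≤ j) :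
    stdCoord (simpleRoot i) j = (if j = i then 1 else 0) - (if j = i + 1 then 1 else 0) := by
  simp only [stdCoord, Pi.single_apply]
  split_ifs <;> omega

/-- A weight supported on the simple roots `α_1, …, α_{N-1}` which is orthogonal to all simple
coroots vanishes. -/
lemma eq_zero_of_corootPair_eq_zero {N : ℕ} {c : ℕ → ℤ} (hc : ∀ i, ¬(1 ≤ i ∧ i < N) → c i = 0)
    (h : ∀ j, 1 ≤ j → j < N → corootPair c j = 0) : c = 0 := by
  have h0 : c 0 = 0 := hc 0 (by omega)
  have key : ∀ j, j ≤ N → c j = j * c 1 := by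
    intro j
    induction j using Nat.strong_induction_on with
    | _ j ih =>
      intro hj
      match j with
      | 0 => simp [h0]
      | 1 => simp
      | j + 2 =>
        have h1 := h (j + 1) (by omega) (by omega)
        have h2 := ih j (by omega) (by omega)
        have h3 := ih (j + 1) (by omega) (by omega)
        simp only [corootPair, Nat.add_sub_cancel] at h1
        push_cast at *
        linarith
  funext i
  by_cases hi : 1 ≤ i ∧ i < N
  · have hN := key N le_rfl
    rw [hc N (by omega)] at hN
    have hN0 : (N : ℤ) ≠ 0 := by omega
    have h1 : c 1 = 0 := by
      rcases mul_eq_zero.mp hN.symm with h | h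
      · exact absurd h hN0
      · exact h
    simp [key i hi.2.le, h1]
  · exact hc i hi

section LinearAlgebra

variable {M ι κ : Type*} [AddCommGroup M] [Module ℂ M]

/-- If a sum of joint eigenvectors with distinct joint eigenvalues lies in a stable subspace then
so does each summand. -/
lemma mem_of_sum_eigenvectors_mem (I : Submodule ℂ M) (T : ι → M →ₗ[ℂ] M)
    (hT : ∀ j, ∀ x ∈ I, T j x ∈ I) (χ : κ → ι → ℂ) (s : Finset κ)
    (hχ : ∀ a ∈ s, ∀ b ∈ s, χ a = χ b → a = b) (x : κ → M)
    (hx : ∀ c ∈ s, ∀ j, T j (x c) = χ c j • x c) (hs : ∑ c ∈ s, x c ∈ I) :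
    ∀ c ∈ s, x c ∈ I := by
  classical
  induction s using Finset.induction_on generalizing x with
  | empty => simp
  | insert a s ha ih =>
    have hmem : ∀ c ∈ s, x c ∈ I := by
      intro c hc
      have hne : χ c ≠ χ a := fun h => ha
        (hχ c (Finset.mem_insert_of_mem hc) a (Finset.mem_insert_self _ _) h ▸ hc)
      obtain ⟨j, hj⟩ := Function.ne_iff.mp hne
      have := ih (fun a ha b hb => hχ a (Finset.mem_insert_of_mem ha) b
          (Finset.mem_insert_of_mem hb)) (fun c => (χ c j - χ a j) • x c)
        (fun c hc i => by
          rw [map_smul, hx c (Finset.mem_insert_of_mem hc), smul_comm]) (by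
          have h1 := I.sub_mem (hT j _ hs) (I.smul_mem (χ a j) hs)
          rw [map_sum, Finset.smul_sum, ← Finset.sum_sub_distrib, Finset.sum_insert ha,
            hx a (Finset.mem_insert_self _ _), sub_self, zero_add] at h1
          convert h1 using 1
          refine Finset.sum_congr rfl fun c hc => ?_
          rw [hx c (Finset.mem_insert_of_mem hc), sub_smul]) c hc
      exact (Submodule.smul_mem_iff _ (sub_ne_zero.mpr hj)).mp this
    intro c hc
    rcases Finset.mem_insert.mp hc with rfl | hc
    · rw [Finset.sum_insert ha] at hs
      exact (I.add_mem_iff_left (I.sum_mem hmem)).mp hs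
    · exact hmem c hc

/-- A subspace containing `1` and stable under right multiplication by a set contains the
subalgebra generated by this set. -/
lemma mem_of_mem_adjoin_of_mul_mem {R : Type*} [Ring R] [Algebra ℂ R] {S : Set R}
    {M : Submodule ℂ R} (h1 : 1 ∈ M) (hM : ∀ m ∈ M, ∀ s ∈ S, m * s ∈ M) {a : R}
    (ha : a ∈ Algebra.adjoin ℂ S) : a ∈ M := by
  suffices h : ∀ m ∈ M, m * a ∈ M by simpa using h 1 h1
  induction ha using Algebra.adjoin_induction with
  | mem x hx => exact fun m hm => hM m hm x hx
  | algebraMap c => intro m hm; rw [← Algebra.commutes, ← Algebra.smul_def]; exact M.smul_mem _ hm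
  | add x y _ _ hx hy => intro m hm; rw [mul_add]; exact M.add_mem (hx m hm) (hy m hm)
  | mul x y _ _ hx hy => intro m hm; rw [← mul_assoc]; exact hy _ (hx m hm)

end LinearAlgebra

/-- The part of the structure of `U_q(sl_N)`, its pairing with `O_q(SL_N)`, the right ideal
`J = K⁺U` and the quantum Grassmannian `B` which is symmetric under exchanging the two
triangular parts. Here `e i = E_i K_i⁻¹`, `f i = F_i`, and `s i j` is the antipode of `u i j`. -/
structure GrassPairing (U A : Type) [Ring U] [Bialgebra ℂ U] [Ring A] [Algebra ℂ A] where
  q : ℂ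
  N : ℕ
  r : ℕ
  e : ℕ → U
  f : ℕ → U
  k : ℕ → U
  k' : ℕ → U
  u : ℕ → ℕ → A
  s : ℕ → ℕ → A
  pair : U →ₗ[ℂ] A →ₗ[ℂ] ℂ
  J : Submodule ℂ U
  B : Subalgebra ℂ A
  q_ne : q ≠ 0
  q_zpow : ∀ n : ℤ, q ^ n = 1 → n = 0
  r_pos : 1 ≤ r
  r_lt : r < N
  k_mul_k' : ∀ i, 1 ≤ i → i < N → k i * k' i = 1
  k'_mul_k : ∀ i, 1 ≤ i → i < N → k' i * k i = 1
  k_mul_e : ∀ i, 1 ≤ i → i < N → ∀ j, 1 ≤ j → j < N →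
    k i * e j = q ^ cartanSL i j • (e j * k i)
  k_mul_f : ∀ i, 1 ≤ i → i < N → ∀ j, 1 ≤ j → j < N →
    k i * f j = q ^ (-cartanSL i j) • (f j * k i)
  e_mul_f : ∀ i, 1 ≤ i → i < N → ∀ j, 1 ≤ j → j < N →
    e i * f j = q ^ cartanSL i j • (f j * e i) +
      if i = j then (q ^ 2 * (q - q⁻¹)⁻¹) • (1 - k' i * k' i) else 0
  comul_e : ∀ i, 1 ≤ i → i < N →
    Coalgebra.comul (R := ℂ) (e i) = e i ⊗ₜ[ℂ] k' i + 1 ⊗ₜ[ℂ] e i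
  comul_f : ∀ i, 1 ≤ i → i < N →
    Coalgebra.comul (R := ℂ) (f i) = f i ⊗ₜ[ℂ] k' i + 1 ⊗ₜ[ℂ] f i
  comul_k : ∀ i, 1 ≤ i → i < N → Coalgebra.comul (R := ℂ) (k i) = k i ⊗ₜ[ℂ] k i
  comul_k' : ∀ i, 1 ≤ i → i < N → Coalgebra.comul (R := ℂ) (k' i) = k' i ⊗ₜ[ℂ] k' i
  gen : Algebra.adjoin ℂ
    {x : U | ∃ i, (1 ≤ i ∧ i < N) ∧ (x = e i ∨ x = f i ∨ x = k i ∨ x = k' i)} = ⊤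
  genA : Algebra.adjoin ℂ
    {x : A | ∃ i j, (1 ≤ i ∧ i ≤ N) ∧ (1 ≤ j ∧ j ≤ N) ∧ x = u i j} = ⊤
  pair_e : ∀ l, 1 ≤ l → l < N → ∀ i, 1 ≤ i → i ≤ N → ∀ j, 1 ≤ j → j ≤ N →
    pair (e l) (u i j) = if i = l ∧ j = l + 1 then q else 0
  pair_f : ∀ l, 1 ≤ l → l < N → ∀ i, 1 ≤ i → i ≤ N → ∀ j, 1 ≤ j → j ≤ N →
    pair (f l) (u i j) = if i = l + 1 ∧ j = l then 1 else 0
  pair_k : ∀ l, 1 ≤ l → l < N → ∀ i, 1 ≤ i → i ≤ N → ∀ j, 1 ≤ j → j ≤ N →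
    pair (k l) (u i j) = if i = j then q ^ stdCoord (simpleRoot l) i else 0
  pair_k' : ∀ l, 1 ≤ l → l < N → ∀ i, 1 ≤ i → i ≤ N → ∀ j, 1 ≤ j → j ≤ N →
    pair (k' l) (u i j) = if i = j then q ^ (-stdCoord (simpleRoot l) i) else 0
  pair_one_u : ∀ i, 1 ≤ i → i ≤ N → ∀ j, 1 ≤ j → j ≤ N →
    pair 1 (u i j) = if i = j then 1 else 0
  pair_one_s : ∀ i, 1 ≤ i → i ≤ N → ∀ j, 1 ≤ j → j ≤ N →
    pair 1 (s i j) = if i = j then 1 else 0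
  pair_mul_u : ∀ x y, ∀ i, 1 ≤ i → i ≤ N → ∀ j, 1 ≤ j → j ≤ N →
    pair (x * y) (u i j) = ∑ m ∈ Finset.Icc 1 N, pair x (u i m) * pair y (u m j)
  pair_mul_s : ∀ x y, ∀ i, 1 ≤ i → i ≤ N → ∀ j, 1 ≤ j → j ≤ N →
    pair (x * y) (s i j) = ∑ m ∈ Finset.Icc 1 N, pair y (s i m) * pair x (s m j)
  s_mul_u : ∀ i, 1 ≤ i → i ≤ N → ∀ j, 1 ≤ j → j ≤ N →
    ∑ m ∈ Finset.Icc 1 N, s i m * u m j = if i = j then 1 else 0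
  pair_mul : ∀ x a b, pair x (a * b) = LinearMap.mul' ℂ ℂ
    (TensorProduct.map (pair.flip a) (pair.flip b) (Coalgebra.comul (R := ℂ) x))
  pair_one : ∀ x, pair x 1 = Coalgebra.counit (R := ℂ) x
  pair_nondeg : ∀ x, (∀ a, pair x a = 0) → x = 0
  translate : ∀ y b, ∃ b', ∀ x, pair x b' = pair (x * y) b
  J_mul : ∀ x ∈ J, ∀ y, x * y ∈ J
  J_e : ∀ i, 1 ≤ i → i < N → i ≠ r → e i ∈ J
  J_f : ∀ i, 1 ≤ i → i < N → i ≠ r → f i ∈ J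
  J_k : ∀ i, 1 ≤ i → i < N → k i - 1 ∈ J
  J_k' : ∀ i, 1 ≤ i → i < N → k' i - 1 ∈ J
  pair_J_B : ∀ x ∈ J, ∀ b ∈ B, pair x b = 0
  mem_B : ∀ b, (∀ i, 1 ≤ i → i < N → i ≠ r → ∀ x, pair (e i * x) b = 0) →
    (∀ i, 1 ≤ i → i < N → i ≠ r → ∀ x, pair (f i * x) b = 0) →
    (∀ i, 1 ≤ i → i < N → ∀ x, pair (k i * x) b = pair x b) → 
    (∀ i, 1 ≤ i → i < N → ∀ x, pair (k' i * x) b = pair x b) → b ∈ B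

namespace GrassPairing

variable {U A : Type} [Ring U] [Bialgebra ℂ U] [Ring A] [Algebra ℂ A] (P : GrassPairing U A)

lemma zpow_inj {m n : ℤ} (h : P.q ^ m = P.q ^ n) : m = n := by
  have := P.q_zpow (m - n) (by rw [zpow_sub₀ P.q_ne, h, div_self (zpow_ne_zero _ P.q_ne)])
  omega

lemma q_sub_inv_ne : P.q - P.q⁻¹ ≠ 0 := by
  intro h
  have := P.zpow_inj (m := 1) (n := -1) (by simpa using sub_eq_zero.mp h)
  omega

/-- The operator `x ↦ x₍₁₎ ⟨x₍₂₎, a⟩`. -/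
def del : A →ₗ[ℂ] U →ₗ[ℂ] U where
  toFun a := (TensorProduct.rid ℂ U).toLinearMap ∘ₗ
    LinearMap.lTensor U (P.pair.flip a) ∘ₗ Coalgebra.comul (R := ℂ)
  map_add' a b := by
    ext x
    simp [LinearMap.lTensor_add]
  map_smul' c a := by
    ext x
    simp [LinearMap.lTensor_smul]

lemma del_apply (a : A) (x : U) : P.del a x = TensorProduct.rid ℂ U
    (LinearMap.lTensor U (P.pair.flip a) (Coalgebra.comul (R := ℂ) x)) := rfl

lemma pair_del (a c : A) (x : U) : P.pair (P.del a x) c = P.pair x (c * a) := by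
  rw [del_apply, P.pair_mul]
  induction Coalgebra.comul (R := ℂ) x with
  | zero => simp
  | add y z hy hz => simp only [map_add, LinearMap.add_apply, hy, hz]
  | tmul y z => simp [mul_comm]

lemma ext_pair {x y : U} (h : ∀ a, P.pair x a = P.pair y a) : x = y :=
  sub_eq_zero.mp (P.pair_nondeg _ fun a => by simp [h])

lemma del_one (x : U) : P.del 1 x = x := P.ext_pair fun a => by rw [pair_del, mul_one]

lemma del_mul (a b : A) (x : U) : P.del (a * b) x = P.del a (P.del b x) :=
  P.ext_pair fun c => by rw [pair_del, pair_del, pair_del, mul_assoc]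

lemma del_u_mul {i j : ℕ} (hi : 1 ≤ i) (hi' : i ≤ P.N) (hj : 1 ≤ j) (hj' : j ≤ P.N) (x y : U) :
    P.del (P.u i j) (x * y) =
      ∑ m ∈ Finset.Icc 1 P.N, P.del (P.u i m) x * P.del (P.u m j) y := by
  simp only [del_apply, Bialgebra.comul_mul]
  induction Coalgebra.comul (R := ℂ) x with
  | zero => simp
  | add a b ha hb => simp only [add_mul, map_add, ha, hb, Finset.sum_add_distrib]
  | tmul a b =>
    induction Coalgebra.comul (R := ℂ) y with
    | zero => simp
    | add c d hc hd => simp only [mul_add, map_add, hc, hd, Finset.sum_add_distrib]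
    | tmul c d =>
      simp only [Algebra.TensorProduct.tmul_mul_tmul, LinearMap.lTensor_tmul,
        TensorProduct.rid_tmul, LinearMap.flip_apply, P.pair_mul_u b d i hi hi' j hj hj',
        Finset.sum_smul, smul_mul_smul_comm]

lemma del_of_comul {x y : U} (h : Coalgebra.comul (R := ℂ) x = x ⊗ₜ[ℂ] y + 1 ⊗ₜ[ℂ] x) (a : A) :
    P.del a x = P.pair y a • x + P.pair x a • 1 := by
  simp [del_apply, h]

lemma del_e {i : ℕ} (hi : 1 ≤ i) (hi' : i < P.N) (a : A) :
    P.del a (P.e i) = P.pair (P.k' i) a • P.e i + P.pair (P.e i) a • 1 :=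
  P.del_of_comul (P.comul_e i hi hi') a

/-- The annihilator of `B` in `U`. -/
def I : Submodule ℂ U where
  carrier := {x | ∀ b ∈ P.B, P.pair x b = 0}
  add_mem' hx hy b hb := by simp [hx b hb, hy b hb]
  zero_mem' b hb := by simp
  smul_mem' c x hx b hb := by simp [hx b hb]

lemma J_le_I : P.J ≤ P.I := fun x hx b hb => P.pair_J_B x hx b hb

lemma del_mem_I {b : A} (hb : b ∈ P.B) {x : U} (hx : x ∈ P.I) : P.del b x ∈ P.I :=
  fun c hc => by rw [pair_del]; exact hx _ (P.B.mul_mem hc hb)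

lemma counit_of_mem_I {x : U} (hx : x ∈ P.I) : Coalgebra.counit (R := ℂ) x = 0 := by
  rw [← P.pair_one]; exact hx 1 P.B.one_mem

lemma J_e_mul {i : ℕ} (hi : 1 ≤ i) (hi' : i < P.N) (hr : i ≠ P.r) (x : U) : P.e i * x ∈ P.J :=
  P.J_mul _ (P.J_e i hi hi' hr) x

lemma J_f_mul {i : ℕ} (hi : 1 ≤ i) (hi' : i < P.N) (hr : i ≠ P.r) (x : U) : P.f i * x ∈ P.J :=
  P.J_mul _ (P.J_f i hi hi' hr) x

lemma J_k_mul_sub {i : ℕ} (hi : 1 ≤ i) (hi' : i < P.N) (x : U) : P.k i * x - x ∈ P.J := by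
  simpa [sub_mul] using P.J_mul _ (P.J_k i hi hi') x

lemma J_k'_mul_sub {i : ℕ} (hi : 1 ≤ i) (hi' : i < P.N) (x : U) : P.k' i * x - x ∈ P.J := by
  simpa [sub_mul] using P.J_mul _ (P.J_k' i hi hi') x

lemma pair_k_mul {i : ℕ} (hi : 1 ≤ i) (hi' : i < P.N) (x : U) {b : A} (hb : b ∈ P.B) :
    P.pair (P.k i * x) b = P.pair x b := by
  have := P.pair_J_B _ (P.J_k_mul_sub hi hi' x) b hb
  simpa [sub_eq_zero] using this

lemma pair_k'_mul {i : ℕ} (hi : 1 ≤ i) (hi' : i < P.N) (x : U) {b : A} (hb : b ∈ P.B) :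
    P.pair (P.k' i * x) b = P.pair x b := by
  have := P.pair_J_B _ (P.J_k'_mul_sub hi hi' x) b hb
  simpa [sub_eq_zero] using this

/-- The annihilator of `B` is a right ideal. -/
lemma I_mul {x : U} (hx : x ∈ P.I) (y : U) : x * y ∈ P.I := by
  intro b hb
  obtain ⟨b', hb'⟩ := P.translate y b
  have : b' ∈ P.B := by
    refine P.mem_B b' (fun i hi hi' hr z => ?_) (fun i hi hi' hr z => ?_) (fun i hi hi' z => ?_)
      (fun i hi hi' z => ?_)
    · rw [hb', mul_assoc]; exact P.pair_J_B _ (P.J_e_mul hi hi' hr _) b hb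
    · rw [hb', mul_assoc]; exact P.pair_J_B _ (P.J_f_mul hi hi' hr _) b hb
    · rw [hb', hb', mul_assoc, P.pair_k_mul hi hi' _ hb]
    · rw [hb', hb', mul_assoc, P.pair_k'_mul hi hi' _ hb]
  rw [← hb']
  exact hx b' this

lemma k_mul_mem_I {i : ℕ} (hi : 1 ≤ i) (hi' : i < P.N) {x : U} (hx : x ∈ P.I) :
    P.k i * x ∈ P.I := fun b hb => by rw [P.pair_k_mul hi hi' x hb]; exact hx b hb

end GrassPairing

namespace GrassPairing

variable {U A : Type} [Ring U] [Bialgebra ℂ U] [Ring A] [Algebra ℂ A] (P : GrassPairing U A)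

/-- The weight space of weight `c` for the adjoint action of the torus. -/
def wt (c : ℕ → ℤ) : Submodule ℂ U where
  carrier := {x | ∀ l, 1 ≤ l → l < P.N → P.k l * x = P.q ^ corootPair c l • (x * P.k l)}
  add_mem' hx hy l hl hl' := by rw [mul_add, hx l hl hl', hy l hl hl', add_mul, smul_add]
  zero_mem' l _ _ := by simp
  smul_mem' t x hx l hl hl' := by
    rw [mul_smul_comm, hx l hl hl', smul_mul_assoc, smul_comm]

variable {P}

lemma one_mem_wt : (1 : U) ∈ P.wt 0 := fun l _ _ => by simp

lemma mul_mem_wt {c d : ℕ → ℤ} {x y : U} (hx : x ∈ P.wt c) (hy : y ∈ P.wt d) :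
    x * y ∈ P.wt (c + d) := fun l hl hl' => by
  rw [← mul_assoc, hx l hl hl', smul_mul_assoc, mul_assoc, hy l hl hl', mul_smul_comm, smul_smul,
    corootPair_add, zpow_add₀ P.q_ne, mul_assoc]

lemma e_mem_wt {i : ℕ} (hi : 1 ≤ i) (hi' : i < P.N) : P.e i ∈ P.wt (simpleRoot i) :=
  fun l hl hl' => by rw [P.k_mul_e l hl hl' i hi hi', corootPair_simpleRoot hi hl]

lemma f_mem_wt {i : ℕ} (hi : 1 ≤ i) (hi' : i < P.N) : P.f i ∈ P.wt (-simpleRoot i) :=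
  fun l hl hl' => by
    rw [P.k_mul_f l hl hl' i hi hi', corootPair_neg, corootPair_simpleRoot hi hl]

lemma k'_mul_of_mem_wt {c : ℕ → ℤ} {x : U} (hx : x ∈ P.wt c) {l : ℕ} (hl : 1 ≤ l)
    (hl' : l < P.N) : P.k' l * x = P.q ^ (-corootPair c l) • (x * P.k' l) := by
  have h := congrArg (fun z => P.k' l * z * P.k' l) (hx l hl hl')
  simp only [mul_smul_comm, smul_mul_assoc] at h
  rw [← mul_assoc, P.k'_mul_k l hl hl', one_mul, mul_assoc, mul_assoc, P.k_mul_k' l hl hl',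
    mul_one] at h
  rw [h, smul_smul, ← zpow_add₀ P.q_ne, neg_add_cancel, zpow_zero, one_smul]

variable (P) in
/-- Elements of weight `c` on which the operators `del (u i j)`, `j ≤ i`, act as they act on the
subalgebra generated by the `e i`. -/
def hw (c : ℕ → ℤ) : Submodule ℂ U where
  carrier := {x | x ∈ P.wt c ∧
    (∀ j, 1 ≤ j → j ≤ P.N → P.del (P.u j j) x = P.q ^ (-stdCoord c j) • x) ∧
    ∀ i j, 1 ≤ j → j < i → i ≤ P.N → P.del (P.u i j) x = 0}
  add_mem' hx hy := ⟨add_mem hx.1 hy.1,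
    fun j hj hj' => by rw [map_add, hx.2.1 j hj hj', hy.2.1 j hj hj', smul_add],
    fun i j h1 h2 h3 => by rw [map_add, hx.2.2 i j h1 h2 h3, hy.2.2 i j h1 h2 h3, add_zero]⟩
  zero_mem' := ⟨zero_mem _, fun j _ _ => by simp, fun i j _ _ _ => by simp⟩
  smul_mem' t x hx := ⟨Submodule.smul_mem _ _ hx.1,
    fun j hj hj' => by rw [map_smul, hx.2.1 j hj hj', smul_comm],
    fun i j h1 h2 h3 => by rw [map_smul, hx.2.2 i j h1 h2 h3, smul_zero]⟩

lemma one_mem_hw : (1 : U) ∈ P.hw 0 := by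
  have h : ∀ i j, 1 ≤ i → i ≤ P.N → 1 ≤ j → j ≤ P.N →
      P.del (P.u i j) 1 = (if i = j then (1 : ℂ) else 0) • (1 : U) := by
    intro i j hi hi' hj hj'
    simp [del_apply, Algebra.TensorProduct.one_def, P.pair_one_u i hi hi' j hj hj']
  refine ⟨one_mem_wt, fun j hj hj' => ?_, fun i j h1 h2 h3 => ?_⟩
  · simp [h j j hj hj' hj hj']
  · rw [h i j (by omega) h3 h1 (by omega), if_neg (by omega), zero_smul]

lemma e_mem_hw {i : ℕ} (hi : 1 ≤ i) (hi' : i < P.N) : P.e i ∈ P.hw (simpleRoot i) := by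
  refine ⟨e_mem_wt hi hi', fun j hj hj' => ?_, fun a b h1 h2 h3 => ?_⟩
  · rw [P.del_e hi hi', P.pair_k' i hi hi' j hj hj' j hj hj', P.pair_e i hi hi' j hj hj' j hj hj',
      if_pos rfl, if_neg (by omega), zero_smul, add_zero]
  · rw [P.del_e hi hi', P.pair_k' i hi hi' a (by omega) h3 b h1 (by omega),
      P.pair_e i hi hi' a (by omega) h3 b h1 (by omega), if_neg (by omega), if_neg (by omega),
      zero_smul, zero_smul, add_zero]

lemma mul_mem_hw {c d : ℕ → ℤ} {x y : U} (hx : x ∈ P.hw c) (hy : y ∈ P.hw d) :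
    x * y ∈ P.hw (c + d) := by
  refine ⟨mul_mem_wt hx.1 hy.1, fun j hj hj' => ?_, fun i j h1 h2 h3 => ?_⟩
  · rw [P.del_u_mul hj hj' hj hj', Finset.sum_eq_single_of_mem j (by simp; omega)]
    · rw [hx.2.1 j hj hj', hy.2.1 j hj hj', smul_mul_smul_comm, stdCoord_add, neg_add,
        zpow_add₀ P.q_ne]
    · intro m hm hmj
      rw [Finset.mem_Icc] at hm
      rcases lt_or_gt_of_ne hmj with h | h
      · rw [hx.2.2 j m hm.1 h hj', zero_mul]
      · rw [hy.2.2 m j hj h hm.2, mul_zero]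
  · rw [P.del_u_mul (by omega) h3 h1 (by omega)]
    refine Finset.sum_eq_zero fun m hm => ?_
    rw [Finset.mem_Icc] at hm
    by_cases h : m < i
    · rw [hx.2.2 i m hm.1 h h3, zero_mul]
    · rw [hy.2.2 m j h1 (by omega) hm.2, mul_zero]

variable (P)

/-- The skew derivation `q^{(c, ε_j)} del (u j (j+1))` on elements of weight `c`. -/
def dj (j : ℕ) (c : ℕ → ℤ) : U →ₗ[ℂ] U := P.q ^ stdCoord c j • P.del (P.u j (j + 1))

/-- The skew commutator with `f j` on elements of weight `c`. -/
def phi (j : ℕ) (c : ℕ → ℤ) : U →ₗ[ℂ] U :=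
  LinearMap.mulRight ℂ (P.f j) - P.q ^ corootPair c j • LinearMap.mulLeft ℂ (P.f j)

/-- The skew commutator with `e i` on elements of weight `c`. -/
def ad (i : ℕ) (c : ℕ → ℤ) : U →ₗ[ℂ] U :=
  LinearMap.mulRight ℂ (P.e i) - P.q ^ corootPair c i • LinearMap.mulLeft ℂ (P.e i)

variable {P}

lemma phi_apply (j : ℕ) (c : ℕ → ℤ) (x : U) :
    P.phi j c x = x * P.f j - P.q ^ corootPair c j • (P.f j * x) := by
  simp [phi]

lemma ad_apply (i : ℕ) (c : ℕ → ℤ) (x : U) :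
    P.ad i c x = x * P.e i - P.q ^ corootPair c i • (P.e i * x) := by
  simp [ad]

lemma dj_apply (j : ℕ) (c : ℕ → ℤ) (x : U) :
    P.dj j c x = P.q ^ stdCoord c j • P.del (P.u j (j + 1)) x := rfl

lemma phi_mul (j : ℕ) (c d : ℕ → ℤ) (x y : U) :
    P.phi j (c + d) (x * y) = x * P.phi j d y + P.q ^ corootPair d j • (P.phi j c x * y) := by
  simp only [phi_apply, corootPair_add, zpow_add₀ P.q_ne, mul_sub, sub_mul, smul_sub,
    mul_smul_comm, smul_mul_assoc, mul_assoc, smul_smul, mul_comm (P.q ^ corootPair c j)]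
  abel

lemma phi_e {i j : ℕ} (hi : 1 ≤ i) (hi' : i < P.N) (hj : 1 ≤ j) (hj' : j < P.N) :
    P.phi j (simpleRoot i) (P.e i) =
      if i = j then (P.q ^ 2 * (P.q - P.q⁻¹)⁻¹) • (1 - P.k' i * P.k' i) else 0 := by
  rw [phi_apply, P.e_mul_f i hi hi' j hj hj', corootPair_simpleRoot hi hj, cartanSL_comm j i]
  abel

lemma dj_e {i j : ℕ} (hi : 1 ≤ i) (hi' : i < P.N) (hj : 1 ≤ j) (hj' : j < P.N) :
    P.dj j (simpleRoot i) (P.e i) = if i = j then P.q ^ 2 • (1 : U) else 0 := by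
  rw [dj_apply, P.del_e hi hi', P.pair_k' i hi hi' j hj hj'.le (j + 1) (by omega) (by omega),
    P.pair_e i hi hi' j hj hj'.le (j + 1) (by omega) (by omega), stdCoord_simpleRoot hj]
  by_cases h : i = j
  · subst h
    simp [smul_smul, sq]
  · simp [h, Ne.symm h]

lemma dj_mul {j : ℕ} (hj : 1 ≤ j) (hj' : j < P.N) {c d : ℕ → ℤ} {x y : U} (hx : x ∈ P.hw c)
    (hy : y ∈ P.hw d) :
    P.dj j (c + d) (x * y) = x * P.dj j d y + P.q ^ corootPair d j • (P.dj j c x * y) := by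
  have key : P.del (P.u j (j + 1)) (x * y) = P.q ^ (-stdCoord c j) • (x * P.del (P.u j (j + 1)) y) +
      P.q ^ (-stdCoord d (j + 1)) • (P.del (P.u j (j + 1)) x * y) := by
    rw [P.del_u_mul hj hj'.le (by omega) (by omega),
      Finset.sum_eq_add_of_mem j (j + 1) (by simp; omega) (by simp; omega) (by omega)]
    · rw [hx.2.1 j hj hj'.le, hy.2.1 (j + 1) (by omega) (by omega), smul_mul_assoc,
        mul_smul_comm]
    · intro m hm hmj
      rw [Finset.mem_Icc] at hm
      rcases lt_or_ge m j with h | h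
      · rw [hx.2.2 j m hm.1 h hj'.le, zero_mul]
      · rw [hy.2.2 m (j + 1) (by omega) (by omega) hm.2, mul_zero]
  simp only [dj_apply, key, smul_add, smul_smul, mul_smul_comm, smul_mul_assoc,
    ← zpow_add₀ P.q_ne, stdCoord_add, corootPair_eq_sub]
  congr 3 <;> ring

lemma phi_ad {i j : ℕ} (hi : 1 ≤ i) (hi' : i < P.N) (hj : 1 ≤ j) (hj' : j < P.N) {c : ℕ → ℤ}
    {x : U} (hx : x ∈ P.wt c) : P.phi j (c + simpleRoot i) (P.ad i c x) =
      P.q ^ cartanSL i j • (P.phi j c x * P.e i) - P.q ^ corootPair c i • (P.e i * P.phi j c x) +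
        if i = j then (P.q ^ 2 * (P.q - P.q⁻¹)⁻¹ * (1 - P.q ^ (2 * corootPair c j))) • x
        else 0 := by
  rw [ad_apply, map_sub, map_smul, phi_mul, phi_e hi hi' hj hj', add_comm c, phi_mul,
    phi_e hi hi' hj hj', corootPair_simpleRoot hi hj, cartanSL_comm j i]
  by_cases h : i = j
  · subst h
    have h1 : P.k' i * P.k' i * x = P.q ^ (-(2 * corootPair c i)) • (x * (P.k' i * P.k' i)) := by
      rw [mul_assoc, k'_mul_of_mem_wt hx hi hi', mul_smul_comm, ← mul_assoc,
        k'_mul_of_mem_wt hx hi hi', smul_mul_assoc, smul_smul, ← zpow_add₀ P.q_ne, mul_assoc]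
      congr 2; ring
    have h2 : P.q ^ (2 * corootPair c i) * P.q ^ (-(2 * corootPair c i)) = 1 := by
      rw [← zpow_add₀ P.q_ne]; simp
    have h3 : P.q ^ corootPair c i * P.q ^ corootPair c i = P.q ^ (2 * corootPair c i) := by
      rw [← zpow_add₀ P.q_ne, two_mul]
    simp only [if_true, smul_add, smul_mul_assoc, sub_mul, one_mul, mul_smul_comm, mul_sub,
      mul_one, h1, smul_sub, smul_smul, mul_assoc, sub_smul]
    rw [show P.q ^ corootPair c i * (P.q ^ corootPair c i * (P.q ^ 2 * ((P.q - P.q⁻¹)⁻¹ *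
      P.q ^ (-(2 * corootPair c i))))) = P.q ^ 2 * (P.q - P.q⁻¹)⁻¹ by
        linear_combination (P.q ^ 2 * (P.q - P.q⁻¹)⁻¹) * h2 +
          (P.q ^ 2 * (P.q - P.q⁻¹)⁻¹) * P.q ^ (-(2 * corootPair c i)) * h3,
      show P.q ^ corootPair c i * (P.q ^ corootPair c i * (P.q ^ 2 * ((P.q - P.q⁻¹)⁻¹))) =
        P.q ^ 2 * ((P.q - P.q⁻¹)⁻¹ * P.q ^ (2 * corootPair c i)) by
        linear_combination (P.q ^ 2 * (P.q - P.q⁻¹)⁻¹) * h3]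
    module
  · simp only [if_neg h]
    simp only [mul_zero, zero_mul, smul_zero, add_zero, zero_add]

lemma dj_ad {i j : ℕ} (hi : 1 ≤ i) (hi' : i < P.N) (hj : 1 ≤ j) (hj' : j < P.N) {c : ℕ → ℤ}
    {x : U} (hx : x ∈ P.hw c) : P.dj j (c + simpleRoot i) (P.ad i c x) =
      P.q ^ cartanSL i j • (P.dj j c x * P.e i) - P.q ^ corootPair c i • (P.e i * P.dj j c x) +
        if i = j then (P.q ^ 2 * (1 - P.q ^ (2 * corootPair c j))) • x else 0 := by
  rw [ad_apply, map_sub, map_smul, dj_mul hj hj' hx (e_mem_hw hi hi'), dj_e hi hi' hj hj',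
    add_comm c, dj_mul hj hj' (e_mem_hw hi hi') hx, dj_e hi hi' hj hj',
    corootPair_simpleRoot hi hj, cartanSL_comm j i]
  by_cases h : i = j
  · subst h
    rw [two_mul, zpow_add₀ P.q_ne]
    simp only [if_true, smul_mul_assoc, mul_smul_comm, one_mul, mul_one]
    module
  · simp only [if_neg h]
    simp only [mul_zero, zero_mul, smul_zero, add_zero, zero_add]

end GrassPairing

lemma rtt_root_vector (q : ℂ) (hq : q * q⁻¹ = 1) (i p p' : ℕ)
    (hp : p = i ∧ p' = i + 1 ∨ p = i + 1 ∧ p' = i) (t : ℂ) (a b c d : ℕ) (κ : ℕ → ℂ)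
    (hκ : ∀ b, κ b = if b = i then q⁻¹ else if b = i + 1 then q else 1) (X : ℕ → ℕ → ℕ → ℕ → ℂ)
    (hX : ∀ a b c d, X a b c d = (if a = p ∧ c = p' then t else 0) * (if b = d then κ b else 0) +
      (if a = c then 1 else 0) * (if b = p ∧ d = p' then t else 0)) :
    (if a = b then q else 1) * X b a c d + (if a < b then q - q⁻¹ else 0) * X a b c d =
    (if c = d then q else 1) * X a b d c + (if c < d then q - q⁻¹ else 0) * X a b c d := by
  simp only [hX, hκ]
  grind (splits := 40)

lemma rtt_grouplike (q : ℂ) (a b c d : ℕ) (κ : ℕ → ℂ) (X : ℕ → ℕ → ℕ → ℕ → ℂ)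
    (hX : ∀ a b c d, X a b c d = (if a = c then κ a else 0) * (if b = d then κ b else 0)) :
    (if a = b then q else 1) * X b a c d + (if a < b then q - q⁻¹ else 0) * X a b c d =
    (if c = d then q else 1) * X a b d c + (if c < d then q - q⁻¹ else 0) * X a b c d := by
  simp only [hX]
  grind (splits := 40)

namespace GrassPairing

variable {U A : Type} [Ring U] [Bialgebra ℂ U] [Ring A] [Algebra ℂ A] (P : GrassPairing U A)

lemma del_congr {a b : A} (h : ∀ x, P.pair x a = P.pair x b) (x : U) :
    P.del a x = P.del b x := by
  rw [del_apply, del_apply, show P.pair.flip a = P.pair.flip b from LinearMap.ext h]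

lemma pair_mul_u_u (x y : U) {a b c d : ℕ} (ha : a ∈ Finset.Icc 1 P.N) (hb : b ∈ Finset.Icc 1 P.N)
    (hc : c ∈ Finset.Icc 1 P.N) (hd : d ∈ Finset.Icc 1 P.N) :
    P.pair (x * y) (P.u a c * P.u b d) = ∑ n ∈ Finset.Icc 1 P.N, ∑ m ∈ Finset.Icc 1 P.N,
      P.pair x (P.u a m * P.u b n) * P.pair y (P.u m c * P.u n d) := by
  rw [Finset.mem_Icc] at ha hb hc hd
  rw [← pair_del, P.del_u_mul hb.1 hb.2 hd.1 hd.2, map_sum, LinearMap.sum_apply]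
  refine Finset.sum_congr rfl fun n _ => ?_
  rw [P.pair_mul_u _ _ a ha.1 ha.2 c hc.1 hc.2]
  refine Finset.sum_congr rfl fun m _ => ?_
  rw [pair_del, pair_del]

/-- The commutation relations between the matrix coefficients, tested against `x`. -/
def RTT (x : U) : Prop :=
  ∀ a ∈ Finset.Icc 1 P.N, ∀ b ∈ Finset.Icc 1 P.N, ∀ c ∈ Finset.Icc 1 P.N, ∀ d ∈ Finset.Icc 1 P.N,
    (if a = b then P.q else 1) * P.pair x (P.u b c * P.u a d) +
      (if a < b then P.q - P.q⁻¹ else 0) * P.pair x (P.u a c * P.u b d) =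
    (if c = d then P.q else 1) * P.pair x (P.u a d * P.u b c) +
      (if c < d then P.q - P.q⁻¹ else 0) * P.pair x (P.u a c * P.u b d)

variable {P}

lemma RTT.mul {x y : U} (hx : P.RTT x) (hy : P.RTT y) : P.RTT (x * y) := by
  intro a ha b hb c hc d hd
  simp only [P.pair_mul_u_u x y ha hb hc hd, P.pair_mul_u_u x y hb ha hc hd,
    P.pair_mul_u_u x y ha hb hd hc]
  have hl : ∀ n ∈ Finset.Icc 1 P.N, ∀ m ∈ Finset.Icc 1 P.N,
      ((if a = b then P.q else 1) * P.pair x (P.u b m * P.u a n) +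
        (if a < b then P.q - P.q⁻¹ else 0) * P.pair x (P.u a m * P.u b n)) *
          P.pair y (P.u m c * P.u n d) =
      ((if m = n then P.q else 1) * P.pair x (P.u a n * P.u b m) +
        (if m < n then P.q - P.q⁻¹ else 0) * P.pair x (P.u a m * P.u b n)) *
          P.pair y (P.u m c * P.u n d) := fun n hn m hm => by rw [hx a ha b hb m hm n hn]
  have hr : ∀ n ∈ Finset.Icc 1 P.N, ∀ m ∈ Finset.Icc 1 P.N,
      P.pair x (P.u a m * P.u b n) * ((if m = n then P.q else 1) * P.pair y (P.u n c * P.u m d) +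
        (if m < n then P.q - P.q⁻¹ else 0) * P.pair y (P.u m c * P.u n d)) =
      P.pair x (P.u a m * P.u b n) * ((if c = d then P.q else 1) * P.pair y (P.u m d * P.u n c) +
        (if c < d then P.q - P.q⁻¹ else 0) * P.pair y (P.u m c * P.u n d)) :=
    fun n hn m hm => by rw [hy m hm n hn c hc d hd]
  have hl' := Finset.sum_congr (rfl : Finset.Icc 1 P.N = _) fun n hn =>
    Finset.sum_congr (rfl : Finset.Icc 1 P.N = _) (hl n hn)
  have hr' := Finset.sum_congr (rfl : Finset.Icc 1 P.N = _) fun n hn =>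
    Finset.sum_congr (rfl : Finset.Icc 1 P.N = _) (hr n hn)
  simp only [add_mul, mul_add, Finset.sum_add_distrib] at hl' hr'
  have hs : ∑ n ∈ Finset.Icc 1 P.N, ∑ m ∈ Finset.Icc 1 P.N,
      (if m = n then P.q else 1) * P.pair x (P.u a n * P.u b m) * P.pair y (P.u m c * P.u n d) =
      ∑ n ∈ Finset.Icc 1 P.N, ∑ m ∈ Finset.Icc 1 P.N,
      P.pair x (P.u a m * P.u b n) * ((if m = n then P.q else 1) *
        P.pair y (P.u n c * P.u m d)) := by
    rw [Finset.sum_comm]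
    refine Finset.sum_congr rfl fun n _ => Finset.sum_congr rfl fun m _ => ?_
    simp only [eq_comm (a := n) (b := m)]
    ring
  simp only [Finset.mul_sum]
  simp only [mul_assoc, mul_left_comm (P.pair x _)] at hl' hr' hs ⊢
  linear_combination hl' + hs + hr'

lemma rtt_of_comul {x : U} {i p p' : ℕ} {t : ℂ} (hi : 1 ≤ i) (hi' : i < P.N)
    (hp : p = i ∧ p' = i + 1 ∨ p = i + 1 ∧ p' = i)
    (hx : Coalgebra.comul (R := ℂ) x = x ⊗ₜ[ℂ] P.k' i + 1 ⊗ₜ[ℂ] x)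
    (hpair : ∀ a, 1 ≤ a → a ≤ P.N → ∀ b, 1 ≤ b → b ≤ P.N →
      P.pair x (P.u a b) = if a = p ∧ b = p' then t else 0) : P.RTT x := by
  intro a ha b hb c hc d hd
  have h : ∀ a ∈ Finset.Icc 1 P.N, ∀ b ∈ Finset.Icc 1 P.N, ∀ c ∈ Finset.Icc 1 P.N,
      ∀ d ∈ Finset.Icc 1 P.N, P.pair x (P.u a c * P.u b d) =
        (if a = p ∧ c = p' then t else 0) *
          (if b = d then (if b = i then P.q⁻¹ else if b = i + 1 then P.q else 1) else 0) +
        (if a = c then 1 else 0) * (if b = p ∧ d = p' then t else 0) := by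
    intro a ha b hb c hc d hd
    rw [Finset.mem_Icc] at ha hb hc hd
    simp only [P.pair_mul, hx, map_add, TensorProduct.map_tmul, LinearMap.mul'_apply,
      LinearMap.flip_apply, hpair a ha.1 ha.2 c hc.1 hc.2, hpair b hb.1 hb.2 d hd.1 hd.2,
      P.pair_k' i hi hi' b hb.1 hb.2 d hd.1 hd.2, P.pair_one_u a ha.1 ha.2 c hc.1 hc.2,
      stdCoord_simpleRoot hb.1]
    congr 3
    split_ifs <;> first | omega | simp
  rw [h a ha b hb c hc d hd, h b hb a ha c hc d hd, h a ha b hb d hd c hc]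
  exact rtt_root_vector P.q (mul_inv_cancel₀ P.q_ne) i p p' hp t a b c d
    (fun b => if b = i then P.q⁻¹ else if b = i + 1 then P.q else 1) (fun _ => rfl)
    (fun a b c d => (if a = p ∧ c = p' then t else 0) *
          (if b = d then (if b = i then P.q⁻¹ else if b = i + 1 then P.q else 1) else 0) +
        (if a = c then 1 else 0) * (if b = p ∧ d = p' then t else 0)) fun _ _ _ _ => rfl

lemma rtt_of_grouplike {x : U} {κ : ℕ → ℂ} (hx : Coalgebra.comul (R := ℂ) x = x ⊗ₜ[ℂ] x)
    (hpair : ∀ a, 1 ≤ a → a ≤ P.N → ∀ b, 1 ≤ b → b ≤ P.N →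
      P.pair x (P.u a b) = if a = b then κ a else 0) : P.RTT x := by
  intro a ha b hb c hc d hd
  have h : ∀ a ∈ Finset.Icc 1 P.N, ∀ b ∈ Finset.Icc 1 P.N, ∀ c ∈ Finset.Icc 1 P.N,
      ∀ d ∈ Finset.Icc 1 P.N, P.pair x (P.u a c * P.u b d) =
        (if a = c then κ a else 0) * (if b = d then κ b else 0) := by
    intro a ha b hb c hc d hd
    rw [Finset.mem_Icc] at ha hb hc hd
    simp only [P.pair_mul, hx, TensorProduct.map_tmul, LinearMap.mul'_apply,
      LinearMap.flip_apply, hpair a ha.1 ha.2 c hc.1 hc.2, hpair b hb.1 hb.2 d hd.1 hd.2]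
  rw [h a ha b hb c hc d hd, h b hb a ha c hc d hd, h a ha b hb d hd c hc]
  exact rtt_grouplike P.q a b c d κ
    (fun a b c d => (if a = c then κ a else 0) * (if b = d then κ b else 0)) fun _ _ _ _ => rfl

variable (P) in
lemma rtt (x : U) : P.RTT x := by
  let M : Submodule ℂ U :=
    { carrier := {x | P.RTT x}
      add_mem' := fun hx hy a ha b hb c hc d hd => by
        simp only [map_add, LinearMap.add_apply]
        linear_combination hx a ha b hb c hc d hd + hy a ha b hb c hc d hd
      zero_mem' := fun a ha b hb c hc d hd => by simp
      smul_mem' := fun t x hx a ha b hb c hc d hd => by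
        simp only [map_smul, LinearMap.smul_apply, smul_eq_mul]
        linear_combination t * hx a ha b hb c hc d hd }
  have h : x ∈ M := by
    refine mem_of_mem_adjoin_of_mul_mem (M := M) (a := x) ?_ ?_ (P.gen ▸ Algebra.mem_top)
    · exact rtt_of_grouplike (κ := fun _ => 1) (by simp [Algebra.TensorProduct.one_def])
        fun a ha ha' b hb hb' => P.pair_one_u a ha ha' b hb hb'
    · rintro m hm s ⟨i, ⟨hi, hi'⟩, rfl | rfl | rfl | rfl⟩
      · exact RTT.mul hm (rtt_of_comul hi hi' (Or.inl ⟨rfl, rfl⟩) (P.comul_e i hi hi')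
          (P.pair_e i hi hi'))
      · exact RTT.mul hm (rtt_of_comul hi hi' (Or.inr ⟨rfl, rfl⟩) (P.comul_f i hi hi')
          (P.pair_f i hi hi'))
      · exact RTT.mul hm (rtt_of_grouplike (P.comul_k i hi hi') (P.pair_k i hi hi'))
      · exact RTT.mul hm (rtt_of_grouplike (P.comul_k' i hi hi') (P.pair_k' i hi hi'))
  exact h

/-- The recursion expressing `del (u i (j+1))` through operators closer to the diagonal. -/
lemma del_u_succ {i j : ℕ} (hi : 1 ≤ i) (hij : i < j) (hj : j < P.N) (x : U) :
    (P.q - P.q⁻¹) • P.del (P.u i (j + 1)) (P.del (P.u j j) x) =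
      P.del (P.u i j) (P.del (P.u j (j + 1)) x) - P.del (P.u j (j + 1)) (P.del (P.u i j) x) := by
  have h : P.del ((P.q - P.q⁻¹) • (P.u i (j + 1) * P.u j j)) x =
      P.del (P.u i j * P.u j (j + 1) - P.u j (j + 1) * P.u i j) x := by
    refine P.del_congr (fun y => ?_) x
    have h := P.rtt y i (by simp; omega) j (by simp; omega) (j + 1) (by simp; omega) j
      (by simp; omega)
    rw [if_neg (by omega), if_pos hij, if_neg (by omega), if_neg (by omega)] at h
    simp only [map_smul, map_sub, smul_eq_mul]
    linear_combination h
  simpa only [map_smul, map_sub, LinearMap.smul_apply, LinearMap.sub_apply, del_mul] using h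

end GrassPairing

namespace GrassPairing

variable {U A : Type} [Ring U] [Bialgebra ℂ U] [Ring A] [Algebra ℂ A] (P : GrassPairing U A)

/-- Iterated skew commutators spanning a complement of the positive part of the ideal `J`. -/
def yw : List ℕ → U
  | [] => 1
  | i :: w => if i = P.r then yw w * P.e i
      else P.ad i (fun l => (w.count l : ℤ)) (yw w)

/-- The weight of a word in the simple roots. -/
def wordWt (w : List ℕ) : ℕ → ℤ := fun l => (w.count l : ℤ)

/-- Words in the letters `1, …, N-1`. -/
def IsWord (w : List ℕ) : Prop := ∀ i ∈ w, 1 ≤ i ∧ i < P.N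

@[simp] lemma wordWt_nil : wordWt [] = 0 := by
  funext l
  simp [wordWt]

lemma wordWt_cons (i : ℕ) (w : List ℕ) : wordWt (i :: w) = wordWt w + simpleRoot i := by
  funext l
  simp only [wordWt, List.count_cons, Pi.add_apply, Pi.single_apply, beq_iff_eq, eq_comm (a := i)]
  split_ifs <;> simp

variable {P} in
lemma isWord_cons {i : ℕ} {w : List ℕ} : P.IsWord (i :: w) ↔ (1 ≤ i ∧ i < P.N) ∧ P.IsWord w := by
  simp [IsWord]

lemma isWord_nil : P.IsWord [] := by simp [IsWord]

lemma yw_cons_r (w : List ℕ) : P.yw (P.r :: w) = P.yw w * P.e P.r := by simp [yw]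

lemma yw_cons {i : ℕ} (hi : i ≠ P.r) (w : List ℕ) :
    P.yw (i :: w) = P.ad i (wordWt w) (P.yw w) := by
  simp only [yw, if_neg hi]
  rfl

/-- The span of the elements `yw w` of weight `c`. -/
def Y (c : ℕ → ℤ) : Submodule ℂ U :=
  Submodule.span ℂ {y | ∃ w, P.IsWord w ∧ wordWt w = c ∧ P.yw w = y}

variable {P}

lemma yw_mem_Y {w : List ℕ} (hw : P.IsWord w) : P.yw w ∈ P.Y (wordWt w) :=
  Submodule.subset_span ⟨w, hw, rfl, rfl⟩

lemma one_mem_Y : (1 : U) ∈ P.Y 0 := by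
  have := yw_mem_Y P.isWord_nil
  rwa [wordWt_nil] at this

lemma mul_e_r_mem_Y {c : ℕ → ℤ} {y : U} (hy : y ∈ P.Y c) :
    y * P.e P.r ∈ P.Y (c + simpleRoot P.r) := by
  refine Submodule.span_induction (p := fun y _ => y * P.e P.r ∈ P.Y (c + simpleRoot P.r))
    ?_ ?_ ?_ ?_ hy
  · rintro _ ⟨w, hw, rfl, rfl⟩
    rw [← yw_cons_r, ← wordWt_cons]
    exact yw_mem_Y (isWord_cons.mpr ⟨⟨P.r_pos, P.r_lt⟩, hw⟩)
  · simp
  · intro x y _ _ hx hy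
    rw [add_mul]
    exact add_mem hx hy
  · intro t x _ hx
    rw [smul_mul_assoc]
    exact Submodule.smul_mem _ _ hx

lemma ad_mem_Y {i : ℕ} (hi : 1 ≤ i) (hi' : i < P.N) (hr : i ≠ P.r) {c : ℕ → ℤ} {y : U}
    (hy : y ∈ P.Y c) : P.ad i c y ∈ P.Y (c + simpleRoot i) := by
  suffices h : P.Y c ≤ (P.Y (c + simpleRoot i)).comap (P.ad i c) from h hy
  refine Submodule.span_le.mpr ?_
  rintro _ ⟨w, hw, rfl, rfl⟩
  rw [SetLike.mem_coe, Submodule.mem_comap]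
  rw [← yw_cons P hr, ← wordWt_cons]
  exact yw_mem_Y (isWord_cons.mpr ⟨⟨hi, hi'⟩, hw⟩)

lemma Y_le {S : (ℕ → ℤ) → Submodule ℂ U} (h1 : (1 : U) ∈ S 0)
    (hr : ∀ c, ∀ y ∈ S c, y * P.e P.r ∈ S (c + simpleRoot P.r))
    (hne : ∀ i, 1 ≤ i → i < P.N → i ≠ P.r → ∀ c, ∀ y ∈ S c, P.ad i c y ∈ S (c + simpleRoot i))
    (c : ℕ → ℤ) : P.Y c ≤ S c := by
  refine Submodule.span_le.mpr ?_
  rintro _ ⟨w, hw, rfl, rfl⟩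
  induction w with
  | nil => simpa [yw] using h1
  | cons i w ih =>
    rw [isWord_cons] at hw
    obtain ⟨⟨hi, hi'⟩, hw⟩ := hw
    rw [wordWt_cons]
    by_cases h : i = P.r
    · subst h
      rw [yw_cons_r]
      exact hr _ _ (ih hw)
    · rw [yw_cons P h]
      exact hne i hi hi' h _ _ (ih hw)

lemma ad_mem_hw {i : ℕ} (hi : 1 ≤ i) (hi' : i < P.N) {c : ℕ → ℤ} {y : U}
    (hy : y ∈ P.hw c) : P.ad i c y ∈ P.hw (c + simpleRoot i) := by
  rw [ad_apply]
  refine sub_mem (mul_mem_hw hy (e_mem_hw hi hi')) (Submodule.smul_mem _ _ ?_)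
  rw [add_comm]
  exact mul_mem_hw (e_mem_hw hi hi') hy

lemma Y_le_hw (c : ℕ → ℤ) : P.Y c ≤ P.hw c :=
  Y_le one_mem_hw (fun _ _ hy => mul_mem_hw hy (e_mem_hw P.r_pos P.r_lt))
    (fun _ hi hi' _ _ _ hy => ad_mem_hw hi hi' hy) c

lemma del_u_one {i j : ℕ} (hi : 1 ≤ i) (hi' : i ≤ P.N) (hj : 1 ≤ j) (hj' : j ≤ P.N) :
    P.del (P.u i j) 1 = (if i = j then (1 : ℂ) else 0) • (1 : U) := by
  simp [del_apply, Algebra.TensorProduct.one_def, P.pair_one_u i hi hi' j hj hj']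

lemma dj_one {j : ℕ} (hj : 1 ≤ j) (hj' : j < P.N) : P.dj j 0 (1 : U) = 0 := by
  rw [dj_apply, del_u_one hj hj'.le (by omega) (by omega), if_neg (by omega), zero_smul, smul_zero]

lemma dj_mul_e_r {j : ℕ} (hj : 1 ≤ j) (hj' : j < P.N) {c : ℕ → ℤ} {y : U} (hy : y ∈ P.hw c) :
    P.dj j (c + simpleRoot P.r) (y * P.e P.r) = P.q ^ cartanSL P.r j • (P.dj j c y * P.e P.r) +
      if P.r = j then P.q ^ 2 • y else 0 := by
  rw [dj_mul hj hj' hy (e_mem_hw P.r_pos P.r_lt), dj_e P.r_pos P.r_lt hj hj',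
    corootPair_simpleRoot P.r_pos hj, cartanSL_comm j, add_comm]
  split_ifs <;> simp

lemma dj_mem_Y {j : ℕ} (hj : 1 ≤ j) (hj' : j < P.N) (c : ℕ → ℤ) {y : U} (hy : y ∈ P.Y c) :
    P.dj j c y ∈ P.Y (c - simpleRoot j) := by
  suffices h : P.Y c ≤ P.Y c ⊓ (P.Y (c - simpleRoot j)).comap (P.dj j c) from (h hy).2
  refine Y_le (S := fun c => P.Y c ⊓ (P.Y (c - simpleRoot j)).comap (P.dj j c)) ?_ ?_ ?_ c
  · exact ⟨one_mem_Y, by simp [dj_one hj hj']⟩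
  · rintro c y ⟨hy, hdy⟩
    refine ⟨mul_e_r_mem_Y hy, ?_⟩
    rw [SetLike.mem_coe, Submodule.mem_comap, dj_mul_e_r hj hj' (Y_le_hw c hy)]
    refine add_mem (Submodule.smul_mem _ _ ?_) ?_
    · rw [add_sub_right_comm]
      exact mul_e_r_mem_Y hdy
    · split_ifs with h
      · rw [h, add_sub_cancel_right]
        exact Submodule.smul_mem _ _ hy
      · exact zero_mem _
  · rintro i hi hi' hr c y ⟨hy, hdy⟩
    refine ⟨ad_mem_Y hi hi' hr hy, ?_⟩
    rw [SetLike.mem_coe, Submodule.mem_comap, dj_ad hi hi' hj hj' (Y_le_hw c hy)]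
    refine add_mem ?_ ?_
    · have h := Submodule.smul_mem _ (P.q ^ cartanSL i j) (ad_mem_Y hi hi' hr hdy)
      rw [ad_apply, smul_sub, smul_smul, ← zpow_add₀ P.q_ne, corootPair_sub,
        corootPair_simpleRoot hj hi, add_sub_cancel, ← add_sub_right_comm] at h
      exact h
    · split_ifs with h
      · rw [h, add_sub_cancel_right]
        exact Submodule.smul_mem _ _ hy
      · exact zero_mem _

lemma phi_eq_dj {j : ℕ} (hj : 1 ≤ j) (hj' : j < P.N) (hjr : j ≠ P.r) (c : ℕ → ℤ) {y : U}
    (hy : y ∈ P.Y c) : P.phi j c y = (P.q - P.q⁻¹)⁻¹ • P.dj j c y := by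
  suffices h : P.Y c ≤ P.hw c ⊓ LinearMap.eqLocus (P.phi j c) ((P.q - P.q⁻¹)⁻¹ • P.dj j c) from
    (h hy).2
  refine Y_le (S := fun c => P.hw c ⊓ LinearMap.eqLocus (P.phi j c)
    ((P.q - P.q⁻¹)⁻¹ • P.dj j c)) ?_ ?_ ?_ c
  · refine ⟨one_mem_hw, ?_⟩
    simp [phi_apply, dj_one hj hj']
  · rintro c y ⟨hy, hdy⟩
    refine ⟨mul_mem_hw hy (e_mem_hw P.r_pos P.r_lt), ?_⟩
    rw [SetLike.mem_coe, LinearMap.mem_eqLocus, LinearMap.smul_apply] at hdy ⊢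
    rw [dj_mul_e_r hj hj' hy, phi_mul, phi_e P.r_pos P.r_lt hj hj', if_neg (Ne.symm hjr),
      if_neg (Ne.symm hjr), hdy, corootPair_simpleRoot P.r_pos hj, cartanSL_comm j]
    simp only [mul_zero, zero_add, add_zero, smul_mul_assoc]
    rw [smul_comm]
  · rintro i hi hi' hr c y ⟨hy, hdy⟩
    refine ⟨ad_mem_hw hi hi' hy, ?_⟩
    rw [SetLike.mem_coe, LinearMap.mem_eqLocus, LinearMap.smul_apply] at hdy ⊢
    rw [phi_ad hi hi' hj hj' hy.1, dj_ad hi hi' hj hj' hy, hdy]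
    split_ifs
    · simp only [smul_mul_assoc, mul_smul_comm]
      module
    · simp only [smul_mul_assoc, mul_smul_comm]
      module

end GrassPairing

/-- The root `α_i + ⋯ + α_{j-1}`. -/
def rootWt (i j : ℕ) : ℕ → ℤ := fun l => if i ≤ l ∧ l < j then 1 else 0

lemma rootWt_self (i : ℕ) : rootWt i i = 0 := by
  funext l
  simp [rootWt]

lemma rootWt_succ {i j : ℕ} (h : i ≤ j) : rootWt i (j + 1) = rootWt i j + simpleRoot j := by
  funext l
  simp only [rootWt, Pi.add_apply, Pi.single_apply]
  split_ifs <;> omega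

namespace GrassPairing

variable {U A : Type} [Ring U] [Bialgebra ℂ U] [Ring A] [Algebra ℂ A] {P : GrassPairing U A}

lemma del_mem_of_del_succ_mem {S : (ℕ → ℤ) → Submodule ℂ U} (hS : ∀ c, S c ≤ P.hw c)
    (h : ∀ j, 1 ≤ j → j < P.N → ∀ c, ∀ y ∈ S c, P.del (P.u j (j + 1)) y ∈ S (c - simpleRoot j))
    {i j : ℕ} (hi : 1 ≤ i) (hij : i ≤ j) (hj : j ≤ P.N) {c : ℕ → ℤ} {y : U} (hy : y ∈ S c) :
    P.del (P.u i j) y ∈ S (c - rootWt i j) := by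
  induction j, hij using Nat.le_induction generalizing c y with
  | base =>
    rw [rootWt_self, sub_zero, (hS c hy).2.1 i hi hj]
    exact Submodule.smul_mem _ _ hy
  | succ j hij ih =>
    rcases hij.eq_or_lt with rfl | hlt
    · rw [rootWt_succ le_rfl, rootWt_self, zero_add]
      exact h i hi (by omega) c y hy
    · have h1 := ih (by omega) (h j (by omega) (by omega) c y hy)
      have h2 := h j (by omega) (by omega) _ _ (ih (by omega) hy)
      have h3 := P.del_u_succ hi hlt (by omega) y
      rw [(hS c hy).2.1 j (by omega) (by omega), map_smul, smul_smul] at h3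
      rw [← Submodule.smul_mem_iff _ (mul_ne_zero P.q_sub_inv_ne (zpow_ne_zero (-stdCoord c j)
        P.q_ne)), h3, rootWt_succ hij, ← sub_sub]
      refine sub_mem ?_ h2
      rwa [sub_right_comm] at h1

lemma del_succ_mem_Y {j : ℕ} (hj : 1 ≤ j) (hj' : j < P.N) (c : ℕ → ℤ) {y : U} (hy : y ∈ P.Y c) :
    P.del (P.u j (j + 1)) y ∈ P.Y (c - simpleRoot j) := by
  have h := dj_mem_Y hj hj' c hy
  rwa [dj_apply, Submodule.smul_mem_iff _ (zpow_ne_zero _ P.q_ne)] at h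

lemma del_mem_Y {i j : ℕ} (hi : 1 ≤ i) (hij : i ≤ j) (hj : j ≤ P.N) {c : ℕ → ℤ} {y : U}
    (hy : y ∈ P.Y c) : P.del (P.u i j) y ∈ P.Y (c - rootWt i j) :=
  del_mem_of_del_succ_mem Y_le_hw (fun _ hj hj' c _ hy => del_succ_mem_Y hj hj' c hy) hi hij hj hy

lemma del_s {i j : ℕ} (hj : 1 ≤ j) (hij : j ≤ i) (hi : i ≤ P.N) {c : ℕ → ℤ} {y : U}
    (hy : y ∈ P.Y c) : P.del (P.s i j) y = if i = j then P.q ^ stdCoord c i • y else 0 := by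
  induction j using Nat.strong_induction_on generalizing c y with
  | _ j ih =>
    have h : ∑ m ∈ Finset.Icc 1 P.N, P.del (P.s i m) (P.del (P.u m j) y) =
        if i = j then y else 0 := by
      simp_rw [← del_mul, ← LinearMap.sum_apply, ← map_sum,
        P.s_mul_u i (by omega) hi j hj (by omega)]
      split_ifs <;> simp [del_one]
    rw [Finset.sum_eq_single_of_mem j (by simp; omega), (Y_le_hw c hy).2.1 j hj (by omega),
      map_smul] at h
    · have h' := congrArg (fun z => P.q ^ stdCoord c j • z) h
      simp only [smul_smul, ← zpow_add₀ P.q_ne, add_neg_cancel, zpow_zero, one_smul] at h'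
      rw [h']
      split_ifs with hij
      · rw [hij]
      · rw [smul_zero]
    · intro m hm hmj
      rw [Finset.mem_Icc] at hm
      rcases lt_or_gt_of_ne hmj with hlt | hlt
      · rw [ih m hlt hm.1 (by omega) (del_mem_Y hm.1 hlt.le (by omega) hy), if_neg (by omega)]
      · rw [(Y_le_hw c hy).2.2 m j hj hlt hm.2, map_zero]

variable (P) in
/-- The quantum Grassmannian coordinate `∑_{m ≤ r} S(u_{rm}) u_{m,r+1}`. -/
def bEl : A := ∑ m ∈ Finset.Icc 1 P.r, P.s P.r m * P.u m (P.r + 1)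

lemma pair_mul_s_u (x y : U) {a b c d : ℕ} (ha : a ∈ Finset.Icc 1 P.N)
    (hb : b ∈ Finset.Icc 1 P.N) (hc : c ∈ Finset.Icc 1 P.N) (hd : d ∈ Finset.Icc 1 P.N) :
    P.pair (x * y) (P.s a b * P.u c d) = ∑ n ∈ Finset.Icc 1 P.N, ∑ m ∈ Finset.Icc 1 P.N,
      P.pair y (P.s a m * P.u n d) * P.pair x (P.s m b * P.u c n) := by
  rw [Finset.mem_Icc] at ha hb hc hd
  rw [← pair_del, P.del_u_mul hc.1 hc.2 hd.1 hd.2, map_sum, LinearMap.sum_apply]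
  refine Finset.sum_congr rfl fun n _ => ?_
  rw [P.pair_mul_s _ _ a ha.1 ha.2 b hb.1 hb.2]
  refine Finset.sum_congr rfl fun m _ => ?_
  rw [pair_del, pair_del]

lemma pair_mul_bEl {x : U} (hx : ∀ a, 1 ≤ a → a ≤ P.N → ∀ n, 1 ≤ n → n ≤ P.N →
    ∑ m ∈ Finset.Icc 1 P.r, P.pair x (P.s a m * P.u m n) =
      if a = n ∧ n ≤ P.r then Coalgebra.counit (R := ℂ) x else 0) (y : U) :
    P.pair (x * y) P.bEl = Coalgebra.counit (R := ℂ) x * P.pair y P.bEl := by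
  have hr := P.r_lt
  have hr' := P.r_pos
  have hsub : Finset.Icc 1 P.r ⊆ Finset.Icc 1 P.N := Finset.Icc_subset_Icc le_rfl hr.le
  rw [bEl, map_sum, map_sum]
  rw [Finset.sum_congr rfl fun m hm => pair_mul_s_u x y (by simp; omega) (hsub hm) (hsub hm)
    (by simp; omega), Finset.sum_comm]
  have : ∀ n ∈ Finset.Icc 1 P.N, ∑ b ∈ Finset.Icc 1 P.r, ∑ m ∈ Finset.Icc 1 P.N,
      P.pair y (P.s P.r m * P.u n (P.r + 1)) * P.pair x (P.s m b * P.u b n) =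
      if n ∈ Finset.Icc 1 P.r then P.pair y (P.s P.r n * P.u n (P.r + 1)) *
        Coalgebra.counit (R := ℂ) x else 0 := by
    intro n hn
    have hn' := Finset.mem_Icc.mp hn
    rw [Finset.sum_comm]
    simp_rw [← Finset.mul_sum]
    rw [Finset.sum_eq_single_of_mem n hn]
    · rw [hx n hn'.1 hn'.2 n hn'.1 hn'.2]
      simp [hn'.1]
    · intro m hm hmn
      rw [Finset.mem_Icc] at hm
      rw [hx m hm.1 hm.2 n hn'.1 hn'.2, if_neg (by omega), mul_zero]
  rw [Finset.sum_congr rfl this, Finset.sum_ite_mem, Finset.inter_eq_right.mpr hsub,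
    ← Finset.sum_mul, mul_comm]

lemma sum_pair_s_u (x : U) {a n : ℕ} (ha : 1 ≤ a) (ha' : a ≤ P.N) (hn : 1 ≤ n) (hn' : n ≤ P.N) :
    ∑ m ∈ Finset.Icc 1 P.N, P.pair x (P.s a m * P.u m n) =
      if a = n then Coalgebra.counit (R := ℂ) x else 0 := by
  rw [← map_sum, P.s_mul_u a ha ha' n hn hn']
  split_ifs <;> simp [P.pair_one]

lemma sum_pair_s_u_of_comul {x : U} {i : ℕ} (hi : 1 ≤ i) (hi' : i < P.N)
    (hx : Coalgebra.comul (R := ℂ) x = x ⊗ₜ[ℂ] P.k' i + 1 ⊗ₜ[ℂ] x)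
    (hx0 : Coalgebra.counit (R := ℂ) x = 0)
    (hpair : ∀ a, 1 ≤ a → a ≤ P.N → ∀ b, 1 ≤ b → b ≤ P.N → ¬(a ≤ P.r ↔ b ≤ P.r) →
      P.pair x (P.u a b) = 0) {a n : ℕ} (ha : 1 ≤ a) (ha' : a ≤ P.N) (hn : 1 ≤ n)
    (hn' : n ≤ P.N) : ∑ m ∈ Finset.Icc 1 P.r, P.pair x (P.s a m * P.u m n) = 0 := by
  have hr := P.r_lt
  have hsub : Finset.Icc 1 P.r ⊆ Finset.Icc 1 P.N := Finset.Icc_subset_Icc le_rfl hr.le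
  have key : ∀ m ∈ Finset.Icc 1 P.N, P.pair x (P.s a m * P.u m n) =
      (if m = n then P.pair x (P.s a n) * P.q ^ (-stdCoord (simpleRoot i) n) else 0) +
        if a = m then P.pair x (P.u a n) else 0 := by
    intro m hm
    rw [Finset.mem_Icc] at hm
    simp only [P.pair_mul, hx, map_add, TensorProduct.map_tmul, LinearMap.mul'_apply,
      LinearMap.flip_apply, P.pair_k' i hi hi' m hm.1 hm.2 n hn hn',
      P.pair_one_s a ha ha' m hm.1 hm.2]
    congr 1
    · split_ifs with h
      · rw [h]
      · simp
    · split_ifs with h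
      · rw [h, one_mul]
      · simp
  have h1 := sum_pair_s_u x ha ha' hn hn'
  rw [Finset.sum_congr rfl key, hx0, ite_self, Finset.sum_add_distrib, Finset.sum_ite_eq',
    Finset.sum_ite_eq, if_pos (by simp; omega), if_pos (by simp; omega)] at h1
  rw [Finset.sum_congr rfl fun m hm => key m (hsub hm), Finset.sum_add_distrib,
    Finset.sum_ite_eq', Finset.sum_ite_eq]
  simp only [Finset.mem_Icc, ha, hn, true_and]
  by_cases h : a ≤ P.r ↔ n ≤ P.r
  · by_cases h' : n ≤ P.r
    · rw [if_pos h', if_pos (h.mpr h'), h1]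
    · rw [if_neg h', if_neg (fun h'' => h' (h.mp h'')), add_zero]
  · rw [hpair a ha ha' n hn hn' h, add_zero] at h1
    rw [hpair a ha ha' n hn hn' h, h1]
    simp

lemma sum_pair_s_u_of_grouplike {x : U} (hx : Coalgebra.comul (R := ℂ) x = x ⊗ₜ[ℂ] x)
    {κ : ℕ → ℂ} (hpair : ∀ a, 1 ≤ a → a ≤ P.N → ∀ b, 1 ≤ b → b ≤ P.N →
      P.pair x (P.u a b) = if a = b then κ b else 0) {a n : ℕ} (ha : 1 ≤ a) (ha' : a ≤ P.N)
    (hn : 1 ≤ n) (hn' : n ≤ P.N) : ∑ m ∈ Finset.Icc 1 P.r, P.pair x (P.s a m * P.u m n) =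
      if a = n ∧ n ≤ P.r then Coalgebra.counit (R := ℂ) x else 0 := by
  have hr := P.r_lt
  have hsub : Finset.Icc 1 P.r ⊆ Finset.Icc 1 P.N := Finset.Icc_subset_Icc le_rfl hr.le
  have key : ∀ m ∈ Finset.Icc 1 P.N, P.pair x (P.s a m * P.u m n) =
      if m = n then P.pair x (P.s a n) * κ n else 0 := by
    intro m hm
    rw [Finset.mem_Icc] at hm
    simp only [P.pair_mul, hx, TensorProduct.map_tmul, LinearMap.mul'_apply,
      LinearMap.flip_apply, hpair m hm.1 hm.2 n hn hn']
    split_ifs with h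
    · rw [h]
    · simp
  have h1 := sum_pair_s_u x ha ha' hn hn'
  rw [Finset.sum_congr rfl key, Finset.sum_ite_eq', if_pos (by simp; omega)] at h1
  rw [Finset.sum_congr rfl fun m hm => key m (hsub hm), Finset.sum_ite_eq', h1]
  simp only [Finset.mem_Icc, hn, true_and]
  split_ifs <;> first | rfl | omega

variable (P) in
lemma bEl_mem_B : P.bEl ∈ P.B := by
  refine P.mem_B _ (fun i hi hi' hr x => ?_) (fun i hi hi' hr x => ?_) (fun i hi hi' x => ?_)
    (fun i hi hi' x => ?_)
  · have h0 := P.counit_of_mem_I (P.J_le_I (P.J_e i hi hi' hr))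
    rw [pair_mul_bEl, h0, zero_mul]
    intro a ha ha' n hn hn'
    rw [h0, ite_self]
    refine sum_pair_s_u_of_comul hi hi' (P.comul_e i hi hi') h0 ?_ ha ha' hn hn'
    intro a ha ha' b hb hb' h
    rw [P.pair_e i hi hi' a ha ha' b hb hb', if_neg (by omega)]
  · have h0 := P.counit_of_mem_I (P.J_le_I (P.J_f i hi hi' hr))
    rw [pair_mul_bEl, h0, zero_mul]
    intro a ha ha' n hn hn'
    rw [h0, ite_self]
    refine sum_pair_s_u_of_comul hi hi' (P.comul_f i hi hi') h0 ?_ ha ha' hn hn'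
    intro a ha ha' b hb hb' h
    rw [P.pair_f i hi hi' a ha ha' b hb hb', if_neg (by omega)]
  · have h0 := P.counit_of_mem_I (P.J_le_I (P.J_k i hi hi'))
    rw [map_sub, Bialgebra.counit_one, sub_eq_zero] at h0
    rw [pair_mul_bEl, h0, one_mul]
    intro a ha ha' n hn hn'
    refine sum_pair_s_u_of_grouplike (P.comul_k i hi hi')
      (κ := fun b => P.q ^ stdCoord (simpleRoot i) b) ?_ ha ha' hn hn'
    intro a ha ha' b hb hb'
    rw [P.pair_k i hi hi' a ha ha' b hb hb']
    split_ifs with h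
    · rw [h]
    · rfl
  · have h0 := P.counit_of_mem_I (P.J_le_I (P.J_k' i hi hi'))
    rw [map_sub, Bialgebra.counit_one, sub_eq_zero] at h0
    rw [pair_mul_bEl, h0, one_mul]
    intro a ha ha' n hn hn'
    refine sum_pair_s_u_of_grouplike (P.comul_k' i hi hi')
      (κ := fun b => P.q ^ (-stdCoord (simpleRoot i) b)) ?_ ha ha' hn hn'
    intro a ha ha' b hb hb'
    rw [P.pair_k' i hi hi' a ha ha' b hb hb']
    split_ifs with h
    · rw [h]
    · rfl

lemma del_bEl {c : ℕ → ℤ} {y : U} (hy : y ∈ P.Y c) : P.del P.bEl y =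
    P.q ^ stdCoord (c - simpleRoot P.r) P.r • P.del (P.u P.r (P.r + 1)) y := by
  have hr := P.r_lt
  have hr' := P.r_pos
  rw [bEl, map_sum, LinearMap.sum_apply, Finset.sum_eq_single_of_mem P.r (by simp; omega)]
  · rw [del_mul, del_s hr' le_rfl hr.le (del_succ_mem_Y hr' hr c hy), if_pos rfl]
  · intro m hm hmr
    rw [Finset.mem_Icc] at hm
    rw [del_mul, del_s hm.1 hm.2 hr.le (del_mem_Y hm.1 (by omega) (by omega) hy),
      if_neg (Ne.symm hmr)]

lemma del_succ_mem_I {j : ℕ} (hj : 1 ≤ j) (hj' : j < P.N) (c : ℕ → ℤ) {y : U} (hy : y ∈ P.Y c)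
    (hyI : y ∈ P.I) : P.del (P.u j (j + 1)) y ∈ P.I := by
  by_cases hr : j = P.r
  · subst hr
    rw [← Submodule.smul_mem_iff _ (zpow_ne_zero (stdCoord (c - simpleRoot P.r) P.r) P.q_ne),
      ← del_bEl hy]
    exact P.del_mem_I P.bEl_mem_B hyI
  · rw [← Submodule.smul_mem_iff _ (zpow_ne_zero (stdCoord c j) P.q_ne), ← dj_apply,
      ← Submodule.smul_mem_iff _ (inv_ne_zero P.q_sub_inv_ne), ← phi_eq_dj hj hj' hr c hy,
      phi_apply]
    exact sub_mem (P.I_mul hyI _) (Submodule.smul_mem _ _ (P.J_le_I (P.J_f_mul hj hj' hr y)))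

lemma pair_eq_zero_of_mem_Y_of_mem_I (a : A) (c : ℕ → ℤ) (y : U) (hy : y ∈ P.Y c)
    (hyI : y ∈ P.I) : P.pair y a = 0 := by
  let M : Submodule ℂ A := ⨅ c, ⨅ y ∈ P.Y c ⊓ P.I, LinearMap.ker (P.pair y)
  have hM : ∀ a, a ∈ M ↔ ∀ c, ∀ y ∈ P.Y c ⊓ P.I, P.pair y a = 0 := fun a => by
    simp only [M, Submodule.mem_iInf, LinearMap.mem_ker]
  suffices h : a ∈ M from (hM a).mp h c y ⟨hy, hyI⟩
  refine mem_of_mem_adjoin_of_mul_mem ?_ ?_ (P.genA ▸ Algebra.mem_top : a ∈ _)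
  · exact (hM 1).mpr fun c y hy => by rw [P.pair_one, P.counit_of_mem_I hy.2]
  · rintro a ha _ ⟨i, j, ⟨hi, hi'⟩, ⟨hj, hj'⟩, rfl⟩
    refine (hM _).mpr fun c y hy => ?_
    rw [← pair_del]
    rcases le_or_gt i j with hij | hij
    · refine (hM a).mp ha (c - rootWt i j) _ ?_
      refine del_mem_of_del_succ_mem (S := fun c => P.Y c ⊓ P.I)
        (fun c => inf_le_left.trans (Y_le_hw c)) ?_ hi hij hj' hy
      exact fun j hj hj' c y hy => ⟨del_succ_mem_Y hj hj' c hy.1, del_succ_mem_I hj hj' c hy.1 hy.2⟩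
    · rw [(Y_le_hw c hy.1).2.2 i j hj hij hi', map_zero, LinearMap.zero_apply]

lemma eq_zero_of_mem_Y_of_mem_I {c : ℕ → ℤ} {y : U} (hy : y ∈ P.Y c) (hyI : y ∈ P.I) : y = 0 :=
  P.pair_nondeg y fun a => pair_eq_zero_of_mem_Y_of_mem_I a c y hy hyI

end GrassPairing

/-- Weights supported on the simple roots `α_1, …, α_{N-1}`. -/
def IsSuppWt (N : ℕ) (c : ℕ → ℤ) : Prop := ∀ i, ¬(1 ≤ i ∧ i < N) → c i = 0

/-- The height of a weight. -/
def wtHeight (N : ℕ) (c : ℕ → ℤ) : ℤ := ∑ i ∈ Finset.range N, c i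

lemma wtHeight_add (N : ℕ) (c d : ℕ → ℤ) : wtHeight N (c + d) = wtHeight N c + wtHeight N d := by
  simp [wtHeight, Finset.sum_add_distrib]

lemma wtHeight_neg (N : ℕ) (c : ℕ → ℤ) : wtHeight N (-c) = -wtHeight N c := by
  simp [wtHeight]

lemma wtHeight_simpleRoot {N i : ℕ} (hi : i < N) : wtHeight N (simpleRoot i) = 1 := by
  simp only [wtHeight, Pi.single_apply, Finset.sum_ite_eq', Finset.mem_range, if_pos hi]

lemma isSuppWt_zero (N : ℕ) : IsSuppWt N 0 := fun _ _ => rfl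

lemma IsSuppWt.add {N : ℕ} {c d : ℕ → ℤ} (hc : IsSuppWt N c) (hd : IsSuppWt N d) :
    IsSuppWt N (c + d) := fun i hi => by simp [hc i hi, hd i hi]

lemma IsSuppWt.neg {N : ℕ} {c : ℕ → ℤ} (hc : IsSuppWt N c) : IsSuppWt N (-c) :=
  fun i hi => by simp [hc i hi]

lemma isSuppWt_simpleRoot {N i : ℕ} (hi : 1 ≤ i) (hi' : i < N) : IsSuppWt N (simpleRoot i) :=
  fun j hj => Pi.single_eq_of_ne (by rintro rfl; exact hj ⟨hi, hi'⟩) 1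

namespace GrassPairing

variable {U A : Type} [Ring U] [Bialgebra ℂ U] [Ring A] [Algebra ℂ A] {P : GrassPairing U A}

lemma mem_I_of_sum_mem_I {κ : Type*} (s : Finset κ) (c : κ → ℕ → ℤ)
    (hinj : ∀ a ∈ s, ∀ b ∈ s, c a = c b → a = b) (hc : ∀ a ∈ s, IsSuppWt P.N (c a)) (x : κ → U)
    (hx : ∀ a ∈ s, x a ∈ P.wt (c a)) (hs : ∑ a ∈ s, x a ∈ P.I) : ∀ a ∈ s, x a ∈ P.I := by
  refine mem_of_sum_eigenvectors_mem P.I (ι := {j // 1 ≤ j ∧ j < P.N})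
    (fun j => LinearMap.mulLeft ℂ (P.k j) ∘ₗ LinearMap.mulRight ℂ (P.k' j))
    (fun j x hx => P.k_mul_mem_I j.2.1 j.2.2 (P.I_mul hx _))
    (fun a j => P.q ^ corootPair (c a) j) s (fun a ha b hb h => hinj a ha b hb ?_) x
    (fun a ha j => ?_) hs
  · rw [← sub_eq_zero]
    refine eq_zero_of_corootPair_eq_zero (N := P.N)
      (fun i hi => by simp [hc a ha i hi, hc b hb i hi]) fun j hj hj' => ?_
    rw [corootPair_sub, sub_eq_zero]
    exact P.zpow_inj (congrFun h ⟨j, hj, hj'⟩)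
  · simp only [LinearMap.comp_apply, LinearMap.mulLeft_apply, LinearMap.mulRight_apply]
    rw [← mul_assoc, hx a ha j j.2.1 j.2.2, smul_mul_assoc, mul_assoc, P.k_mul_k' j j.2.1 j.2.2,
      mul_one]

variable (P) in
/-- The sum of the weight spaces whose weight lies in `S` and is supported on the simple roots. -/
def wtS (S : Set (ℕ → ℤ)) : Submodule ℂ U := ⨆ c : {c // c ∈ S ∧ IsSuppWt P.N c}, P.wt c

lemma mem_wtS {S : Set (ℕ → ℤ)} {c : ℕ → ℤ} (hc : c ∈ S) (hc' : IsSuppWt P.N c) {x : U}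
    (hx : x ∈ P.wt c) : x ∈ P.wtS S :=
  Submodule.mem_iSup_of_mem (p := fun c : {c // c ∈ S ∧ IsSuppWt P.N c} => P.wt c) ⟨c, hc, hc'⟩ hx

lemma wtS_le {S : Set (ℕ → ℤ)} {M : Submodule ℂ U}
    (h : ∀ c ∈ S, IsSuppWt P.N c → P.wt c ≤ M) : P.wtS S ≤ M :=
  iSup_le fun c => h c c.2.1 c.2.2

lemma mem_I_of_add_mem_I {S S' : Set (ℕ → ℤ)} (hS : Disjoint S S') {x y : U} (hx : x ∈ P.wtS S)
    (hy : y ∈ P.wtS S') (h : x + y ∈ P.I) : x ∈ P.I := by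
  obtain ⟨f, hf, rfl⟩ := (Submodule.mem_iSup_iff_exists_finsupp _ _).mp hx
  obtain ⟨g, hg, rfl⟩ := (Submodule.mem_iSup_iff_exists_finsupp _ _).mp hy
  refine P.I.sum_mem fun a ha => ?_
  refine mem_I_of_sum_mem_I (f.support.disjSum g.support)
    (Sum.elim (fun c => (c : ℕ → ℤ)) (fun c => (c : ℕ → ℤ))) ?_ ?_ (Sum.elim f g) ?_ ?_ (Sum.inl a)
    (by simpa using ha)
  · rintro (a | a) - (b | b) - hab
    · exact congrArg Sum.inl (Subtype.ext hab)
    · exact absurd b.2.1 fun hb =>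
        Set.disjoint_left.mp hS a.2.1 (by rwa [show a.1 = b.1 from hab])
    · exact absurd a.2.1 fun ha =>
        Set.disjoint_left.mp hS b.2.1 (by rwa [show b.1 = a.1 from hab.symm])
    · exact congrArg Sum.inr (Subtype.ext hab)
  · rintro (a | a) -
    · exact a.2.2
    · exact a.2.2
  · rintro (a | a) -
    · exact hf a
    · exact hg a
  · rw [Finset.sum_disjSum]
    exact h

variable (P) in
/-- The span of the weight vectors of height at least `h`. -/
def Up (h : ℤ) : Submodule ℂ U := P.wtS {c | h ≤ wtHeight P.N c}

lemma mem_Up {h : ℤ} {c : ℕ → ℤ} (hc : h ≤ wtHeight P.N c) (hc' : IsSuppWt P.N c) {x : U}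
    (hx : x ∈ P.wt c) : x ∈ P.Up h := mem_wtS hc hc' hx

lemma Up_anti {h h' : ℤ} (hh : h ≤ h') : P.Up h' ≤ P.Up h :=
  wtS_le fun _ hc hc' _ hx => mem_Up (hh.trans hc) hc' hx

lemma mul_mem_Up {h h' : ℤ} {x y : U} (hx : x ∈ P.Up h) (hy : y ∈ P.Up h') :
    x * y ∈ P.Up (h + h') := by
  suffices H : P.Up h ≤ (P.Up (h + h')).comap (LinearMap.mulRight ℂ y) from H hx
  refine wtS_le fun c hc hc' x hx => ?_
  suffices H : P.Up h' ≤ (P.Up (h + h')).comap (LinearMap.mulLeft ℂ x) from H hy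
  refine wtS_le fun d hd hd' y hy => ?_
  exact mem_Up (by rw [wtHeight_add]; exact add_le_add hc hd) (hc'.add hd') (mul_mem_wt hx hy)

lemma one_mem_Up : (1 : U) ∈ P.Up 0 := mem_Up (by simp [wtHeight]) (isSuppWt_zero _) one_mem_wt


lemma e_mem_Up {i : ℕ} (hi : 1 ≤ i) (hi' : i < P.N) : P.e i ∈ P.Up 1 :=
  mem_Up (wtHeight_simpleRoot hi').ge (isSuppWt_simpleRoot hi hi') (e_mem_wt hi hi')

lemma f_mem_Up {i : ℕ} (hi : 1 ≤ i) (hi' : i < P.N) : P.f i ∈ P.Up (-1) :=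
  mem_Up (by rw [wtHeight_neg, wtHeight_simpleRoot hi']) (isSuppWt_simpleRoot hi hi').neg
    (f_mem_wt hi hi')

variable (P) in
/-- The span of all elements `yw w`. -/
def YF : Submodule ℂ U := ⨆ c, P.Y c

lemma isSuppWt_wordWt {w : List ℕ} (hw : P.IsWord w) : IsSuppWt P.N (wordWt w) := by
  intro i hi
  simp only [wordWt, Nat.cast_eq_zero, List.count_eq_zero]
  exact fun h => hi (hw i h)

lemma isSuppWt_of_mem_Y {c : ℕ → ℤ} {y : U} (hy : y ∈ P.Y c) (hy0 : y ≠ 0) : IsSuppWt P.N c := by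
  by_contra hc
  apply hy0
  have : P.Y c ≤ ⊥ := Submodule.span_le.mpr (by
    rintro _ ⟨w, hw, rfl, rfl⟩
    exact absurd (isSuppWt_wordWt hw) hc)
  simpa using this hy

lemma eq_zero_of_mem_YF_of_mem_I {y : U} (hy : y ∈ P.YF) (hyI : y ∈ P.I) : y = 0 := by
  obtain ⟨f, hf, rfl⟩ := (Submodule.mem_iSup_iff_exists_finsupp _ _).mp hy
  have := mem_I_of_sum_mem_I f.support id (fun _ _ _ _ h => h)
    (fun a ha => isSuppWt_of_mem_Y (hf a) (Finsupp.mem_support_iff.mp ha)) f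
    (fun a _ => (Y_le_hw a (hf a)).1) hyI
  exact Finset.sum_eq_zero fun a ha => eq_zero_of_mem_Y_of_mem_I (hf a) (this a ha)

lemma yw_mem_YF {w : List ℕ} (hw : P.IsWord w) : P.yw w ∈ P.YF :=
  Submodule.mem_iSup_of_mem _ (yw_mem_Y hw)

lemma YF_le {M : Submodule ℂ U} (h : ∀ w, P.IsWord w → P.yw w ∈ M) : P.YF ≤ M :=
  iSup_le fun _ => Submodule.span_le.mpr (by rintro _ ⟨w, hw, -, rfl⟩; exact h w hw)

variable (P) in
/-- The generators of the positive part. -/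
def eSet : Set U := {x | ∃ i, (1 ≤ i ∧ i < P.N) ∧ x = P.e i}

lemma mul_mem_J_sup_YF {y : U} (hy : y ∈ P.YF) {i : ℕ} (hi : 1 ≤ i) (hi' : i < P.N) :
    y * P.e i ∈ P.J ⊔ P.YF := by
  suffices h : P.YF ≤ (P.J ⊔ P.YF).comap (LinearMap.mulRight ℂ (P.e i)) from h hy
  refine YF_le fun w hw => ?_
  rw [Submodule.mem_comap, LinearMap.mulRight_apply]
  have hiw : P.IsWord (i :: w) := isWord_cons.mpr ⟨⟨hi, hi'⟩, hw⟩
  by_cases hr : i = P.r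
  · subst hr
    rw [← yw_cons_r]
    exact Submodule.mem_sup_right (yw_mem_YF hiw)
  · have := yw_cons P hr w
    rw [ad_apply, eq_sub_iff_add_eq'] at this
    rw [← this]
    exact add_mem (Submodule.mem_sup_left (Submodule.smul_mem _ _ (P.J_e_mul hi hi' hr _)))
      (Submodule.mem_sup_right (yw_mem_YF hiw))

lemma mem_J_sup_YF {x : U} (hx : x ∈ Algebra.adjoin ℂ P.eSet) : x ∈ P.J ⊔ P.YF := by
  refine mem_of_mem_adjoin_of_mul_mem ?_ ?_ hx
  · exact Submodule.mem_sup_right (by simpa [yw] using yw_mem_YF P.isWord_nil)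
  · rintro m hm _ ⟨i, ⟨hi, hi'⟩, rfl⟩
    obtain ⟨a, ha, y, hy, rfl⟩ := Submodule.mem_sup.mp hm
    rw [add_mul]
    exact add_mem (Submodule.mem_sup_left (P.J_mul a ha _)) (mul_mem_J_sup_YF hy hi hi')

lemma mem_J_of_mem_I_of_mem_adjoin {x : U} (hx : x ∈ Algebra.adjoin ℂ P.eSet) (hxI : x ∈ P.I) :
    x ∈ P.J := by
  obtain ⟨a, ha, y, hy, rfl⟩ := Submodule.mem_sup.mp (mem_J_sup_YF hx)
  have : y ∈ P.I := by simpa using sub_mem hxI (P.J_le_I ha)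
  rwa [eq_zero_of_mem_YF_of_mem_I hy this, add_zero]

lemma yw_mem_adjoin {w : List ℕ} (hw : P.IsWord w) : P.yw w ∈ Algebra.adjoin ℂ P.eSet := by
  induction w with
  | nil => exact one_mem _
  | cons i w ih =>
    rw [isWord_cons] at hw
    have he : P.e i ∈ Algebra.adjoin ℂ P.eSet := Algebra.subset_adjoin ⟨i, hw.1, rfl⟩
    by_cases hr : i = P.r
    · subst hr
      rw [yw_cons_r]
      exact mul_mem (ih hw.2) he
    · rw [yw_cons P hr, ad_apply]
      exact sub_mem (mul_mem (ih hw.2) he) (Subalgebra.smul_mem _ (mul_mem he (ih hw.2)) _)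

lemma YF_le_adjoin : P.YF ≤ Subalgebra.toSubmodule (Algebra.adjoin ℂ P.eSet) :=
  YF_le fun _ hw => yw_mem_adjoin hw

end GrassPairing

lemma cartanSL_sub {N i j : ℕ} (hi : i ≤ N) (hj : j ≤ N) :
    cartanSL (N - i) (N - j) = cartanSL i j := by
  simp only [cartanSL]
  split_ifs <;> omega

lemma stdCoord_simpleRoot_sub {N l i : ℕ} (hl : l ≤ N) (hi : 1 ≤ i) (hi' : i ≤ N) :
    stdCoord (simpleRoot (N - l)) (N + 1 - i) = -stdCoord (simpleRoot l) i := by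
  rw [stdCoord_simpleRoot (by omega), stdCoord_simpleRoot hi]
  split_ifs <;> omega

lemma sum_Icc_reflect {M : Type*} [AddCommMonoid M] (N : ℕ) (g : ℕ → M) :
    ∑ m ∈ Finset.Icc 1 N, g m = ∑ m ∈ Finset.Icc 1 N, g (N + 1 - m) := by
  refine Finset.sum_nbij' (fun m => N + 1 - m) (fun m => N + 1 - m) ?_ ?_ ?_ ?_ ?_ <;>
    intro m hm <;> rw [Finset.mem_Icc] at hm
  · rw [Finset.mem_Icc]; omega
  · rw [Finset.mem_Icc]; omega
  · omega
  · omega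
  · congr 1; omega

namespace GrassPairing

variable {U A : Type} [Ring U] [Bialgebra ℂ U] [Ring A] [Algebra ℂ A] (P : GrassPairing U A)

/-- The pairing obtained by exchanging the two triangular parts and reversing the diagram. -/
def swap : GrassPairing U A where
  q := P.q⁻¹
  N := P.N
  r := P.N - P.r
  e i := P.q⁻¹ • P.f (P.N - i)
  f i := P.q⁻¹ • P.e (P.N - i)
  k i := P.k (P.N - i)
  k' i := P.k' (P.N - i)
  u i j := P.u (P.N + 1 - i) (P.N + 1 - j)
  s i j := P.s (P.N + 1 - i) (P.N + 1 - j)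
  pair := P.pair
  J := P.J
  B := P.B
  q_ne := inv_ne_zero P.q_ne
  q_zpow n hn := P.q_zpow n (by rwa [inv_zpow, inv_eq_one] at hn)
  r_pos := by have := P.r_lt; omega
  r_lt := by have := P.r_pos; have := P.r_lt; omega
  k_mul_k' i hi hi' := P.k_mul_k' _ (by omega) (by omega)
  k'_mul_k i hi hi' := P.k'_mul_k _ (by omega) (by omega)
  k_mul_e i hi hi' j hj hj' := by
    rw [mul_smul_comm, P.k_mul_f _ (by omega) (by omega) _ (by omega) (by omega), smul_mul_assoc,
      smul_comm, cartanSL_sub hi'.le hj'.le, inv_zpow, zpow_neg]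
  k_mul_f i hi hi' j hj hj' := by
    rw [mul_smul_comm, P.k_mul_e _ (by omega) (by omega) _ (by omega) (by omega), smul_mul_assoc,
      smul_comm, cartanSL_sub hi'.le hj'.le, inv_zpow, zpow_neg, inv_inv]
  e_mul_f i hi hi' j hj hj' := by
    have h := P.e_mul_f (P.N - j) (by omega) (by omega) (P.N - i) (by omega) (by omega)
    rw [cartanSL_sub hj'.le hi'.le, cartanSL_comm] at h
    have hq := P.q_ne
    have hz : P.q⁻¹ ^ cartanSL i j * P.q ^ cartanSL i j = 1 := by
      rw [inv_zpow, inv_mul_cancel₀ (zpow_ne_zero _ hq)]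
    rw [smul_mul_smul_comm, smul_mul_smul_comm, h, smul_smul, smul_add, smul_smul,
      show P.q⁻¹ ^ cartanSL i j * (P.q⁻¹ * P.q⁻¹) * P.q ^ cartanSL i j = P.q⁻¹ * P.q⁻¹ by
        linear_combination (P.q⁻¹ * P.q⁻¹) * hz, add_assoc, left_eq_add]
    by_cases hij : i = j
    · subst hij
      rw [if_pos rfl, if_pos rfl, smul_smul, ← add_smul]
      have hc : cartanSL i i = 2 := by simp [cartanSL]
      have hne := P.q_sub_inv_ne
      have hne' : P.q⁻¹ - P.q⁻¹⁻¹ ≠ 0 := by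
        rw [inv_inv, ← neg_sub]
        exact neg_ne_zero.mpr hne
      convert zero_smul ℂ _
      rw [hc, inv_inv, ← neg_sub P.q P.q⁻¹, inv_neg]
      have h2 : P.q⁻¹ ^ (2 : ℤ) = P.q⁻¹ ^ 2 := zpow_ofNat _ _
      rw [h2]
      field_simp
      ring
    · rw [if_neg (by omega), if_neg hij, smul_zero, add_zero]
  comul_e i hi hi' := by
    rw [map_smul, P.comul_f _ (by omega) (by omega), smul_add, TensorProduct.smul_tmul',
      TensorProduct.tmul_smul]
  comul_f i hi hi' := by
    rw [map_smul, P.comul_e _ (by omega) (by omega), smul_add, TensorProduct.smul_tmul',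
      TensorProduct.tmul_smul]
  comul_k i hi hi' := P.comul_k _ (by omega) (by omega)
  comul_k' i hi hi' := P.comul_k' _ (by omega) (by omega)
  gen := by
    rw [eq_top_iff, ← P.gen]
    refine Algebra.adjoin_le ?_
    rintro x ⟨i, ⟨hi, hi'⟩, h⟩
    have hi'' : P.N - (P.N - i) = i := by omega
    have mem : ∀ y, (y = P.q⁻¹ • P.f i ∨ y = P.q⁻¹ • P.e i ∨ y = P.k i ∨ y = P.k' i) →
        y ∈ Algebra.adjoin ℂ {x : U | ∃ i, (1 ≤ i ∧ i < P.N) ∧ (x = P.q⁻¹ • P.f (P.N - i) ∨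
          x = P.q⁻¹ • P.e (P.N - i) ∨ x = P.k (P.N - i) ∨ x = P.k' (P.N - i))} := fun y hy =>
      Algebra.subset_adjoin ⟨P.N - i, ⟨by omega, by omega⟩, by rwa [hi'']⟩
    rcases h with rfl | rfl | rfl | rfl
    · rw [← smul_inv_smul₀ P.q_ne (P.e i)]
      exact Subalgebra.smul_mem _ (mem _ (by simp)) _
    · rw [← smul_inv_smul₀ P.q_ne (P.f i)]
      exact Subalgebra.smul_mem _ (mem _ (by simp)) _
    · exact mem _ (by simp)
    · exact mem _ (by simp)
  genA := by
    rw [eq_top_iff, ← P.genA]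
    refine Algebra.adjoin_mono ?_
    rintro x ⟨i, j, hi, hj, rfl⟩
    refine ⟨P.N + 1 - i, P.N + 1 - j, by omega, by omega, ?_⟩
    congr 1 <;> omega
  pair_e l hl hl' i hi hi' j hj hj' := by
    rw [map_smul, LinearMap.smul_apply, P.pair_f _ (by omega) (by omega) _ (by omega) (by omega) _
      (by omega) (by omega), if_congr (show _ ↔ i = l ∧ j = l + 1 by omega) rfl rfl]
    simp
  pair_f l hl hl' i hi hi' j hj hj' := by
    rw [map_smul, LinearMap.smul_apply, P.pair_e _ (by omega) (by omega) _ (by omega) (by omega) _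
      (by omega) (by omega), if_congr (show _ ↔ i = l + 1 ∧ j = l by omega) rfl rfl]
    simp [P.q_ne]
  pair_k l hl hl' i hi hi' j hj hj' := by
    rw [P.pair_k _ (by omega) (by omega) _ (by omega) (by omega) _ (by omega) (by omega),
      if_congr (show _ ↔ i = j by omega) rfl rfl, stdCoord_simpleRoot_sub hl'.le hi hi', inv_zpow,
      zpow_neg]
  pair_k' l hl hl' i hi hi' j hj hj' := by
    rw [P.pair_k' _ (by omega) (by omega) _ (by omega) (by omega) _ (by omega) (by omega),
      if_congr (show _ ↔ i = j by omega) rfl rfl, stdCoord_simpleRoot_sub hl'.le hi hi', inv_zpow,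
      zpow_neg, zpow_neg, inv_inv]
  pair_one_u i hi hi' j hj hj' := by
    rw [P.pair_one_u _ (by omega) (by omega) _ (by omega) (by omega),
      if_congr (show _ ↔ i = j by omega) rfl rfl]
  pair_one_s i hi hi' j hj hj' := by
    rw [P.pair_one_s _ (by omega) (by omega) _ (by omega) (by omega),
      if_congr (show _ ↔ i = j by omega) rfl rfl]
  pair_mul_u x y i hi hi' j hj hj' := by
    rw [P.pair_mul_u x y _ (by omega) (by omega) _ (by omega) (by omega)]
    exact sum_Icc_reflect _ _
  pair_mul_s x y i hi hi' j hj hj' := by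
    rw [P.pair_mul_s x y _ (by omega) (by omega) _ (by omega) (by omega)]
    exact sum_Icc_reflect P.N
      fun m => P.pair y (P.s (P.N + 1 - i) m) * P.pair x (P.s m (P.N + 1 - j))
  s_mul_u i hi hi' j hj hj' := by
    rw [← sum_Icc_reflect P.N fun m => P.s (P.N + 1 - i) m * P.u m (P.N + 1 - j),
      P.s_mul_u _ (by omega) (by omega) _ (by omega) (by omega),
      if_congr (show _ ↔ i = j by omega) rfl rfl]
  pair_mul := P.pair_mul
  pair_one := P.pair_one
  pair_nondeg := P.pair_nondeg
  translate := P.translate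
  J_mul := P.J_mul
  J_e i hi hi' hr := P.J.smul_mem _ (P.J_f _ (by omega) (by omega) (by omega))
  J_f i hi hi' hr := P.J.smul_mem _ (P.J_e _ (by omega) (by omega) (by omega))
  J_k i hi hi' := P.J_k _ (by omega) (by omega)
  J_k' i hi hi' := P.J_k' _ (by omega) (by omega)
  pair_J_B := P.pair_J_B
  mem_B b he hf hk hk' := by
    have hr := P.r_lt
    have hsub : ∀ i, i < P.N → P.N - (P.N - i) = i := fun i hi => by omega
    refine P.mem_B b (fun i hi hi' hir x => ?_) (fun i hi hi' hir x => ?_) (fun i hi hi' x => ?_)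
      (fun i hi hi' x => ?_)
    · have := hf (P.N - i) (by omega) (by omega) (by omega) x
      simpa [hsub i hi', P.q_ne] using this
    · have := he (P.N - i) (by omega) (by omega) (by omega) x
      simpa [hsub i hi', P.q_ne] using this
    · have := hk (P.N - i) (by omega) (by omega) x
      simpa [hsub i hi'] using this
    · have := hk' (P.N - i) (by omega) (by omega) x
      simpa [hsub i hi'] using this

end GrassPairing

namespace GrassPairing

variable {U A : Type} [Ring U] [Bialgebra ℂ U] [Ring A] [Algebra ℂ A] (P : GrassPairing U A)

/-- The product of the `f j` along a word. -/
def fw (v : List ℕ) : U := (v.map P.f).prod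

/-- The product of the `e i` along a word. -/
def ew (w : List ℕ) : U := (w.map P.e).prod

lemma wordWt_append (v w : List ℕ) : wordWt (v ++ w) = wordWt v + wordWt w := by
  funext l
  simp [wordWt]

@[simp] lemma fw_nil : P.fw [] = 1 := rfl

@[simp] lemma ew_nil : P.ew [] = 1 := rfl

lemma fw_cons (j : ℕ) (v : List ℕ) : P.fw (j :: v) = P.f j * P.fw v := by
  simp [fw]

lemma fw_append_singleton (v : List ℕ) (j : ℕ) : P.fw (v ++ [j]) = P.fw v * P.f j := by
  simp [fw]

lemma ew_append_singleton (w : List ℕ) (i : ℕ) : P.ew (w ++ [i]) = P.ew w * P.e i := by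
  simp [ew]

variable {P}

lemma isWord_append_singleton {v : List ℕ} {j : ℕ} :
    P.IsWord (v ++ [j]) ↔ P.IsWord v ∧ 1 ≤ j ∧ j < P.N := by
  simp only [IsWord, List.mem_append, List.mem_singleton]
  exact ⟨fun h => ⟨fun i hi => h i (Or.inl hi), h j (Or.inr rfl)⟩,
    fun h i hi => hi.elim (h.1 i) fun hij => hij ▸ h.2⟩

lemma fw_mem_wt {v : List ℕ} (hv : P.IsWord v) : P.fw v ∈ P.wt (-wordWt v) := by
  induction v with
  | nil => simpa using one_mem_wt
  | cons j v ih =>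
    rw [isWord_cons] at hv
    rw [fw_cons, wordWt_cons, neg_add_rev]
    exact mul_mem_wt (f_mem_wt hv.1.1 hv.1.2) (ih hv.2)

lemma ew_mem_wt {w : List ℕ} (hw : P.IsWord w) : P.ew w ∈ P.wt (wordWt w) := by
  induction w using List.reverseRecOn with
  | nil => simpa using one_mem_wt
  | append_singleton w i ih =>
    rw [isWord_append_singleton] at hw
    rw [ew_append_singleton, wordWt_append, wordWt_cons, wordWt_nil, zero_add]
    exact mul_mem_wt (ih hw.1) (e_mem_wt hw.2.1 hw.2.2)

lemma mul_k_mem {M : Submodule ℂ U} (hM : P.J ≤ M) {c : ℕ → ℤ} {x : U} (hx : x ∈ P.wt c)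
    (hxM : x ∈ M) {l : ℕ} (hl : 1 ≤ l) (hl' : l < P.N) : x * P.k l ∈ M := by
  rw [← Submodule.smul_mem_iff _ (zpow_ne_zero (corootPair c l) P.q_ne), ← hx l hl hl',
    ← sub_add_cancel (P.k l * x) x]
  exact add_mem (hM (P.J_k_mul_sub hl hl' x)) hxM

lemma mul_k'_mem {M : Submodule ℂ U} (hM : P.J ≤ M) {c : ℕ → ℤ} {x : U} (hx : x ∈ P.wt c)
    (hxM : x ∈ M) {l : ℕ} (hl : 1 ≤ l) (hl' : l < P.N) : x * P.k' l ∈ M := by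
  rw [← Submodule.smul_mem_iff _ (zpow_ne_zero (-corootPair c l) P.q_ne),
    ← k'_mul_of_mem_wt hx hl hl', ← sub_add_cancel (P.k' l * x) x]
  exact add_mem (hM (P.J_k'_mul_sub hl hl' x)) hxM

lemma mul_k'_of_mem_wt {l : ℕ} (hl : 1 ≤ l) (hl' : l < P.N) {c : ℕ → ℤ} {x : U} (hx : x ∈ P.wt c) :
    x * P.k' l = P.q ^ corootPair c l • (P.k' l * x) := by
  rw [k'_mul_of_mem_wt hx hl hl', smul_smul, ← zpow_add₀ P.q_ne, add_neg_cancel, zpow_zero,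
    one_smul]

lemma mul_k'_mul_k'_mem {M : Submodule ℂ U} (hM : P.J ≤ M) {c : ℕ → ℤ} {x : U} (hx : x ∈ P.wt c)
    (hxM : x ∈ M) {l : ℕ} (hl : 1 ≤ l) (hl' : l < P.N) : x * (P.k' l * P.k' l) ∈ M := by
  rw [← mul_assoc, mul_k'_of_mem_wt hl hl' hx, smul_mul_assoc, mul_assoc, ← sub_add_cancel (P.k' l * _)
    (x * P.k' l)]
  exact M.smul_mem _ (add_mem (hM (P.J_k'_mul_sub hl hl' _)) (mul_k'_mem hM hx hxM hl hl'))

lemma mul_mem_sup_span {S : Set U} {x y : U} (h : ∀ m ∈ S, m * y ∈ P.J ⊔ Submodule.span ℂ S)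
    (hx : x ∈ P.J ⊔ Submodule.span ℂ S) : x * y ∈ P.J ⊔ Submodule.span ℂ S := by
  suffices H : P.J ⊔ Submodule.span ℂ S ≤
    (P.J ⊔ Submodule.span ℂ S).comap (LinearMap.mulRight ℂ y) from H hx
  refine sup_le (fun m hm => Submodule.mem_sup_left (P.J_mul m hm y)) (Submodule.span_le.mpr h)

lemma fw_mul_ew_mul_f_mem {v w : List ℕ} (hv : P.IsWord v) (hw : P.IsWord w) {j : ℕ} (hj : 1 ≤ j)
    (hj' : j < P.N) : P.fw v * P.ew w * P.f j ∈ P.J ⊔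
      Submodule.span ℂ {x | ∃ v w, P.IsWord v ∧ P.IsWord w ∧ x = P.fw v * P.ew w} := by
  have hmem : ∀ {v w}, P.IsWord v → P.IsWord w → P.fw v * P.ew w ∈ P.J ⊔
      Submodule.span ℂ {x | ∃ v w, P.IsWord v ∧ P.IsWord w ∧ x = P.fw v * P.ew w} :=
    fun hv hw => Submodule.mem_sup_right (Submodule.subset_span ⟨_, _, hv, hw, rfl⟩)
  induction w using List.reverseRecOn with
  | nil =>
    rw [ew_nil, mul_one, ← fw_append_singleton]
    simpa using hmem (isWord_append_singleton.mpr ⟨hv, hj, hj'⟩) P.isWord_nil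
  | append_singleton w i ih =>
    rw [isWord_append_singleton] at hw
    obtain ⟨hw, hi, hi'⟩ := hw
    rw [ew_append_singleton, mul_assoc, mul_assoc, P.e_mul_f i hi hi' j hj hj', ← mul_assoc,
      mul_add, mul_smul_comm]
    refine add_mem (Submodule.smul_mem _ _ ?_) ?_
    · rw [← mul_assoc]
      refine mul_mem_sup_span ?_ (ih hw)
      rintro _ ⟨v', w', hv', hw', rfl⟩
      rw [mul_assoc, ← ew_append_singleton]
      exact hmem hv' (isWord_append_singleton.mpr ⟨hw', hi, hi'⟩)
    · split_ifs
      · rw [mul_smul_comm, mul_sub, mul_one]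
        refine Submodule.smul_mem _ _ (sub_mem (hmem hv hw) ?_)
        exact mul_k'_mul_k'_mem le_sup_left (mul_mem_wt (fw_mem_wt hv) (ew_mem_wt hw))
          (hmem hv hw) hi hi'
      · rw [mul_zero]
        exact zero_mem _

variable (P) in
lemma J_sup_span_fw_mul_ew : P.J ⊔
    Submodule.span ℂ {x | ∃ v w, P.IsWord v ∧ P.IsWord w ∧ x = P.fw v * P.ew w} = ⊤ := by
  refine eq_top_iff.mpr fun x _ => mem_of_mem_adjoin_of_mul_mem ?_ ?_
    (P.gen ▸ Algebra.mem_top : x ∈ _)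
  · exact Submodule.mem_sup_right
      (Submodule.subset_span ⟨[], [], P.isWord_nil, P.isWord_nil, by simp⟩)
  · rintro m hm y ⟨i, ⟨hi, hi'⟩, hy⟩
    refine mul_mem_sup_span ?_ hm
    rintro _ ⟨v, w, hv, hw, rfl⟩
    have hvw := mul_mem_wt (fw_mem_wt hv) (ew_mem_wt hw)
    have hmem : P.fw v * P.ew w ∈ P.J ⊔
        Submodule.span ℂ {x | ∃ v w, P.IsWord v ∧ P.IsWord w ∧ x = P.fw v * P.ew w} :=
      Submodule.mem_sup_right (Submodule.subset_span ⟨v, w, hv, hw, rfl⟩)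
    rcases hy with rfl | rfl | rfl | rfl
    · rw [mul_assoc, ← ew_append_singleton]
      exact Submodule.mem_sup_right (Submodule.subset_span
        ⟨v, _, hv, isWord_append_singleton.mpr ⟨hw, hi, hi'⟩, rfl⟩)
    · exact fw_mul_ew_mul_f_mem hv hw hi hi'
    · exact mul_k_mem le_sup_left hvw hmem hi hi'
    · exact mul_k'_mem le_sup_left hvw hmem hi hi'

lemma fw_mul_e_mem {v : List ℕ} (hv : P.IsWord v) {i : ℕ} (hi : 1 ≤ i) (hi' : i < P.N)
    (hr : i ≠ P.r) :
    P.fw v * P.e i ∈ P.J ⊔ Submodule.span ℂ {x | ∃ v, P.IsWord v ∧ x = P.fw v} := by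
  have hmem : ∀ {v}, P.IsWord v →
      P.fw v ∈ P.J ⊔ Submodule.span ℂ {x | ∃ v, P.IsWord v ∧ x = P.fw v} :=
    fun hv => Submodule.mem_sup_right (Submodule.subset_span ⟨_, hv, rfl⟩)
  induction v using List.reverseRecOn with
  | nil =>
    rw [fw_nil, one_mul]
    exact Submodule.mem_sup_left (P.J_e i hi hi' hr)
  | append_singleton v j ih =>
    rw [isWord_append_singleton] at hv
    obtain ⟨hv, hj, hj'⟩ := hv
    rw [fw_append_singleton, mul_assoc,
      ← Submodule.smul_mem_iff _ (zpow_ne_zero (cartanSL i j) P.q_ne), ← mul_smul_comm,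
      eq_sub_of_add_eq (P.e_mul_f i hi hi' j hj hj').symm, mul_sub, ← mul_assoc]
    refine sub_mem ?_ ?_
    · refine mul_mem_sup_span ?_ (ih hv)
      rintro _ ⟨v', hv', rfl⟩
      rw [← fw_append_singleton]
      exact hmem (isWord_append_singleton.mpr ⟨hv', hj, hj'⟩)
    · split_ifs
      · rw [mul_smul_comm, mul_sub, mul_one]
        exact Submodule.smul_mem _ _ (sub_mem (hmem hv)
          (mul_k'_mul_k'_mem le_sup_left (fw_mem_wt hv) (hmem hv) hi hi'))
      · rw [mul_zero]
        exact zero_mem _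

variable (P) in
lemma J_sup_span_fw_mul_yw : P.J ⊔
    Submodule.span ℂ {x | ∃ v w, P.IsWord v ∧ P.IsWord w ∧ x = P.fw v * P.yw w} = ⊤ := by
  rw [eq_top_iff, ← J_sup_span_fw_mul_ew P]
  refine sup_le le_sup_left (Submodule.span_le.mpr ?_)
  rintro _ ⟨v, w, hv, hw, rfl⟩
  have hmem : ∀ {v w}, P.IsWord v → P.IsWord w → P.fw v * P.yw w ∈ P.J ⊔
      Submodule.span ℂ {x | ∃ v w, P.IsWord v ∧ P.IsWord w ∧ x = P.fw v * P.yw w} :=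
    fun hv hw => Submodule.mem_sup_right (Submodule.subset_span ⟨_, _, hv, hw, rfl⟩)
  rw [SetLike.mem_coe]
  induction w using List.reverseRecOn with
  | nil => simpa [yw] using hmem hv P.isWord_nil
  | append_singleton w i ih =>
    rw [isWord_append_singleton] at hw
    obtain ⟨hw, hi, hi'⟩ := hw
    rw [ew_append_singleton, ← mul_assoc]
    refine mul_mem_sup_span ?_ (ih hw)
    rintro _ ⟨v', w', hv', hw', rfl⟩
    have hiw : P.IsWord (i :: w') := isWord_cons.mpr ⟨⟨hi, hi'⟩, hw'⟩
    rw [mul_assoc]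
    by_cases hr : i = P.r
    · subst hr
      rw [← yw_cons_r]
      exact hmem hv' hiw
    · have h := yw_cons P hr w'
      rw [ad_apply, eq_sub_iff_add_eq'] at h
      rw [← h, mul_add, mul_smul_comm]
      refine add_mem (Submodule.smul_mem _ _ ?_) (hmem hv' hiw)
      obtain ⟨a, ha, p, hp, hap⟩ := Submodule.mem_sup.mp (fw_mul_e_mem hv' hi hi' hr)
      rw [← mul_assoc, ← hap, add_mul]
      refine add_mem (Submodule.mem_sup_left (P.J_mul a ha _)) ?_
      suffices H : Submodule.span ℂ {x | ∃ v, P.IsWord v ∧ x = P.fw v} ≤ (P.J ⊔ Submodule.span ℂ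
        {x | ∃ v w, P.IsWord v ∧ P.IsWord w ∧ x = P.fw v * P.yw w}).comap
          (LinearMap.mulRight ℂ (P.yw w')) from H hp
      refine Submodule.span_le.mpr ?_
      rintro _ ⟨u, hu, rfl⟩
      exact hmem hu hw'

end GrassPairing

namespace GrassPairing

variable {U A : Type} [Ring U] [Bialgebra ℂ U] [Ring A] [Algebra ℂ A] (P : GrassPairing U A)

/-- The span of the tensors whose first factor has height at least `h`. -/
def upTensor (h : ℤ) : Submodule ℂ (U ⊗[ℂ] U) :=
  Submodule.span ℂ {x | ∃ a ∈ P.Up h, ∃ b, x = a ⊗ₜ[ℂ] b}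

variable {P}

lemma tmul_mem_upTensor {h : ℤ} {a : U} (ha : a ∈ P.Up h) (b : U) :
    a ⊗ₜ[ℂ] b ∈ P.upTensor h := Submodule.subset_span ⟨a, ha, b, rfl⟩

lemma upTensor_anti {h h' : ℤ} (hh : h ≤ h') : P.upTensor h' ≤ P.upTensor h :=
  Submodule.span_mono fun _ ⟨a, ha, b, hx⟩ => ⟨a, Up_anti hh ha, b, hx⟩

lemma mul_mem_upTensor {h h' : ℤ} {x y : U ⊗[ℂ] U} (hx : x ∈ P.upTensor h)
    (hy : y ∈ P.upTensor h') : x * y ∈ P.upTensor (h + h') := by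
  have hxy := Submodule.mul_mem_mul hx hy
  rw [upTensor, upTensor, Submodule.span_mul_span] at hxy
  refine Submodule.span_le.mpr ?_ hxy
  rintro _ ⟨_, ⟨a, ha, b, rfl⟩, _, ⟨a', ha', b', rfl⟩, rfl⟩
  beta_reduce
  rw [Algebra.TensorProduct.tmul_mul_tmul]
  exact tmul_mem_upTensor (mul_mem_Up ha ha') _

lemma comul_sub_mem_of_mem_adjoin {z : U} (hz : z ∈ Algebra.adjoin ℂ P.eSet) :
    Coalgebra.comul (R := ℂ) z - 1 ⊗ₜ[ℂ] z ∈ P.upTensor 1 := by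
  induction hz using Algebra.adjoin_induction with
  | mem z hz =>
    obtain ⟨i, ⟨hi, hi'⟩, rfl⟩ := hz
    rw [P.comul_e i hi hi', add_sub_cancel_right]
    exact tmul_mem_upTensor (e_mem_Up hi hi') _
  | algebraMap c =>
    rw [Algebra.algebraMap_eq_smul_one, map_smul, Bialgebra.comul_one,
      Algebra.TensorProduct.one_def, TensorProduct.tmul_smul, sub_self]
    exact zero_mem _
  | add x y _ _ hx hy =>
    rw [map_add, TensorProduct.tmul_add, add_sub_add_comm]
    exact add_mem hx hy
  | mul x y _ _ hx hy =>
    have hy0 : Coalgebra.comul (R := ℂ) y ∈ P.upTensor 0 := by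
      rw [← sub_add_cancel (Coalgebra.comul (R := ℂ) y) (1 ⊗ₜ[ℂ] y)]
      exact add_mem (upTensor_anti zero_le_one hy) (tmul_mem_upTensor one_mem_Up _)
    have : Coalgebra.comul (R := ℂ) (x * y) - 1 ⊗ₜ[ℂ] (x * y) =
        (Coalgebra.comul (R := ℂ) x - 1 ⊗ₜ[ℂ] x) * Coalgebra.comul (R := ℂ) y +
          1 ⊗ₜ[ℂ] x * (Coalgebra.comul (R := ℂ) y - 1 ⊗ₜ[ℂ] y) := by
      rw [Bialgebra.comul_mul, sub_mul, mul_sub, Algebra.TensorProduct.tmul_mul_tmul, one_mul]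
      abel
    rw [this]
    exact add_mem (by simpa using mul_mem_upTensor hx hy0)
      (by simpa using mul_mem_upTensor (tmul_mem_upTensor one_mem_Up x) hy)

lemma fw_mem_Up {v : List ℕ} (hv : P.IsWord v) : P.fw v ∈ P.Up (-(v.length : ℤ)) := by
  induction v with
  | nil => simpa using one_mem_Up
  | cons j v ih =>
    rw [isWord_cons] at hv
    rw [fw_cons, List.length_cons, Nat.cast_succ, neg_add_rev]
    exact mul_mem_Up (f_mem_Up hv.1.1 hv.1.2) (ih hv.2)

variable (P) in
/-- The product of the `k' j` along a word. -/
def kw (v : List ℕ) : U := (v.map P.k').prod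

lemma pair_kw_mul {v : List ℕ} (hv : P.IsWord v) (z : U) {c : A} (hc : c ∈ P.B) :
    P.pair (P.kw v * z) c = P.pair z c := by
  induction v with
  | nil => simp [kw]
  | cons j v ih =>
    rw [isWord_cons] at hv
    rw [← ih hv.2, kw, List.map_cons, List.prod_cons, mul_assoc, P.pair_k'_mul hv.1.1 hv.1.2 _ hc]
    rfl

lemma comul_fw_sub_mem {v : List ℕ} (hv : P.IsWord v) :
    Coalgebra.comul (R := ℂ) (P.fw v) - P.fw v ⊗ₜ[ℂ] P.kw v ∈ P.upTensor (1 - v.length) := by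
  induction v with
  | nil => simp [kw, Algebra.TensorProduct.one_def]
  | cons j v ih =>
    rw [isWord_cons] at hv
    obtain ⟨⟨hj, hj'⟩, hv⟩ := hv
    have h0 : Coalgebra.comul (R := ℂ) (P.fw v) ∈ P.upTensor (-(v.length : ℤ)) := by
      rw [← sub_add_cancel (Coalgebra.comul (R := ℂ) (P.fw v)) (P.fw v ⊗ₜ[ℂ] P.kw v)]
      exact add_mem (upTensor_anti (by omega) (ih hv)) (tmul_mem_upTensor (fw_mem_Up hv) _)
    have : Coalgebra.comul (R := ℂ) (P.fw (j :: v)) - P.fw (j :: v) ⊗ₜ[ℂ] P.kw (j :: v) =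
        P.f j ⊗ₜ[ℂ] P.k' j * (Coalgebra.comul (R := ℂ) (P.fw v) - P.fw v ⊗ₜ[ℂ] P.kw v) +
          1 ⊗ₜ[ℂ] P.f j * Coalgebra.comul (R := ℂ) (P.fw v) := by
      rw [fw_cons, Bialgebra.comul_mul, P.comul_f j hj hj', mul_sub, add_mul,
        Algebra.TensorProduct.tmul_mul_tmul, kw, kw, List.map_cons, List.prod_cons]
      abel
    rw [this]
    refine add_mem (upTensor_anti ?_ (mul_mem_upTensor (tmul_mem_upTensor (f_mem_Up hj hj') _)
      (ih hv))) (upTensor_anti ?_ (mul_mem_upTensor (tmul_mem_upTensor one_mem_Up _) h0))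
    · rw [List.length_cons]; push_cast; omega
    · rw [List.length_cons]; push_cast; omega

lemma del_fw_mul_sub_mem {v : List ℕ} (hv : P.IsWord v) {z : U}
    (hz : z ∈ Algebra.adjoin ℂ P.eSet) {c : A} (hc : c ∈ P.B) :
    P.del c (P.fw v * z) - P.pair z c • P.fw v ∈ P.Up (1 - v.length) := by
  have key : Coalgebra.comul (R := ℂ) (P.fw v * z) - P.fw v ⊗ₜ[ℂ] (P.kw v * z) ∈
      P.upTensor (1 - v.length) := by
    have h1 := comul_sub_mem_of_mem_adjoin hz
    have h0 : Coalgebra.comul (R := ℂ) z ∈ P.upTensor 0 := by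
      rw [← sub_add_cancel (Coalgebra.comul (R := ℂ) z) (1 ⊗ₜ[ℂ] z)]
      exact add_mem (upTensor_anti zero_le_one h1) (tmul_mem_upTensor one_mem_Up _)
    have : Coalgebra.comul (R := ℂ) (P.fw v * z) - P.fw v ⊗ₜ[ℂ] (P.kw v * z) =
        (Coalgebra.comul (R := ℂ) (P.fw v) - P.fw v ⊗ₜ[ℂ] P.kw v) * Coalgebra.comul (R := ℂ) z +
          P.fw v ⊗ₜ[ℂ] P.kw v * (Coalgebra.comul (R := ℂ) z - 1 ⊗ₜ[ℂ] z) := by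
      rw [Bialgebra.comul_mul, sub_mul, mul_sub, Algebra.TensorProduct.tmul_mul_tmul, mul_one]
      abel
    rw [this]
    refine add_mem (by simpa using mul_mem_upTensor (comul_fw_sub_mem hv) h0)
      (upTensor_anti (by omega) (mul_mem_upTensor (tmul_mem_upTensor (fw_mem_Up hv) _) h1))
  suffices H : P.upTensor (1 - v.length) ≤ (P.Up (1 - v.length)).comap
      ((TensorProduct.rid ℂ U).toLinearMap ∘ₗ LinearMap.lTensor U (P.pair.flip c)) by
    have := H key
    rw [Submodule.mem_comap, map_sub] at this
    simpa [-Bialgebra.comul_mul, ← del_apply, pair_kw_mul hv z hc] using this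
  refine Submodule.span_le.mpr ?_
  rintro _ ⟨a, ha, b, rfl⟩
  simpa using Submodule.smul_mem _ _ ha

variable (P) in
/-- The part of height `-b` of the negative part. -/
def V (b : ℕ) : Submodule ℂ U :=
  Submodule.span ℂ {x | ∃ v, P.IsWord v ∧ v.length = b ∧ x = P.fw v}

variable (P) in
/-- The span of the products of words of length less than `b` in the `f j` and elements of
`YF`. -/
def lowFilt (b : ℕ) : Submodule ℂ U :=
  Submodule.span ℂ {x | ∃ v, P.IsWord v ∧ v.length < b ∧ ∃ z ∈ P.YF, x = P.fw v * z}

lemma wtHeight_wordWt {v : List ℕ} (hv : P.IsWord v) :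
    wtHeight P.N (wordWt v) = v.length := by
  induction v with
  | nil => simp [wtHeight]
  | cons j v ih =>
    rw [isWord_cons] at hv
    rw [wordWt_cons, wtHeight_add, wtHeight_simpleRoot hv.1.2, ih hv.2, List.length_cons,
      Nat.cast_succ]

lemma V_le_wtS (b : ℕ) : P.V b ≤ P.wtS {c | wtHeight P.N c = -(b : ℤ)} := by
  refine Submodule.span_le.mpr ?_
  rintro _ ⟨v, hv, rfl, rfl⟩
  exact mem_wtS (by rw [Set.mem_ofPred_eq, wtHeight_neg, wtHeight_wordWt hv])
    (isSuppWt_wordWt hv).neg (fw_mem_wt hv)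

lemma f_mem_adjoin_swap {j : ℕ} (hj : 1 ≤ j) (hj' : j < P.N) :
    P.f j ∈ Algebra.adjoin ℂ P.swap.eSet := by
  rw [← smul_inv_smul₀ P.q_ne (P.f j)]
  refine Subalgebra.smul_mem _ (Algebra.subset_adjoin ?_) _
  refine ⟨P.N - j, ?_, ?_⟩
  · change 1 ≤ P.N - j ∧ P.N - j < P.N
    omega
  · change _ = P.q⁻¹ • P.f (P.N - (P.N - j))
    rw [Nat.sub_sub_self hj'.le]

lemma mem_J_of_mem_V {b : ℕ} {x : U} (hx : x ∈ P.V b) (hxI : x ∈ P.I) : x ∈ P.J := by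
  refine mem_J_of_mem_I_of_mem_adjoin (P := P.swap) ?_ hxI
  refine (Submodule.span_le (p := Subalgebra.toSubmodule (Algebra.adjoin ℂ P.swap.eSet))).mpr ?_ hx
  rintro _ ⟨v, hv, -, rfl⟩
  refine list_prod_mem (S := Algebra.adjoin ℂ P.swap.eSet) fun y hy => ?_
  obtain ⟨j, hj, rfl⟩ := List.mem_map.mp hy
  exact f_mem_adjoin_swap (hv j hj).1 (hv j hj).2

lemma del_mem_Up_of_mem_lowFilt {b : ℕ} {x : U} (hx : x ∈ P.lowFilt b) {c : A} (hc : c ∈ P.B) :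
    P.del c x ∈ P.Up (1 - b) := by
  suffices H : P.lowFilt b ≤ (P.Up (1 - b)).comap (P.del c) from H hx
  refine Submodule.span_le.mpr ?_
  rintro _ ⟨v, hv, hvb, z, hz, rfl⟩
  rw [SetLike.mem_coe, Submodule.mem_comap,
    ← sub_add_cancel (P.del c (P.fw v * z)) (P.pair z c • P.fw v)]
  exact add_mem (Up_anti (by omega) (del_fw_mul_sub_mem hv (YF_le_adjoin hz) hc))
    (Submodule.smul_mem _ _ (Up_anti (by omega) (fw_mem_Up hv)))

lemma del_mul_sub_mem_Up {b : ℕ} {p : U} (hp : p ∈ P.V b) {z : U} (hz : z ∈ P.YF) {c : A}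
    (hc : c ∈ P.B) : P.del c (p * z) - P.pair z c • p ∈ P.Up (1 - b) := by
  suffices H : P.V b ≤ (P.Up (1 - b)).comap
      (P.del c ∘ₗ LinearMap.mulRight ℂ z - P.pair z c • LinearMap.id) from H hp
  refine Submodule.span_le.mpr ?_
  rintro _ ⟨v, hv, rfl, rfl⟩
  exact del_fw_mul_sub_mem hv (YF_le_adjoin hz) hc

lemma exists_of_mem_lowFilt_succ {ι : Type*} (β : Module.Basis ι ℂ P.YF) {b : ℕ} {x : U}
    (hx : x ∈ P.lowFilt (b + 1)) : ∃ t ∈ P.lowFilt b, ∃ g : ι →₀ P.V b,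
      x = t + g.sum fun k p => (p : U) * (β k : U) := by
  let L : (ι →₀ P.V b) →ₗ[ℂ] U :=
    Finsupp.lsum ℂ fun k => LinearMap.mulRight ℂ (β k : U) ∘ₗ (P.V b).subtype
  suffices H : P.lowFilt (b + 1) ≤ P.lowFilt b ⊔ LinearMap.range L by
    obtain ⟨t, ht, _, ⟨g, rfl⟩, h⟩ := Submodule.mem_sup.mp (H hx)
    exact ⟨t, ht, g, h.symm⟩
  refine Submodule.span_le.mpr ?_
  rintro _ ⟨v, hv, hvb, z, hz, rfl⟩
  rcases Nat.lt_succ_iff_lt_or_eq.mp hvb with h | h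
  · exact Submodule.mem_sup_left (Submodule.subset_span ⟨v, hv, h, z, hz, rfl⟩)
  · refine Submodule.mem_sup_right ?_
    have hz' : z = (β.repr ⟨z, hz⟩).sum fun k t => t • (β k : U) := by
      have := congrArg (P.YF.subtype) (β.linearCombination_repr ⟨z, hz⟩)
      rw [Finsupp.linearCombination_apply, map_finsuppSum] at this
      exact this.symm
    rw [hz', Finsupp.mul_sum]
    refine Submodule.sum_mem _ fun k _ => ?_
    dsimp only
    rw [mul_smul_comm]
    refine Submodule.smul_mem _ _ ⟨Finsupp.single k
      ⟨P.fw v, Submodule.subset_span ⟨v, hv, h, rfl⟩⟩, ?_⟩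
    simp [L]

lemma mem_J_of_mem_lowFilt (b : ℕ) {x : U} (hx : x ∈ P.lowFilt b) (hxI : x ∈ P.I) : x ∈ P.J := by
  induction b generalizing x with
  | zero =>
    have : P.lowFilt 0 ≤ P.J := Submodule.span_le.mpr (by
      rintro _ ⟨v, -, hv, -⟩
      exact absurd hv (Nat.not_lt_zero _))
    exact this hx
  | succ b ih =>
    let β := Module.Basis.ofVectorSpace ℂ P.YF
    obtain ⟨t, ht, g, rfl⟩ := exists_of_mem_lowFilt_succ β hx
    have hg : ∀ c ∈ P.B, g.sum (fun k p => P.pair (β k) c • (p : U)) ∈ P.J := by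
      intro c hc
      have hV : g.sum (fun k p => P.pair (β k) c • (p : U)) ∈ P.V b :=
        Submodule.sum_mem _ fun k _ => Submodule.smul_mem _ _ (g k).2
      refine mem_J_of_mem_V hV (mem_I_of_add_mem_I (S := {c | wtHeight P.N c = -(b : ℤ)})
        (S' := {c | 1 - (b : ℤ) ≤ wtHeight P.N c}) ?_ (V_le_wtS b hV)
        (y := P.del c (t + g.sum fun k p => (p : U) * (β k : U)) -
          g.sum (fun k p => P.pair (β k) c • (p : U))) ?_ ?_)
      · rw [Set.disjoint_left]
        intro d hd hd'
        rw [Set.mem_ofPred_eq] at hd hd'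
        omega
      · rw [map_add, map_finsuppSum, add_sub_assoc, Finsupp.sum, Finsupp.sum,
          ← Finset.sum_sub_distrib]
        exact add_mem (del_mem_Up_of_mem_lowFilt ht hc)
          (Submodule.sum_mem _ fun k _ => del_mul_sub_mem_Up (g k).2 (β k).2 hc)
      · rw [add_sub_cancel]
        exact P.del_mem_I hc hxI
    have hgJ : ∀ k, (g k : U) ∈ P.J := by
      intro k
      by_contra hk
      obtain ⟨φ, hφ, hφJ⟩ := Submodule.exists_le_ker_of_notMem hk
      apply hφ
      have hy : ((g.sum fun k p => φ (p : U) • β k : P.YF) : U) = 0 := by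
        refine eq_zero_of_mem_YF_of_mem_I (Subtype.property _) fun c hc => ?_
        have h := hφJ (hg c hc)
        rw [LinearMap.mem_ker, map_finsuppSum] at h
        rw [← P.YF.subtype_apply, map_finsuppSum, map_finsuppSum, Finsupp.sum,
          LinearMap.sum_apply, ← h]
        refine Finset.sum_congr rfl fun k _ => ?_
        simp [mul_comm]
      have hy' := (Submodule.coe_eq_zero (p := P.YF)).mp hy
      by_cases hks : k ∈ g.support
      · exact linearIndependent_iff'.mp β.linearIndependent g.support (fun k => φ (g k : U)) hy' k
          hks
      · rw [Finsupp.notMem_support_iff.mp hks, ZeroMemClass.coe_zero, map_zero]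
    have hsum : (g.sum fun k p => (p : U) * (β k : U)) ∈ P.J :=
      P.J.sum_mem fun k _ => P.J_mul _ (hgJ k) _
    refine add_mem (ih ht ?_) hsum
    exact (P.I.add_mem_iff_left (P.J_le_I hsum)).mp hxI

lemma exists_mem_lowFilt {x : U}
    (hx : x ∈ Submodule.span ℂ {x | ∃ v w, P.IsWord v ∧ P.IsWord w ∧ x = P.fw v * P.yw w}) :
    ∃ b, x ∈ P.lowFilt b := by
  have mono : Monotone P.lowFilt := fun b b' h => Submodule.span_mono
    fun x ⟨v, hv, hvb, hz⟩ => ⟨v, hv, hvb.trans_le h, hz⟩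
  refine Submodule.span_induction (p := fun x _ => ∃ b, x ∈ P.lowFilt b) ?_ ?_ ?_ ?_ hx
  · rintro _ ⟨v, w, hv, hw, rfl⟩
    exact ⟨v.length + 1, Submodule.subset_span ⟨v, hv, Nat.lt_succ_self _, _, yw_mem_YF hw, rfl⟩⟩
  · exact ⟨0, zero_mem _⟩
  · rintro x y _ _ ⟨b, hb⟩ ⟨b', hb'⟩
    exact ⟨max b b', add_mem (mono (le_max_left _ _) hb) (mono (le_max_right _ _) hb')⟩
  · rintro a x _ ⟨b, hb⟩
    exact ⟨b, Submodule.smul_mem _ _ hb⟩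

variable (P) in
/-- Elements of `U` which vanish on `B` lie in the right ideal `J`. -/
theorem I_le_J : P.I ≤ P.J := by
  intro x hx
  obtain ⟨j, hj, t, ht, rfl⟩ := Submodule.mem_sup.mp
    ((J_sup_span_fw_mul_yw P).ge (Submodule.mem_top : x ∈ ⊤))
  obtain ⟨b, hb⟩ := exists_mem_lowFilt ht
  exact add_mem hj (mem_J_of_mem_lowFilt b hb ((P.I.add_mem_iff_right (P.J_le_I hj)).mp hx))

end GrassPairing

lemma Transcendental.zpow_eq_one {q : ℝ} (hq : Transcendental ℚ q) {n : ℤ}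
    (hn : (q : ℂ) ^ n = 1) : n = 0 := by
  have h : q ^ n = 1 := by exact_mod_cast hn
  have h' : q ^ n.natAbs = 1 := by
    rcases Int.natAbs_eq n with hn | hn
    · rw [hn, zpow_natCast] at h
      exact h
    · rw [hn, zpow_neg, zpow_natCast, inv_eq_one] at h
      exact h
  by_contra h0
  exact hq (IsAlgebraic.of_pow (Int.natAbs_pos.mpr h0) (h' ▸ isAlgebraic_one))

lemma Transcendental.ofReal_ne_zero {q : ℝ} (hq : Transcendental ℚ q) : (q : ℂ) ≠ 0 :=
  Complex.ofReal_ne_zero.mpr fun h => hq (h ▸ isAlgebraic_zero)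

namespace UqslData

variable {q : ℝ} {N : ℕ} (D : UqslData q N) {i j : ℕ}

lemma mem_Icc_of_lt (hi : 1 ≤ i) (hi' : i < N) : i ∈ Finset.Icc 1 (N - 1) :=
  Finset.mem_Icc.mpr ⟨hi, by omega⟩

lemma Kg_mul_Ki (hi : 1 ≤ i) (hi' : i < N) : D.Kg i * D.Ki i = 1 :=
  (D.rels.1 i (mem_Icc_of_lt hi hi')).1

lemma Ki_mul_Kg (hi : 1 ≤ i) (hi' : i < N) : D.Ki i * D.Kg i = 1 :=
  (D.rels.1 i (mem_Icc_of_lt hi hi')).2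

lemma Kg_mul_Ki_comm (hi : 1 ≤ i) (hi' : i < N) (hj : 1 ≤ j) (hj' : j < N) :
    D.Kg i * D.Ki j = D.Ki j * D.Kg i := by
  have h := D.rels.2.1 i (mem_Icc_of_lt hi hi') j (mem_Icc_of_lt hj hj')
  calc D.Kg i * D.Ki j = D.Ki j * (D.Kg j * D.Kg i) * D.Ki j := by
        rw [← mul_assoc, D.Ki_mul_Kg hj hj', one_mul]
    _ = D.Ki j * D.Kg i := by
        rw [← h, mul_assoc, mul_assoc, D.Kg_mul_Ki hj hj', mul_one]

lemma Ki_mul_F (hq : (q : ℂ) ≠ 0) (hi : 1 ≤ i) (hi' : i < N) (hj : 1 ≤ j) (hj' : j < N) :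
    D.Ki i * D.F j = (q : ℂ) ^ cartanSL i j • (D.F j * D.Ki i) := by
  have h := D.rels.2.2.2.1 i (mem_Icc_of_lt hi hi') j (mem_Icc_of_lt hj hj')
  calc D.Ki i * D.F j = (q : ℂ) ^ cartanSL i j •
        (D.Ki i * ((q : ℂ) ^ (-cartanSL i j) • (D.F j * D.Kg i)) * D.Ki i) := by
        rw [mul_smul_comm, smul_mul_assoc, smul_smul, ← zpow_add₀ hq, add_neg_cancel, zpow_zero,
          one_smul, mul_assoc, mul_assoc, D.Kg_mul_Ki hi hi', mul_one]
    _ = (q : ℂ) ^ cartanSL i j • (D.F j * D.Ki i) := by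
        rw [← h, ← mul_assoc, D.Ki_mul_Kg hi hi', one_mul]

lemma Kg_mul_E_mul_Ki (hi : 1 ≤ i) (hi' : i < N) (hj : 1 ≤ j) (hj' : j < N) :
    D.Kg i * (D.E j * D.Ki j) = (q : ℂ) ^ cartanSL i j • (D.E j * D.Ki j * D.Kg i) := by
  rw [← mul_assoc, D.rels.2.2.1 i (mem_Icc_of_lt hi hi') j (mem_Icc_of_lt hj hj'),
    smul_mul_assoc, mul_assoc, D.Kg_mul_Ki_comm hi hi' hj hj', mul_assoc]

lemma E_mul_Ki_mul_F (hq : (q : ℂ) ≠ 0) (hi : 1 ≤ i) (hi' : i < N) (hj : 1 ≤ j) (hj' : j < N) :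
    D.E i * D.Ki i * D.F j = (q : ℂ) ^ cartanSL i j • (D.F j * (D.E i * D.Ki i)) +
      if i = j then ((q : ℂ) ^ 2 * ((q : ℂ) - (q : ℂ)⁻¹)⁻¹) • (1 - D.Ki i * D.Ki i) else 0 := by
  have h := D.rels.2.2.2.2.1 i (mem_Icc_of_lt hi hi') j (mem_Icc_of_lt hj hj')
  rw [sub_eq_iff_eq_add'] at h
  rw [mul_assoc, D.Ki_mul_F hq hi hi' hj hj', mul_smul_comm, ← mul_assoc, h, add_mul, smul_add,
    mul_assoc]
  congr 1
  split_ifs with hij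
  · subst hij
    have hc : (q : ℂ) ^ cartanSL i i = (q : ℂ) ^ 2 := by simp [cartanSL]
    rw [smul_mul_assoc, sub_mul, D.Kg_mul_Ki hi hi', smul_smul, hc]
  · rw [zero_mul, smul_zero]

lemma comul_E_mul_Ki (hi : 1 ≤ i) (hi' : i < N) : Coalgebra.comul (R := ℂ) (D.E i * D.Ki i) =
    (D.E i * D.Ki i) ⊗ₜ[ℂ] D.Ki i + 1 ⊗ₜ[ℂ] (D.E i * D.Ki i) := by
  rw [Bialgebra.comul_mul, D.comul_E i (mem_Icc_of_lt hi hi'), D.comul_Ki i (mem_Icc_of_lt hi hi'),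
    add_mul, Algebra.TensorProduct.tmul_mul_tmul, Algebra.TensorProduct.tmul_mul_tmul, one_mul,
    D.Kg_mul_Ki hi hi']

variable {D} {r : ℕ}

lemma Jsub_mul {x : D.U} (hx : x ∈ D.Jsub r) (y : D.U) : x * y ∈ D.Jsub r := by
  suffices H : D.Jsub r ≤ (D.Jsub r).comap (LinearMap.mulRight ℂ y) from H hx
  refine Submodule.span_le.mpr ?_
  rintro _ ⟨k, hk, hk0, u, rfl⟩
  exact Submodule.subset_span ⟨k, hk, hk0, u * y, mul_assoc _ _ _⟩

lemma mem_Jsub {k : D.U} (hk : k ∈ D.Ksub r) (hk0 : Coalgebra.counit (R := ℂ) k = 0) :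
    k ∈ D.Jsub r := Submodule.subset_span ⟨k, hk, hk0, 1, (mul_one k).symm⟩

lemma E_mem_Ksub (hi : 1 ≤ i) (hi' : i < N) (hr : i ≠ r) : D.E i ∈ D.Ksub r :=
  Algebra.subset_adjoin (Or.inl ⟨i, mem_Icc_of_lt hi hi', hr, Or.inl rfl⟩)

lemma F_mem_Ksub (hi : 1 ≤ i) (hi' : i < N) (hr : i ≠ r) : D.F i ∈ D.Ksub r :=
  Algebra.subset_adjoin (Or.inl ⟨i, mem_Icc_of_lt hi hi', hr, Or.inr rfl⟩)

lemma Kg_mem_Ksub (hi : 1 ≤ i) (hi' : i < N) : D.Kg i ∈ D.Ksub r :=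
  Algebra.subset_adjoin (Or.inr ⟨i, mem_Icc_of_lt hi hi', Or.inl rfl⟩)

lemma Ki_mem_Ksub (hi : 1 ≤ i) (hi' : i < N) : D.Ki i ∈ D.Ksub r :=
  Algebra.subset_adjoin (Or.inr ⟨i, mem_Icc_of_lt hi hi', Or.inr rfl⟩)

end UqslData

namespace QslnFun

variable {q : ℝ} {N : ℕ} {D : UqslData q N} (P : QslnFun q N D)

lemma pair_hitL (κ x : D.U) (b : P.A) : P.pair x (P.hitL κ b) = P.pair (κ * x) b := by
  rw [P.pair_mulU, hitL, LinearMap.comp_apply]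
  induction Coalgebra.comul (R := ℂ) b with
  | zero => simp
  | add s t hs ht => simp only [map_add, hs, ht]
  | tmul s t => simp

lemma mem_Bmod {r : ℕ} {b : P.A} : b ∈ P.Bmod r ↔ ∀ κ ∈ D.Ksub r, ∀ x,
    P.pair (κ * x) b = Coalgebra.counit (R := ℂ) κ * P.pair x b := by
  have key : ∀ κ x, P.pair x (P.hitL (κ - algebraMap ℂ D.U (Coalgebra.counit (R := ℂ) κ)) b) =
      P.pair (κ * x) b - Coalgebra.counit (R := ℂ) κ * P.pair x b := fun κ x => by
    rw [pair_hitL, sub_mul, map_sub, LinearMap.sub_apply, ← Algebra.smul_def, map_smul,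
      LinearMap.smul_apply, smul_eq_mul]
  simp only [Bmod, Submodule.mem_iInf, LinearMap.mem_ker, Subtype.forall]
  refine forall₂_congr fun κ _ => ⟨fun h x => ?_, fun h => P.nondegA _ fun x => ?_⟩
  · rw [← sub_eq_zero, ← key, h, map_zero]
  · rw [key, h, sub_self]

lemma mem_Bmod_of_gen {r : ℕ} {b : P.A}
    (hE : ∀ i, 1 ≤ i → i < N → i ≠ r → ∀ x, P.pair (D.E i * x) b = 0)
    (hF : ∀ i, 1 ≤ i → i < N → i ≠ r → ∀ x, P.pair (D.F i * x) b = 0)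
    (hKg : ∀ i, 1 ≤ i → i < N → ∀ x, P.pair (D.Kg i * x) b = P.pair x b)
    (hKi : ∀ i, 1 ≤ i → i < N → ∀ x, P.pair (D.Ki i * x) b = P.pair x b) : b ∈ P.Bmod r := by
  refine P.mem_Bmod.mpr fun κ hκ => ?_
  have hlt : ∀ i ∈ Finset.Icc 1 (N - 1), 1 ≤ i ∧ i < N := fun i hi => by
    rw [Finset.mem_Icc] at hi; omega
  induction hκ using Algebra.adjoin_induction with
  | mem κ hκ =>
    intro x
    rcases hκ with ⟨i, hi, hr, rfl | rfl⟩ | ⟨i, hi, rfl | rfl⟩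
    · rw [hE i (hlt i hi).1 (hlt i hi).2 hr, D.counit_E i hi, zero_mul]
    · rw [hF i (hlt i hi).1 (hlt i hi).2 hr, D.counit_F i hi, zero_mul]
    · rw [hKg i (hlt i hi).1 (hlt i hi).2, D.counit_Kg i hi, one_mul]
    · rw [hKi i (hlt i hi).1 (hlt i hi).2, D.counit_Ki i hi, one_mul]
  | algebraMap c =>
    intro x
    rw [← Algebra.smul_def, map_smul, LinearMap.smul_apply, smul_eq_mul,
      Bialgebra.counit_algebraMap]
  | add κ κ' _ _ h h' =>
    intro x
    rw [add_mul, map_add, LinearMap.add_apply, h, h', map_add, add_mul]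
  | mul κ κ' _ _ h h' =>
    intro x
    rw [mul_assoc, h, h', Bialgebra.counit_mul, mul_assoc]

lemma pair_eq_zero_of_mem_Jsub {r : ℕ} {b : P.A} (hb : b ∈ P.Bmod r) {x : D.U}
    (hx : x ∈ D.Jsub r) : P.pair x b = 0 := by
  suffices H : D.Jsub r ≤ LinearMap.ker (P.pair.flip b) from H hx
  refine Submodule.span_le.mpr ?_
  rintro _ ⟨k, hk, hk0, u, rfl⟩
  rw [SetLike.mem_coe, LinearMap.mem_ker, LinearMap.flip_apply, P.mem_Bmod.mp hb k hk, hk0,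
    zero_mul]

lemma pair_mul_u (x y : D.U) {i j : ℕ} (hi : i ∈ Finset.Icc 1 N) (hj : j ∈ Finset.Icc 1 N) :
    P.pair (x * y) (P.u i j) = ∑ m ∈ Finset.Icc 1 N, P.pair x (P.u i m) * P.pair y (P.u m j) := by
  simp [P.pair_mulU, P.comul_u i hi j hj]

lemma exists_pair_eq_pair_mul (y : D.U) (b : P.A) :
    ∃ b', ∀ x, P.pair x b' = P.pair (x * y) b := by
  refine ⟨TensorProduct.rid ℂ P.A (LinearMap.lTensor P.A (P.pair y)
    (Coalgebra.comul (R := ℂ) b)), fun x => ?_⟩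
  rw [P.pair_mulU]
  induction Coalgebra.comul (R := ℂ) b with
  | zero => simp
  | add s t hs ht => simp only [map_add, hs, ht]
  | tmul s t => simp [mul_comm]

lemma sum_antipode_u_mul_u {i j : ℕ} (hi : i ∈ Finset.Icc 1 N) (hj : j ∈ Finset.Icc 1 N) :
    ∑ m ∈ Finset.Icc 1 N, HopfAlgebra.antipode (R := ℂ) (P.u i m) * P.u m j =
      if i = j then 1 else 0 := by
  have h := HopfAlgebra.mul_antipode_rTensor_comul_apply (R := ℂ) (P.u i j)
  rw [P.comul_u i hi j hj, P.counit_u i hi j hj] at h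
  simp only [map_sum, LinearMap.rTensor_tmul, LinearMap.mul'_apply] at h
  rw [h]
  split_ifs <;> simp

/-- The pairing of `U_q(sl_N)` with `O_q(SL_N)` as a `GrassPairing`. -/
def toGrassPairing (hq : Transcendental ℚ q) {r : ℕ} (hr1 : 1 ≤ r) (hr2 : r ≤ N - 1)
    {Bsub : Subalgebra ℂ P.A} (hB : Subalgebra.toSubmodule Bsub = P.Bmod r) :
    GrassPairing D.U P.A where
  q := q
  N := N
  r := r
  e i := D.E i * D.Ki i
  f := D.F
  k := D.Kg
  k' := D.Ki
  u := P.u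
  s i j := HopfAlgebra.antipode (R := ℂ) (P.u i j)
  pair := P.pair
  J := D.Jsub r
  B := Bsub
  q_ne := hq.ofReal_ne_zero
  q_zpow _ hn := hq.zpow_eq_one hn
  r_pos := hr1
  r_lt := by omega
  k_mul_k' _ hi hi' := D.Kg_mul_Ki hi hi'
  k'_mul_k _ hi hi' := D.Ki_mul_Kg hi hi'
  k_mul_e _ hi hi' _ hj hj' := D.Kg_mul_E_mul_Ki hi hi' hj hj'
  k_mul_f _ hi hi' _ hj hj' :=
    D.rels.2.2.2.1 _ (UqslData.mem_Icc_of_lt hi hi') _ (UqslData.mem_Icc_of_lt hj hj')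
  e_mul_f _ hi hi' _ hj hj' :=
    D.E_mul_Ki_mul_F hq.ofReal_ne_zero hi hi' hj hj'
  comul_e _ hi hi' := D.comul_E_mul_Ki hi hi'
  comul_f _ hi hi' := D.comul_F _ (UqslData.mem_Icc_of_lt hi hi')
  comul_k _ hi hi' := D.comul_Kg _ (UqslData.mem_Icc_of_lt hi hi')
  comul_k' _ hi hi' := D.comul_Ki _ (UqslData.mem_Icc_of_lt hi hi')
  gen := by
    rw [eq_top_iff, ← D.gen]
    refine Algebra.adjoin_le ?_
    rintro x ⟨i, hi, hx⟩
    have hi' : 1 ≤ i ∧ i < N := by rw [Finset.mem_Icc] at hi; omega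
    have mem : ∀ y, (y = D.E i * D.Ki i ∨ y = D.F i ∨ y = D.Kg i ∨ y = D.Ki i) →
        y ∈ Algebra.adjoin ℂ {x : D.U | ∃ i, (1 ≤ i ∧ i < N) ∧
          (x = D.E i * D.Ki i ∨ x = D.F i ∨ x = D.Kg i ∨ x = D.Ki i)} :=
      fun y hy => Algebra.subset_adjoin ⟨i, hi', hy⟩
    rcases hx with rfl | rfl | rfl | rfl
    · rw [← mul_one (D.E i), ← D.Ki_mul_Kg hi'.1 hi'.2, ← mul_assoc]
      exact mul_mem (mem _ (by simp)) (mem _ (by simp))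
    · exact mem _ (by simp)
    · exact mem _ (by simp)
    · exact mem _ (by simp)
  genA := by
    rw [eq_top_iff, ← P.genA]
    refine Algebra.adjoin_mono ?_
    rintro x ⟨i, hi, j, hj, rfl⟩
    exact ⟨i, j, Finset.mem_Icc.mp hi, Finset.mem_Icc.mp hj, rfl⟩
  pair_e l hl hl' i hi hi' j hj hj' := by
    have hl'' := UqslData.mem_Icc_of_lt hl hl'
    have hi'' := Finset.mem_Icc.mpr ⟨hi, hi'⟩
    have hj'' := Finset.mem_Icc.mpr ⟨hj, hj'⟩
    have hl1 : l + 1 ∈ Finset.Icc 1 N := by rw [Finset.mem_Icc]; omega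
    rw [P.pair_mul_u _ _ hi'' hj'', Finset.sum_eq_single_of_mem (l + 1) hl1,
      P.pair_E l hl'' i hi'' _ hl1, P.pair_Ki l hl'' _ hl1 j hj'']
    · by_cases h' : j = l + 1
      · subst h'
        simp
      · simp [h', Ne.symm h']
    · intro m hm hml
      rw [P.pair_E l hl'' i hi'' m hm, if_neg (fun h => hml h.2), zero_mul]
  pair_f l hl hl' i hi hi' j hj hj' := P.pair_F l (UqslData.mem_Icc_of_lt hl hl') i
    (Finset.mem_Icc.mpr ⟨hi, hi'⟩) j (Finset.mem_Icc.mpr ⟨hj, hj'⟩)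
  pair_k l hl hl' i hi hi' j hj hj' := by
    rw [P.pair_Kg l (UqslData.mem_Icc_of_lt hl hl') i (Finset.mem_Icc.mpr ⟨hi, hi'⟩) j
      (Finset.mem_Icc.mpr ⟨hj, hj'⟩), stdCoord_simpleRoot hi]
    by_cases h : i = l
    · simp [h]
    · by_cases h' : i = l + 1 <;> simp [h, h']
  pair_k' l hl hl' i hi hi' j hj hj' := by
    rw [P.pair_Ki l (UqslData.mem_Icc_of_lt hl hl') i (Finset.mem_Icc.mpr ⟨hi, hi'⟩) j
      (Finset.mem_Icc.mpr ⟨hj, hj'⟩), stdCoord_simpleRoot hi]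
    by_cases h : i = l
    · simp [h]
    · by_cases h' : i = l + 1 <;> simp [h, h']
  pair_one_u i hi hi' j hj hj' := by
    rw [P.pair_oneU, P.counit_u i (Finset.mem_Icc.mpr ⟨hi, hi'⟩) j (Finset.mem_Icc.mpr ⟨hj, hj'⟩)]
  pair_one_s i hi hi' j hj hj' := by
    rw [P.pair_oneU, HopfAlgebra.counit_antipode,
      P.counit_u i (Finset.mem_Icc.mpr ⟨hi, hi'⟩) j (Finset.mem_Icc.mpr ⟨hj, hj'⟩)]
  pair_mul_u x y i hi hi' j hj hj' :=
    P.pair_mul_u x y (Finset.mem_Icc.mpr ⟨hi, hi'⟩) (Finset.mem_Icc.mpr ⟨hj, hj'⟩)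
  pair_mul_s x y i hi hi' j hj hj' := by
    simp_rw [← P.pair_antipode]
    rw [HopfAlgebra.antipode_mul_antidistrib,
      P.pair_mul_u _ _ (Finset.mem_Icc.mpr ⟨hi, hi'⟩) (Finset.mem_Icc.mpr ⟨hj, hj'⟩)]
  s_mul_u i hi hi' j hj hj' :=
    P.sum_antipode_u_mul_u (Finset.mem_Icc.mpr ⟨hi, hi'⟩) (Finset.mem_Icc.mpr ⟨hj, hj'⟩)
  pair_mul := P.pair_mulA
  pair_one := P.pair_oneA
  pair_nondeg := P.nondegU
  translate := P.exists_pair_eq_pair_mul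
  J_mul _ hx y := UqslData.Jsub_mul hx y
  J_e i hi hi' hr := UqslData.mem_Jsub
    (mul_mem (UqslData.E_mem_Ksub hi hi' hr) (UqslData.Ki_mem_Ksub hi hi'))
    (by rw [Bialgebra.counit_mul, D.counit_E i (UqslData.mem_Icc_of_lt hi hi'), zero_mul])
  J_f i hi hi' hr := UqslData.mem_Jsub (UqslData.F_mem_Ksub hi hi' hr)
    (D.counit_F i (UqslData.mem_Icc_of_lt hi hi'))
  J_k i hi hi' := UqslData.mem_Jsub (sub_mem (UqslData.Kg_mem_Ksub hi hi') (one_mem _))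
    (by rw [map_sub, D.counit_Kg i (UqslData.mem_Icc_of_lt hi hi'), Bialgebra.counit_one,
      sub_self])
  J_k' i hi hi' := UqslData.mem_Jsub (sub_mem (UqslData.Ki_mem_Ksub hi hi') (one_mem _))
    (by rw [map_sub, D.counit_Ki i (UqslData.mem_Icc_of_lt hi hi'), Bialgebra.counit_one,
      sub_self])
  pair_J_B x hx b hb := P.pair_eq_zero_of_mem_Jsub (hB ▸ hb) hx
  mem_B b he hf hk hk' := by
    rw [← Subalgebra.mem_toSubmodule, hB]
    refine P.mem_Bmod_of_gen (fun i hi hi' hr x => ?_) hf hk hk'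
    rw [← mul_one (D.E i), ← D.Ki_mul_Kg hi hi', ← mul_assoc, mul_assoc]
    exact he i hi hi' hr _

end QslnFun

/-- Lemma `nondeg`.  The pairing `⟨·,·⟩ : B ⊗ Ū → ℂ` between the
quantum Grassmannian `B = O_q(Gr(r,N))` and `Ū = U/K⁺U` is nondegenerate:  an element
of `B` on which all of `U` vanishes is zero, and an element of `U` which vanishes on
all of `B` lies in `K⁺U`. -/
theorem pairing_B_Ubar_nondegenerate
    (q : ℝ) (hq : Transcendental ℚ q)
    (N r : ℕ) (hN : 2 ≤ N) (hr1 : 1 ≤ r) (hr2 : r ≤ N - 1)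
    (D : UqslData q N) (P : QslnFun q N D)
    (Bsub : Subalgebra ℂ P.A) (hB : Subalgebra.toSubmodule Bsub = P.Bmod r) :
    (∀ b ∈ Bsub, (∀ x : D.U, P.pair x b = 0) → b = 0) ∧
    (∀ x : D.U, (∀ b ∈ Bsub, P.pair x b = 0) → x ∈ D.Jsub r) :=
  ⟨fun b _ h => P.nondegA b h, fun _ h => (P.toGrassPairing hq hr1 hr2 hB).I_le_J h⟩
end
end

section
/- For all k ≥ 0, dim (B⁺)ᵏ/(B⁺)^{k+1} ≤ C(2r(N−r)+k−1, k), the binomial coefficient '2r(N−r)+k−1 choose k'. -/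
noncomputable section

open scoped TensorProduct

/-- The entries `R̂^{ij}_{kl}` of the `R̂`-matrix of the vector representation of
`U_q(sl_N)`:  `R̂^{ij}_{kl} = q^{δ_{ij}} δ_{il} δ_{jk} + (q - q⁻¹) θ(i<j) δ_{ik} δ_{jl}`. -/
def Rhat (q : ℝ) (i j k l : ℕ) : ℂ :=
  (if i = l ∧ j = k then (q : ℂ) ^ (if i = j then (1 : ℤ) else 0) else 0) +
  (if i = k ∧ j = l ∧ i < j then ((q : ℂ) - (q : ℂ)⁻¹) else 0)

/-- The defining relations of the quantum Grassmannian `O_q(Gr(r,N))` for a candidate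
family of generators `z_{ij}`: the reflection-equation relations, the trace relation
`Σ_i z_{ii} = (1 - q^{-2s})/(q - q⁻¹)` (`s = N - r`), and the projector relation
`q^{2N+1} Σ_n q^{-2n} z_{in} z_{nk} = z_{ik}`. -/
def GrassRels (q : ℝ) (N r : ℕ) {V : Type} [Ring V] [Algebra ℂ V]
    (z : ℕ → ℕ → V) : Prop :=
  (∀ a ∈ Finset.Icc 1 N, ∀ b ∈ Finset.Icc 1 N, ∀ c ∈ Finset.Icc 1 N, ∀ d ∈ Finset.Icc 1 N,
    (∑ i ∈ Finset.Icc 1 N, ∑ j ∈ Finset.Icc 1 N, ∑ k ∈ Finset.Icc 1 N, ∑ l ∈ Finset.Icc 1 N,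
      ((q : ℂ) ^ (2 * (b : ℤ) - 2 * (j : ℤ)) * Rhat q k b j l * Rhat q i l c d) •
        (z i j * z k a)) =
    (∑ i ∈ Finset.Icc 1 N, ∑ j ∈ Finset.Icc 1 N, ∑ k ∈ Finset.Icc 1 N, ∑ l ∈ Finset.Icc 1 N,
      ((q : ℂ) ^ (2 * (l : ℤ) - 2 * (i : ℤ)) * Rhat q j l i d * Rhat q a b k l) •
        (z c i * z j k))) ∧
  ((∑ i ∈ Finset.Icc 1 N, z i i) =
    algebraMap ℂ V ((1 - (q : ℂ) ^ (-(2 : ℤ) * ((N : ℤ) - (r : ℤ)))) /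
      ((q : ℂ) - (q : ℂ)⁻¹))) ∧
  (∀ i ∈ Finset.Icc 1 N, ∀ k ∈ Finset.Icc 1 N,
    ((q : ℂ) ^ (2 * (N : ℤ) + 1)) •
        ∑ n ∈ Finset.Icc 1 N, ((q : ℂ) ^ (-(2 : ℤ) * (n : ℤ))) • (z i n * z n k) =
      z i k)

/-- The quantum Grassmannian `B = O_q(Gr(r,N))`, presented by the generators `z_{ij}`
(`i,j = 1,…,N`) and the relations `GrassRels`, together with its counit. -/
structure QGrassData (q : ℝ) (N r : ℕ) where
  B : Type
  [instRing : Ring B]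
  [instAlg : Algebra ℂ B]
  z : ℕ → ℕ → B
  rels : GrassRels q N r z
  counit : B →ₐ[ℂ] ℂ
  counit_z : ∀ i ∈ Finset.Icc 1 N, ∀ j ∈ Finset.Icc 1 N,
    counit (z i j) = if i = j ∧ r < i then (q : ℂ) ^ (2 * (i : ℤ) - (2 * (N : ℤ) + 1)) else 0
  gen : Algebra.adjoin ℂ
      {x : B | ∃ i ∈ Finset.Icc 1 N, ∃ j ∈ Finset.Icc 1 N, x = z i j} = ⊤
  univ : ∀ (V : Type) [Ring V] [Algebra ℂ V] (w : ℕ → ℕ → V), GrassRels q N r w →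
      ∃ φ : B →ₐ[ℂ] V, ∀ i ∈ Finset.Icc 1 N, ∀ j ∈ Finset.Icc 1 N, φ (z i j) = w i j

attribute [instance] QGrassData.instRing QGrassData.instAlg

namespace QGrassData

variable {q : ℝ} {N r : ℕ} (G : QGrassData q N r)

/-- The augmentation ideal `B⁺ = B ∩ ker ε`, as a `ℂ`-subspace of `B`. -/
def Bp : Submodule ℂ G.B := LinearMap.ker G.counit.toLinearMap

end QGrassData

theorem Submodule.list_map_prod_mem_pow {A ι : Type*} [Ring A] [Algebra ℂ A]
    {I : Submodule ℂ A} {x : ι → A} (hx : ∀ a, x a ∈ I) (l : List ι) : (l.map x).prod ∈ I ^ l.length := by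
  induction l with
  | nil => exact Submodule.one_le.1 le_rfl
  | cons a l ih =>
    rw [List.map_cons, List.prod_cons, List.length_cons, pow_succ']
    exact Submodule.mul_mem_mul (hx a) ih

section Spanning

variable {A : Type*} [Ring A] [Algebra ℂ A] {ι : Type*} [LinearOrder ι]

/-- The span of the ordered monomials of degree `k` in the family `x`. -/
def orderedSpan (x : ι → A) (k : ℕ) : Submodule ℂ A :=
  Submodule.span ℂ {m | ∃ l : List ι, l.Pairwise (· ≤ ·) ∧ l.length = k ∧ (l.map x).prod = m}

theorem orderedSpan_le_pow {I : Submodule ℂ A} {x : ι → A} (hx : ∀ a, x a ∈ I) (k : ℕ) :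
    orderedSpan x k ≤ I ^ k := by
  refine Submodule.span_le.2 ?_
  rintro _ ⟨l, -, rfl, rfl⟩
  exact Submodule.list_map_prod_mem_pow hx l

theorem mul_mem_orderedSpan_sup [WellFoundedLT ι] {I : Submodule ℂ A} {x : ι → A}
    (hx : ∀ a, x a ∈ I)
    (hswap : ∀ a b, b < a →
      x a * x b ∈ Submodule.span ℂ {m | ∃ c < a, ∃ d, x c * x d = m} ⊔ I ^ 3)
    {k : ℕ} (hk : Submodule.span ℂ (Set.range x) * orderedSpan x (k - 1) ≤
      orderedSpan x k ⊔ I ^ (k + 1)) (a : ι) :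
    ∀ w ∈ orderedSpan x k, x a * w ∈ orderedSpan x (k + 1) ⊔ I ^ (k + 2) := by
  induction a using WellFoundedLT.induction with
  | ind a ih =>
  intro w hw
  induction hw using Submodule.span_induction with
  | zero => simp
  | add u v _ _ hu hv => rw [mul_add]; exact add_mem hu hv
  | smul t u _ hu => rw [mul_smul_comm]; exact Submodule.smul_mem _ _ hu
  | mem w hw =>
    obtain ⟨l, hl, rfl, rfl⟩ := hw
    by_cases hal : (a :: l).Pairwise (· ≤ ·)
    · exact Submodule.mem_sup_left (Submodule.subset_span ⟨a :: l, hal, by simp, by simp⟩)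
    · cases l with
      | nil => simp at hal
      | cons b l =>
        have hba : b < a := by
          by_contra! hab
          refine hal (List.pairwise_cons.2 ⟨?_, hl⟩)
          intro c hc
          rcases List.mem_cons.1 hc with rfl | hc
          · exact hab
          · exact hab.trans ((List.pairwise_cons.1 hl).1 c hc)
        have hl' : (l.map x).prod ∈ orderedSpan x l.length :=
          Submodule.subset_span ⟨l, (List.pairwise_cons.1 hl).2, rfl, rfl⟩
        rw [List.map_cons, List.prod_cons, ← mul_assoc]
        obtain ⟨u, hu, v, hv, huv⟩ := Submodule.mem_sup.1 (hswap a b hba)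
        rw [← huv, add_mul]
        refine add_mem ?_ ?_
        · clear huv
          induction hu using Submodule.span_induction with
          | zero => simp
          | add u v _ _ hu hv => rw [add_mul]; exact add_mem hu hv
          | smul t u _ hu => rw [smul_mul_assoc]; exact Submodule.smul_mem _ _ hu
          | mem u hu =>
            obtain ⟨c, hc, d, rfl⟩ := hu
            rw [mul_assoc]
            obtain ⟨p, hp, m, hm, hpm⟩ := Submodule.mem_sup.1
              (hk (Submodule.mul_mem_mul (Submodule.subset_span ⟨d, rfl⟩) (by simpa using hl')))
            rw [← hpm, mul_add]
            refine add_mem (ih c hc p hp) (Submodule.mem_sup_right ?_)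
            have := Submodule.mul_mem_mul (hx c) hm
            rwa [← pow_succ'] at this
        · refine Submodule.mem_sup_right ?_
          have := Submodule.mul_mem_mul hv (Submodule.list_map_prod_mem_pow hx l)
          rw [← pow_add] at this
          convert this using 2
          simp; omega

theorem span_mul_orderedSpan_le [WellFoundedLT ι] {I : Submodule ℂ A} {x : ι → A}
    (hx : ∀ a, x a ∈ I)
    (hswap : ∀ a b, b < a →
      x a * x b ∈ Submodule.span ℂ {m | ∃ c < a, ∃ d, x c * x d = m} ⊔ I ^ 3) (k : ℕ) :
    Submodule.span ℂ (Set.range x) * orderedSpan x k ≤ orderedSpan x (k + 1) ⊔ I ^ (k + 2) := by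
  have key : ∀ n, (∀ a, ∀ w ∈ orderedSpan x n, x a * w ∈ orderedSpan x (n + 1) ⊔ I ^ (n + 2)) →
      Submodule.span ℂ (Set.range x) * orderedSpan x n ≤ orderedSpan x (n + 1) ⊔ I ^ (n + 2) := by
    intro n h
    refine Submodule.mul_le.2 fun u hu w hw => ?_
    induction hu using Submodule.span_induction with
    | zero => simp
    | add u v _ _ hu hv => rw [add_mul]; exact add_mem hu hv
    | smul t u _ hu => rw [smul_mul_assoc]; exact Submodule.smul_mem _ _ hu
    | mem u hu => obtain ⟨a, rfl⟩ := hu; exact h a w hw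
  induction k with
  | zero =>
    refine key 0 fun a w hw => Submodule.mem_sup_left ?_
    induction hw using Submodule.span_induction with
    | zero => simp
    | add u v _ _ hu hv => rw [mul_add]; exact add_mem hu hv
    | smul t u _ hu => rw [mul_smul_comm]; exact Submodule.smul_mem _ _ hu
    | mem w hw =>
      obtain ⟨l, -, hl, rfl⟩ := hw
      obtain rfl := List.length_eq_zero_iff.1 hl
      exact Submodule.subset_span ⟨[a], by simp, by simp, by simp⟩
  | succ k ih => exact key _ (mul_mem_orderedSpan_sup hx hswap ih)

theorem pow_le_orderedSpan_sup [WellFoundedLT ι] {I : Submodule ℂ A} {x : ι → A}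
    (hx : ∀ a, x a ∈ I) (hI : I ≤ Submodule.span ℂ (Set.range x) ⊔ I ^ 2)
    (hswap : ∀ a b, b < a →
      x a * x b ∈ Submodule.span ℂ {m | ∃ c < a, ∃ d, x c * x d = m} ⊔ I ^ 3) (k : ℕ) :
    I ^ k ≤ orderedSpan x k ⊔ I ^ (k + 1) := by
  induction k with
  | zero =>
    rw [pow_zero, Submodule.one_eq_span, Submodule.span_le, Set.singleton_subset_iff]
    exact Submodule.mem_sup_left (Submodule.subset_span ⟨[], by simp, by simp, by simp⟩)
  | succ k ih =>
    calc I ^ (k + 1) = I * I ^ k := pow_succ' _ _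
      _ ≤ I * (orderedSpan x k ⊔ I ^ (k + 1)) := mul_le_mul' le_rfl ih
      _ = I * orderedSpan x k ⊔ I ^ (k + 2) := by rw [Submodule.mul_sup, ← pow_succ']
      _ ≤ _ := by
        refine sup_le ?_ le_sup_right
        refine (mul_le_mul' hI le_rfl).trans ?_
        rw [Submodule.sup_mul]
        refine sup_le (span_mul_orderedSpan_le hx hswap k) ?_
        refine (mul_le_mul' le_rfl (orderedSpan_le_pow hx k)).trans ?_
        rw [← pow_add]
        exact le_sup_of_le_right (by rw [add_comm])

theorem rank_orderedSpan_le {A : Type} [Ring A] [Algebra ℂ A] {ι : Type} [LinearOrder ι]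
    [Fintype ι] (x : ι → A) (k : ℕ) :
    Module.rank ℂ (orderedSpan x k) ≤ ((Fintype.card ι + k - 1).choose k : Cardinal) := by
  have hsub : {m | ∃ l : List ι, l.Pairwise (· ≤ ·) ∧ l.length = k ∧ (l.map x).prod = m} ⊆
      Set.range fun s : Sym ι k => ((s.1.sort (· ≤ ·)).map x).prod := by
    rintro _ ⟨l, hl, hk, rfl⟩
    refine ⟨⟨l, by simpa using hk⟩, ?_⟩
    dsimp only
    rw [Multiset.coe_sort, List.mergeSort_eq_self]
    simpa using hl
  calc Module.rank ℂ (orderedSpan x k) ≤ Module.rank ℂ (Submodule.span ℂ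
        (Set.range fun s : Sym ι k => ((s.1.sort (· ≤ ·)).map x).prod)) :=
        Submodule.rank_mono (Submodule.span_mono hsub)
    _ ≤ Cardinal.mk (Set.range fun s : Sym ι k => ((s.1.sort (· ≤ ·)).map x).prod) :=
        rank_span_le _
    _ ≤ Cardinal.mk (Sym ι k) := Cardinal.mk_range_le
    _ = _ := by rw [Cardinal.mk_fintype, Sym.card_sym_eq_choose]

theorem rank_pow_quotient_le {A : Type} [Ring A] [Algebra ℂ A] {ι : Type} [LinearOrder ι]
    [Fintype ι] {I : Submodule ℂ A} {x : ι → A}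
    (hx : ∀ a, x a ∈ I) (hI : I ≤ Submodule.span ℂ (Set.range x) ⊔ I ^ 2)
    (hswap : ∀ a b, b < a →
      x a * x b ∈ Submodule.span ℂ {m | ∃ c < a, ∃ d, x c * x d = m} ⊔ I ^ 3) (k : ℕ) :
    Module.rank ℂ (↥(I ^ k) ⧸ Submodule.comap (I ^ k).subtype (I ^ (k + 1))) ≤
      ((Fintype.card ι + k - 1).choose k : Cardinal) := by
  refine le_trans ?_ (rank_orderedSpan_le x k)
  refine LinearMap.rank_le_of_surjective ((Submodule.comap (I ^ k).subtype (I ^ (k + 1))).mkQ ∘ₗ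
    Submodule.inclusion (orderedSpan_le_pow hx k)) fun y => ?_
  obtain ⟨⟨y, hy⟩, rfl⟩ := Submodule.mkQ_surjective _ y
  obtain ⟨u, hu, v, hv, rfl⟩ := Submodule.mem_sup.1 (pow_le_orderedSpan_sup hx hI hswap k hy)
  refine ⟨⟨u, hu⟩, ?_⟩
  rw [LinearMap.comp_apply, Submodule.mkQ_apply, Submodule.mkQ_apply, Submodule.Quotient.eq]
  simpa using hv

end Spanning

section Relations

variable {V : Type*} [AddCommGroup V] [Module ℂ V]

theorem sum_rotate {V : Type*} [AddCommMonoid V] (s : Finset ℕ) (f : ℕ → ℕ → ℕ → V) :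
    (∑ i ∈ s, ∑ j ∈ s, ∑ k ∈ s, f i j k) = ∑ j ∈ s, ∑ k ∈ s, ∑ i ∈ s, f i j k :=
  Finset.sum_comm.trans (Finset.sum_congr rfl fun _ _ => Finset.sum_comm)

theorem sum_Rhat_lower_smul (q : ℝ) {N c d : ℕ} (hc : c ∈ Finset.Icc 1 N)
    (hd : d ∈ Finset.Icc 1 N) (F : ℕ → ℕ → V) :
    (∑ i ∈ Finset.Icc 1 N, ∑ l ∈ Finset.Icc 1 N, Rhat q i l c d • F i l) =
      ((q : ℂ) ^ (if c = d then (1 : ℤ) else 0)) • F d c +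
        if c < d then ((q : ℂ) - (q : ℂ)⁻¹) • F c d else 0 := by
  simp only [Rhat, add_smul, Finset.sum_add_distrib, ite_smul, zero_smul, ite_and]
  congr 1
  · rw [Finset.sum_eq_single d, Finset.sum_eq_single c] <;> simp_all [eq_comm]
  · rw [Finset.sum_eq_single c, Finset.sum_eq_single d] <;> simp_all

theorem sum_Rhat_upper_smul (q : ℝ) {N a b : ℕ} (ha : a ∈ Finset.Icc 1 N)
    (hb : b ∈ Finset.Icc 1 N) (F : ℕ → ℕ → V) :
    (∑ k ∈ Finset.Icc 1 N, ∑ l ∈ Finset.Icc 1 N, Rhat q a b k l • F k l) =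
      ((q : ℂ) ^ (if a = b then (1 : ℤ) else 0)) • F b a +
        if a < b then ((q : ℂ) - (q : ℂ)⁻¹) • F a b else 0 := by
  simp only [Rhat, add_smul, Finset.sum_add_distrib, ite_smul, zero_smul, ite_and]
  congr 1
  · rw [Finset.sum_eq_single b, Finset.sum_eq_single a] <;> simp_all +contextual [eq_comm]
  · rw [Finset.sum_eq_single a, Finset.sum_eq_single b] <;> simp_all +contextual [eq_comm]

theorem sum_Rhat_outer_smul (q : ℝ) {N b l : ℕ} (hb : b ∈ Finset.Icc 1 N)
    (hl : l ∈ Finset.Icc 1 N) (F : ℕ → ℕ → V) :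
    (∑ j ∈ Finset.Icc 1 N, ∑ k ∈ Finset.Icc 1 N, Rhat q k b j l • F j k) =
      ((q : ℂ) ^ (if b = l then (1 : ℤ) else 0)) • F b l +
        if b = l then ((q : ℂ) - (q : ℂ)⁻¹) • ∑ k ∈ Finset.Ico 1 b, F k k else 0 := by
  simp only [Rhat, add_smul, Finset.sum_add_distrib, ite_smul, zero_smul, ite_and]
  congr 1
  · rw [Finset.sum_eq_single b, Finset.sum_eq_single l] <;> simp_all [eq_comm]
  · split_ifs with h
    · subst h
      rw [Finset.smul_sum, ← Finset.sum_subset (s₁ := Finset.Ico 1 b)]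
      · refine Finset.sum_congr rfl fun j hj => ?_
        rw [Finset.sum_eq_single j] <;> simp_all +contextual
        omega
      · intro j hj; simp only [Finset.mem_Ico, Finset.mem_Icc] at *; omega
      · intro j hj hj'
        refine Finset.sum_eq_zero fun k _ => ?_
        simp_all
    · simp

end Relations

section Explicit

variable {V : Type} [Ring V] [Algebra ℂ V]

theorem GrassRels.reflection {q : ℝ} {N r : ℕ} {z : ℕ → ℕ → V} (h : GrassRels q N r z)
    {a b c d : ℕ} (ha : a ∈ Finset.Icc 1 N) (hb : b ∈ Finset.Icc 1 N)
    (hc : c ∈ Finset.Icc 1 N) (hd : d ∈ Finset.Icc 1 N) (hbd : b ≠ d) :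
    ((q : ℂ) ^ (if c = d then (1 : ℤ) else 0)) •
        (((q : ℂ) ^ (if b = c then (1 : ℤ) else 0)) • (z d b * z c a) +
          if b = c then ((q : ℂ) - (q : ℂ)⁻¹) •
            ∑ j ∈ Finset.Ico 1 b, ((q : ℂ) ^ (2 * (b : ℤ) - 2 * (j : ℤ))) • (z d j * z j a)
          else 0) +
      (if c < d then ((q : ℂ) - (q : ℂ)⁻¹) • (z c b * z d a) else 0) =
    ((q : ℂ) ^ (if a = b then (1 : ℤ) else 0)) •
        (((q : ℂ) ^ (if a = d then (1 : ℤ) else 0)) • (z c a * z d b) +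
          if a = d then ((q : ℂ) - (q : ℂ)⁻¹) •
            ∑ i ∈ Finset.Ico 1 a, ((q : ℂ) ^ (2 * (a : ℤ) - 2 * (i : ℤ))) • (z c i * z i b)
          else 0) +
      (if a < b then ((q : ℂ) - (q : ℂ)⁻¹) • (z c b * z d a) else 0) := by
  have key := h.1 a ha b hb c hc d hd
  have hL : (∑ i ∈ Finset.Icc 1 N, ∑ j ∈ Finset.Icc 1 N, ∑ k ∈ Finset.Icc 1 N,
      ∑ l ∈ Finset.Icc 1 N,
      ((q : ℂ) ^ (2 * (b : ℤ) - 2 * (j : ℤ)) * Rhat q k b j l * Rhat q i l c d) •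
        (z i j * z k a)) =
      ∑ i ∈ Finset.Icc 1 N, ∑ l ∈ Finset.Icc 1 N, Rhat q i l c d •
        ∑ j ∈ Finset.Icc 1 N, ∑ k ∈ Finset.Icc 1 N, Rhat q k b j l •
          ((q : ℂ) ^ (2 * (b : ℤ) - 2 * (j : ℤ)) • (z i j * z k a)) := by
    refine Finset.sum_congr rfl fun i _ => ?_
    simp only [Finset.smul_sum, smul_smul]
    rw [← sum_rotate]
    refine Finset.sum_congr rfl fun l _ => Finset.sum_congr rfl fun j _ =>
      Finset.sum_congr rfl fun k _ => ?_
    congr 1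
    ring
  have hR : (∑ i ∈ Finset.Icc 1 N, ∑ j ∈ Finset.Icc 1 N, ∑ k ∈ Finset.Icc 1 N,
      ∑ l ∈ Finset.Icc 1 N,
      ((q : ℂ) ^ (2 * (l : ℤ) - 2 * (i : ℤ)) * Rhat q j l i d * Rhat q a b k l) •
        (z c i * z j k)) =
      ∑ k ∈ Finset.Icc 1 N, ∑ l ∈ Finset.Icc 1 N, Rhat q a b k l •
        ∑ i ∈ Finset.Icc 1 N, ∑ j ∈ Finset.Icc 1 N, Rhat q j l i d •
          ((q : ℂ) ^ (2 * (l : ℤ) - 2 * (i : ℤ)) • (z c i * z j k)) := by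
    simp only [Finset.smul_sum, smul_smul]
    rw [Finset.sum_congr rfl fun i _ => sum_rotate _ _, sum_rotate]
    refine Finset.sum_congr rfl fun k _ => Finset.sum_congr rfl fun l _ =>
      Finset.sum_congr rfl fun i _ => Finset.sum_congr rfl fun j _ => ?_
    congr 1
    ring
  rw [hL, hR, sum_Rhat_lower_smul q hc hd, sum_Rhat_upper_smul q ha hb,
    sum_Rhat_outer_smul q hb hc, sum_Rhat_outer_smul q hb hd, sum_Rhat_outer_smul q ha hd] at key
  simpa [hbd] using key

/-- Rows are interchanged within a block of generators. -/
theorem GrassRels.mul_eq_of_row_lt {q : ℝ} {N r : ℕ} {z : ℕ → ℕ → V}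
    (h : GrassRels q N r z) {a b c d : ℕ} (ha : a ∈ Finset.Icc 1 N) (hb : b ∈ Finset.Icc 1 N)
    (hc : c ∈ Finset.Icc 1 N) (hd : d ∈ Finset.Icc 1 N) (hbd : b ≠ d) (hbc : b ≠ c)
    (had : a ≠ d) (hcd : c < d) :
    ∃ s t : ℂ, z d b * z c a = s • (z c a * z d b) + t • (z c b * z d a) := by
  have key := h.reflection ha hb hc hd hbd
  rw [if_neg hcd.ne, if_neg hbc, if_neg hbc, if_pos hcd, if_neg had, if_neg had] at key
  simp only [zpow_zero, one_smul, add_zero] at key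
  refine ⟨(q : ℂ) ^ (if a = b then (1 : ℤ) else 0),
    (if a < b then (q : ℂ) - (q : ℂ)⁻¹ else 0) - ((q : ℂ) - (q : ℂ)⁻¹), ?_⟩
  rw [eq_sub_of_add_eq key]
  split_ifs <;> module

theorem GrassRels.mul_eq_of_col_lt {q : ℝ} {N r : ℕ} {z : ℕ → ℕ → V}
    (h : GrassRels q N r z) {a b c : ℕ} (ha : a ∈ Finset.Icc 1 N) (hb : b ∈ Finset.Icc 1 N)
    (hc : c ∈ Finset.Icc 1 N) (hbc : b ≠ c) (hac : a ≠ c) (hab : a < b) :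
    z c b * z c a = (q : ℂ) • (z c a * z c b) := by
  have key := h.reflection hb ha hc hc hac
  simpa [hac, hbc, hab.ne', hab.not_gt] using key.symm

end Explicit

namespace QGrassData

variable {q : ℝ} {N r : ℕ} (G : QGrassData q N r)

theorem mem_Bp {b : G.B} : b ∈ G.Bp ↔ G.counit b = 0 := LinearMap.mem_ker

theorem mul_mem_Bp_cube {x y : G.B} (hx : x ∈ G.Bp ^ 2) (hy : y ∈ G.Bp) : x * y ∈ G.Bp ^ 3 := by
  rw [pow_succ]
  exact Submodule.mul_mem_mul hx hy

theorem mul_mem_Bp_cube' {x y : G.B} (hx : x ∈ G.Bp) (hy : y ∈ G.Bp ^ 2) :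
    x * y ∈ G.Bp ^ 3 := by
  rw [pow_succ']
  exact Submodule.mul_mem_mul hx hy

theorem mul_mem_Bp_sq {x y : G.B} (hx : x ∈ G.Bp) (hy : y ∈ G.Bp) : x * y ∈ G.Bp ^ 2 := by
  rw [pow_two]
  exact Submodule.mul_mem_mul hx hy

theorem sub_counit_mem_Bp (b : G.B) : b - algebraMap ℂ G.B (G.counit b) ∈ G.Bp := by
  simp [mem_Bp]

theorem z_mem_Bp {i j : ℕ} (hi : i ∈ Finset.Icc 1 N) (hj : j ∈ Finset.Icc 1 N)
    (h : i = j → i ≤ r) : G.z i j ∈ G.Bp := by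
  rw [mem_Bp, G.counit_z i hi j hj, if_neg]
  rintro ⟨h1, h2⟩
  exact absurd (h h1) h2.not_ge

theorem z_mem_Bp_sq_of_le {i j : ℕ} (hi : i ∈ Finset.Icc 1 N) (hj : j ∈ Finset.Icc 1 N)
    (hir : i ≤ r) (hjr : j ≤ r) : G.z i j ∈ G.Bp ^ 2 := by
  rw [← G.rels.2.2 i hi j hj]
  refine Submodule.smul_mem _ _ (Submodule.sum_mem _ fun n hn => Submodule.smul_mem _ _ ?_)
  exact G.mul_mem_Bp_sq (G.z_mem_Bp hi hn fun _ => hir) (G.z_mem_Bp hn hj fun h => h ▸ hjr)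

theorem z_sub_counit_mem_Bp_sq_of_lt (hq : q ≠ 0) {i k : ℕ} (hi : i ∈ Finset.Icc 1 N)
    (hk : k ∈ Finset.Icc 1 N) (hir : r < i) (hkr : r < k) :
    G.z i k - algebraMap ℂ G.B (G.counit (G.z i k)) ∈ G.Bp ^ 2 := by
  have hq' : (q : ℂ) ≠ 0 := by exact_mod_cast hq
  set e : ℕ → ℂ := fun i => (q : ℂ) ^ (2 * (i : ℤ) - (2 * (N : ℤ) + 1)) with he
  have hwe : ∀ i : ℕ, (q : ℂ) ^ (2 * (N : ℤ) + 1) * (q : ℂ) ^ (-(2 : ℤ) * (i : ℤ)) * e i = 1 := by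
    intro i
    rw [he, ← zpow_add₀ hq', ← zpow_add₀ hq', ← zpow_zero (q : ℂ)]
    congr 1
    ring
  have hε : ∀ n ∈ Finset.Icc 1 N, G.counit (G.z i n) = if n = i then e i else 0 := by
    intro n hn
    rw [G.counit_z i hi n hn]
    simp [he, hir, eq_comm]
  have hε' : ∀ n ∈ Finset.Icc 1 N, G.counit (G.z n k) = if n = k then e k else 0 := by
    intro n hn
    rw [G.counit_z n hn k hk]
    by_cases h : n = k
    · subst h; simp [he, hkr]
    · simp [h]
  have hsum : (q : ℂ) ^ (2 * (N : ℤ) + 1) • ∑ n ∈ Finset.Icc 1 N,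
      (q : ℂ) ^ (-(2 : ℤ) * (n : ℤ)) •
        ((G.z i n - algebraMap ℂ G.B (G.counit (G.z i n))) *
          (G.z n k - algebraMap ℂ G.B (G.counit (G.z n k)))) =
      -(G.z i k - algebraMap ℂ G.B (G.counit (G.z i k))) := by
    have hterm : ∀ n ∈ Finset.Icc 1 N, (q : ℂ) ^ (-(2 : ℤ) * (n : ℤ)) •
        ((G.z i n - algebraMap ℂ G.B (G.counit (G.z i n))) *
          (G.z n k - algebraMap ℂ G.B (G.counit (G.z n k)))) =
        (q : ℂ) ^ (-(2 : ℤ) * (n : ℤ)) • (G.z i n * G.z n k)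
        - (if n = i then ((q : ℂ) ^ (-(2 : ℤ) * (i : ℤ)) * e i) • G.z i k else 0)
        - (if n = k then ((q : ℂ) ^ (-(2 : ℤ) * (k : ℤ)) * e k) • G.z i k else 0)
        + (if n = i then ((q : ℂ) ^ (-(2 : ℤ) * (i : ℤ)) * e i) •
            algebraMap ℂ G.B (G.counit (G.z i k)) else 0) := by
      intro n hn
      rw [hε n hn, hε' n hn, hε' i hi]
      simp only [Algebra.algebraMap_eq_smul_one, sub_mul, mul_sub, smul_mul_assoc, one_mul,
        mul_smul_comm, mul_one]
      by_cases h1 : n = i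
      · subst h1
        by_cases h2 : n = k
        · subst h2; simp only [if_true]; module
        · simp only [if_true, if_neg h2]; module
      · by_cases h2 : n = k
        · subst h2; simp only [if_true, if_neg h1]; module
        · simp only [if_neg h1, if_neg h2]; module
    rw [Finset.sum_congr rfl hterm, Finset.sum_add_distrib, Finset.sum_sub_distrib,
      Finset.sum_sub_distrib, Finset.sum_ite_eq', Finset.sum_ite_eq', Finset.sum_ite_eq',
      if_pos hi, if_pos hk, if_pos hi, smul_add, smul_sub, smul_sub, G.rels.2.2 i hi k hk, smul_smul,
      smul_smul, smul_smul, ← mul_assoc, ← mul_assoc, hwe, hwe, one_smul, one_smul]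
    abel
  rw [← neg_mem_iff, ← hsum]
  exact Submodule.smul_mem _ _ (Submodule.sum_mem _ fun n _ => Submodule.smul_mem _ _
    (G.mul_mem_Bp_sq (G.sub_counit_mem_Bp _) (G.sub_counit_mem_Bp _)))

/-- The span of the products of a generator `z_{ij}` with `i ≤ r < j` and a generator `z_{kl}`
with `l ≤ r < k`, modulo `(B⁺)³`. -/
def mixedSpan : Submodule ℂ G.B :=
  Submodule.span ℂ {m | ∃ i ∈ Finset.Icc 1 N, ∃ j ∈ Finset.Icc 1 N, ∃ k ∈ Finset.Icc 1 N,
    ∃ l ∈ Finset.Icc 1 N, (i ≤ r ∧ r < j ∧ r < k ∧ l ≤ r) ∧ G.z i j * G.z k l = m} ⊔ G.Bp ^ 3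

theorem z_mul_z_mem_mixedSpan_of_le {i n k : ℕ} (hi : i ∈ Finset.Icc 1 N)
    (hn : n ∈ Finset.Icc 1 N) (hk : k ∈ Finset.Icc 1 N) (hir : i ≤ r) (hkr : k ≤ r) :
    G.z i n * G.z n k ∈ G.mixedSpan := by
  rcases le_or_gt n r with hnr | hnr
  · exact Submodule.mem_sup_right (G.mul_mem_Bp_cube (G.z_mem_Bp_sq_of_le hi hn hir hnr)
      (G.z_mem_Bp hn hk fun _ => hnr))
  · exact Submodule.mem_sup_left (Submodule.subset_span
      ⟨i, hi, n, hn, n, hn, k, hk, ⟨hir, hnr, hnr, hkr⟩, rfl⟩)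

theorem z_mem_mixedSpan_of_le {i k : ℕ} (hi : i ∈ Finset.Icc 1 N) (hk : k ∈ Finset.Icc 1 N)
    (hir : i ≤ r) (hkr : k ≤ r) : G.z i k ∈ G.mixedSpan := by
  rw [← G.rels.2.2 i hi k hk]
  exact Submodule.smul_mem _ _ (Submodule.sum_mem _ fun n hn => Submodule.smul_mem _ _
    (G.z_mul_z_mem_mixedSpan_of_le hi hn hk hir hkr))

theorem z_mul_z_mem_mixedSpan (hq : q ≠ 0) {a b c d : ℕ} (ha : a ∈ Finset.Icc 1 N)
    (hb : b ∈ Finset.Icc 1 N) (hc : c ∈ Finset.Icc 1 N) (hd : d ∈ Finset.Icc 1 N)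
    (har : a ≤ r) (hbr : r < b) (hcr : r < c) (hdr : d ≤ r) :
    G.z c a * G.z d b ∈ G.mixedSpan := by
  have hq' : (q : ℂ) ≠ 0 := by exact_mod_cast hq
  induction d using Nat.strong_induction_on generalizing a with
  | _ d ih =>
  have key := G.rels.reflection ha hb hc hd (by omega)
  rw [if_neg (show ¬ c = d by omega), if_neg (show ¬ c < d by omega),
    if_neg (show ¬ a = b by omega), if_pos (show a < b by omega)] at key
  simp only [zpow_zero, one_smul, add_zero] at key
  have h1 : (((q : ℂ) ^ (if b = c then (1 : ℤ) else 0)) • (G.z d b * G.z c a) +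
      if b = c then ((q : ℂ) - (q : ℂ)⁻¹) • ∑ j ∈ Finset.Ico 1 b,
        ((q : ℂ) ^ (2 * (b : ℤ) - 2 * (j : ℤ))) • (G.z d j * G.z j a) else 0) ∈
      G.mixedSpan := by
    refine add_mem (Submodule.smul_mem _ _ (Submodule.mem_sup_left (Submodule.subset_span
      ⟨d, hd, b, hb, c, hc, a, ha, ⟨hdr, hbr, hcr, har⟩, rfl⟩))) ?_
    split_ifs
    · refine Submodule.smul_mem _ _ (Submodule.sum_mem _ fun j hj => Submodule.smul_mem _ _ ?_)
      simp only [Finset.mem_Ico, Finset.mem_Icc] at *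
      exact G.z_mul_z_mem_mixedSpan_of_le (by simp; omega) (by simp; omega) (by simp; omega)
        hdr har
    · exact zero_mem _
  have h2 : (if a = d then ((q : ℂ) - (q : ℂ)⁻¹) • ∑ i ∈ Finset.Ico 1 a,
      ((q : ℂ) ^ (2 * (a : ℤ) - 2 * (i : ℤ))) • (G.z c i * G.z i b) else 0) ∈
      G.mixedSpan := by
    split_ifs with had
    · refine Submodule.smul_mem _ _ (Submodule.sum_mem _ fun j hj => Submodule.smul_mem _ _ ?_)
      have hj' : j ∈ Finset.Icc 1 N := by
        simp only [Finset.mem_Ico, Finset.mem_Icc] at *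
        omega
      rw [Finset.mem_Ico] at hj
      exact ih j (by omega) hj' hj' (by omega) (by omega)
    · exact zero_mem _
  have h3 : G.z c b * G.z d a ∈ G.mixedSpan := by
    rw [← sub_add_cancel (G.z c b) (algebraMap ℂ G.B (G.counit (G.z c b))), add_mul,
      ← Algebra.smul_def]
    exact add_mem (Submodule.mem_sup_right (G.mul_mem_Bp_cube' (G.sub_counit_mem_Bp _)
      (G.z_mem_Bp_sq_of_le hd ha hdr har)))
      (Submodule.smul_mem _ _ (G.z_mem_mixedSpan_of_le hd ha hdr har))
  rw [key, Submodule.add_mem_iff_left _ (Submodule.smul_mem _ _ h3),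
    Submodule.add_mem_iff_left _ h2] at h1
  exact (Submodule.smul_mem_iff _ (zpow_ne_zero _ hq')).1 h1

/-- The generators `z_{ij}` with exactly one index in `{1,…,r}`, in the order
in which ordered monomials are formed. -/
def offDiagonal : (Fin r ×ₗ Fin (N - r)) ⊕ₗ (Fin (N - r) ×ₗ Fin r) → G.B := fun t =>
  Sum.elim (fun p => G.z ((ofLex p).1 + 1) (r + (ofLex p).2 + 1))
    (fun p => G.z (r + (ofLex p).1 + 1) ((ofLex p).2 + 1)) (ofLex t)

theorem exists_offDiagonal_inl {i j : ℕ} (hi : i ∈ Finset.Icc 1 N) (hj : j ∈ Finset.Icc 1 N)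
    (hir : i ≤ r) (hjr : r < j) : ∃ p, G.offDiagonal (toLex (Sum.inl p)) = G.z i j := by
  rw [Finset.mem_Icc] at hi hj
  refine ⟨toLex (⟨i - 1, by omega⟩, ⟨j - r - 1, by omega⟩), ?_⟩
  simp only [offDiagonal, ofLex_toLex, Sum.elim_inl]
  congr 1 <;> omega

theorem exists_offDiagonal_inr {i j : ℕ} (hi : i ∈ Finset.Icc 1 N) (hj : j ∈ Finset.Icc 1 N)
    (hir : r < i) (hjr : j ≤ r) : ∃ p, G.offDiagonal (toLex (Sum.inr p)) = G.z i j := by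
  rw [Finset.mem_Icc] at hi hj
  refine ⟨toLex (⟨i - r - 1, by omega⟩, ⟨j - 1, by omega⟩), ?_⟩
  simp only [offDiagonal, ofLex_toLex, Sum.elim_inr]
  congr 1 <;> omega

theorem offDiagonal_mem_Bp (hr : r ≤ N) (t) : G.offDiagonal t ∈ G.Bp := by
  induction t with | _ t =>
  rcases t with ⟨i, j⟩ | ⟨i, j⟩
  · exact G.z_mem_Bp (by simp; omega) (by simp; omega) (by simp)
  · exact G.z_mem_Bp (by simp; omega) (by simp; omega) (by simp; omega)

theorem z_sub_counit_mem_span_sup (hq : q ≠ 0) {i j : ℕ} (hi : i ∈ Finset.Icc 1 N)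
    (hj : j ∈ Finset.Icc 1 N) : G.z i j - algebraMap ℂ G.B (G.counit (G.z i j)) ∈
      Submodule.span ℂ (Set.range G.offDiagonal) ⊔ G.Bp ^ 2 := by
  rcases le_or_gt i r with hir | hir <;> rcases le_or_gt j r with hjr | hjr
  · rw [(G.mem_Bp).1 (G.z_mem_Bp hi hj fun _ => hir), map_zero, sub_zero]
    exact Submodule.mem_sup_right (G.z_mem_Bp_sq_of_le hi hj hir hjr)
  · rw [(G.mem_Bp).1 (G.z_mem_Bp hi hj fun _ => hir), map_zero, sub_zero]
    obtain ⟨p, hp⟩ := G.exists_offDiagonal_inl hi hj hir hjr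
    exact Submodule.mem_sup_left (Submodule.subset_span ⟨_, hp⟩)
  · rw [(G.mem_Bp).1 (G.z_mem_Bp hi hj fun h => h ▸ hjr), map_zero, sub_zero]
    obtain ⟨p, hp⟩ := G.exists_offDiagonal_inr hi hj hir hjr
    exact Submodule.mem_sup_left (Submodule.subset_span ⟨_, hp⟩)
  · exact Submodule.mem_sup_right (G.z_sub_counit_mem_Bp_sq_of_lt hq hi hj hir hjr)

theorem Bp_le_span_sup (hq : q ≠ 0) :
    G.Bp ≤ Submodule.span ℂ (Set.range G.offDiagonal) ⊔ G.Bp ^ 2 := by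
  suffices h : ∀ b : G.B, b - algebraMap ℂ G.B (G.counit b) ∈
      Submodule.span ℂ (Set.range G.offDiagonal) ⊔ G.Bp ^ 2 by
    intro b hb
    simpa [(G.mem_Bp).1 hb] using h b
  intro b
  have hb : b ∈ Algebra.adjoin ℂ
      {x : G.B | ∃ i ∈ Finset.Icc 1 N, ∃ j ∈ Finset.Icc 1 N, x = G.z i j} := by
    rw [G.gen]; trivial
  induction hb using Algebra.adjoin_induction with
  | mem x hx =>
    obtain ⟨i, hi, j, hj, rfl⟩ := hx
    exact G.z_sub_counit_mem_span_sup hq hi hj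
  | algebraMap c => simp
  | add x y _ _ hx hy =>
    have := add_mem hx hy
    rw [map_add, map_add]
    convert this using 1
    abel
  | mul x y _ _ hx hy =>
    have hxy := Submodule.mem_sup_right (S := Submodule.span ℂ (Set.range G.offDiagonal))
      (G.mul_mem_Bp_sq (G.sub_counit_mem_Bp x) (G.sub_counit_mem_Bp y))
    have := add_mem hxy (add_mem (Submodule.smul_mem _ (G.counit x) hy)
      (Submodule.smul_mem _ (G.counit y) hx))
    convert this using 1
    simp only [map_mul, Algebra.algebraMap_eq_smul_one, sub_mul, mul_sub, smul_mul_assoc,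
      one_mul, mul_smul_comm, mul_one]
    module

theorem offDiagonal_mul_mem (hq : q ≠ 0) (hr : r ≤ N) (a b) (hba : b < a) :
    G.offDiagonal a * G.offDiagonal b ∈
      Submodule.span ℂ {m | ∃ c < a, ∃ d, G.offDiagonal c * G.offDiagonal d = m} ⊔ G.Bp ^ 3 := by
  induction a with | _ a =>
  induction b with | _ b =>
  rcases a with ⟨i, j⟩ | ⟨i, j⟩ <;> rcases b with ⟨i', j'⟩ | ⟨i', j'⟩
  · refine Submodule.mem_sup_left ?_
    rcases Prod.Lex.toLex_lt_toLex.1 (Sum.Lex.inl_lt_inl_iff.1 hba) with h | ⟨h, h'⟩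
    · obtain ⟨s, t, hst⟩ := G.rels.mul_eq_of_row_lt (a := r + j' + 1) (b := r + j + 1)
        (c := i' + 1) (d := i + 1) (by simp; omega) (by simp; omega) (by simp; omega)
        (by simp; omega) (by omega) (by omega) (by omega) (by simpa using h)
      refine (congrArg (· ∈ _) hst).mpr (add_mem (Submodule.smul_mem _ _ ?_)
        (Submodule.smul_mem _ _ ?_))
      · exact Submodule.subset_span ⟨_, hba, toLex (Sum.inl (toLex (i, j))), rfl⟩
      · exact Submodule.subset_span ⟨toLex (Sum.inl (toLex (i', j))),
          Sum.Lex.inl_lt_inl_iff.2 (Prod.Lex.toLex_lt_toLex.2 (Or.inl h)),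
          toLex (Sum.inl (toLex (i, j'))), rfl⟩
    · dsimp only at h h'
      subst h
      have hst := G.rels.mul_eq_of_col_lt (a := r + j' + 1) (b := r + j + 1)
        (c := i' + 1) (by simp; omega) (by simp; omega) (by simp; omega)
        (by omega) (by omega) (by simpa using h')
      refine (congrArg (· ∈ _) hst).mpr (Submodule.smul_mem _ _ ?_)
      exact Submodule.subset_span ⟨_, hba, toLex (Sum.inl (toLex (i', j))), rfl⟩
  · exact absurd hba Sum.Lex.not_inr_lt_inl
  · refine (sup_le_sup_right (α := Submodule ℂ G.B) (Submodule.span_mono ?_) _) (G.z_mul_z_mem_mixedSpan hq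
      (by simp; omega) (by simp; omega) (by simp; omega) (by simp; omega)
      (by omega) (by omega) (by omega) (by omega))
    rintro _ ⟨i, hi, j, hj, k, hk, l, hl, ⟨hir, hjr, hkr, hlr⟩, rfl⟩
    obtain ⟨p, hp⟩ := G.exists_offDiagonal_inl hi hj hir hjr
    obtain ⟨p', hp'⟩ := G.exists_offDiagonal_inr hk hl hkr hlr
    exact ⟨_, Sum.Lex.inl_lt_inr p _, toLex (Sum.inr p'), by rw [hp, hp']⟩
  · refine Submodule.mem_sup_left ?_
    rcases Prod.Lex.toLex_lt_toLex.1 (Sum.Lex.inr_lt_inr_iff.1 hba) with h | ⟨h, h'⟩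
    · obtain ⟨s, t, hst⟩ := G.rels.mul_eq_of_row_lt (a := j' + 1) (b := j + 1)
        (c := r + i' + 1) (d := r + i + 1) (by simp; omega) (by simp; omega) (by simp; omega)
        (by simp; omega) (by omega) (by omega) (by omega) (by simpa using h)
      refine (congrArg (· ∈ _) hst).mpr (add_mem (Submodule.smul_mem _ _ ?_)
        (Submodule.smul_mem _ _ ?_))
      · exact Submodule.subset_span ⟨_, hba, toLex (Sum.inr (toLex (i, j))), rfl⟩
      · exact Submodule.subset_span ⟨toLex (Sum.inr (toLex (i', j))),
          Sum.Lex.inr_lt_inr_iff.2 (Prod.Lex.toLex_lt_toLex.2 (Or.inl h)),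
          toLex (Sum.inr (toLex (i, j'))), rfl⟩
    · dsimp only at h h'
      subst h
      have hst := G.rels.mul_eq_of_col_lt (a := j' + 1) (b := j + 1)
        (c := r + i' + 1) (by simp; omega) (by simp; omega) (by simp; omega)
        (by omega) (by omega) (by simpa using h')
      refine (congrArg (· ∈ _) hst).mpr (Submodule.smul_mem _ _ ?_)
      exact Submodule.subset_span ⟨_, hba, toLex (Sum.inr (toLex (i', j))), rfl⟩

end QGrassData

/-- Lemma `ubdim`.  For all `k ≥ 0`,
`dim (B⁺)^k/(B⁺)^{k+1} ≤ C(2r(N-r)+k-1, k)`. -/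
theorem rank_Bplus_pow_quotient_le
    (q : ℝ) (hq₁ : q ≠ -1) (hq₂ : q ≠ 0) (hq₃ : q ≠ 1)
    (N r : ℕ) (hN : 2 ≤ N) (hr1 : 1 ≤ r) (hr2 : r ≤ N - 1)
    (G : QGrassData q N r) (k : ℕ) :
    Module.rank ℂ
        (↥(G.Bp ^ k) ⧸ Submodule.comap (G.Bp ^ k).subtype (G.Bp ^ (k + 1))) ≤
      (Nat.choose (2 * r * (N - r) + k - 1) k : Cardinal) := by
  have hr : r ≤ N := hr2.trans (Nat.sub_le N 1)
  refine (rank_pow_quotient_le (x := G.offDiagonal) (G.offDiagonal_mem_Bp hr)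
    (G.Bp_le_span_sup hq₂) (G.offDiagonal_mul_mem hq₂ hr) k).trans_eq ?_
  have hcard : Fintype.card ((Fin r ×ₗ Fin (N - r)) ⊕ₗ (Fin (N - r) ×ₗ Fin r)) =
      2 * r * (N - r) := by
    simp only [Fintype.card_lex, Fintype.card_sum, Fintype.card_prod, Fintype.card_fin]
    ring
  rw [hcard]
end
end
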